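/- Let q be an odd prime power and fix ε > 0. Then there exists a constant C depending only on q and ε such that for every squarefree monic M ∈ F_q[T], every additive character ψ mod M, and every X a power of q, one has | Σ_{f monic, |f| ≤ X, gcd(f,M)=1} μ(f)·ψ(f̄) | ≤ C·|M|^{3/16 + ε}·X^{25/32}, where f̄ denotes the residue class mod M of an inverse of f modulo M. -/

import Mathlib

open scoped Classical
open Polynomial Filter

/-- The norm `|f| = q ^ deg f` of a polynomial over `F_q`, with `|0| = 0`. -/
noncomputable def pnorm {Fq : Type} [Field Fq] [Fintype Fq] (f : Polynomial Fq) : ℝ :=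
  if f = 0 then 0 else (Fintype.card Fq : ℝ) ^ f.natDegree

/-- The Möbius function of a polynomial: `0` unless `f` is squarefree (in particular `μ 0 = 0`),
and `(-1)^k` for squarefree `f` with `k` distinct monic irreducible factors. -/
noncomputable def pmu {Fq : Type} [Field Fq] (f : Polynomial Fq) : ℤ :=
  if Squarefree f then (-1 : ℤ) ^ Multiset.card (UniqueFactorizationMonoid.normalizedFactors f)
  else 0

open scoped Classical
open Polynomial Filter

namespace FM

/-- Kummer type irreducibility in the form: degree of minimal polynomial. -/
lemma kummer_natDegree {L Λ : Type*} [Field L] [Field Λ] [IsAlgClosed Λ] [Algebra L Λ] (d : ℕ) (hd : 0 < d)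
    (γ : L) (h : ∀ e : ℕ, 0 < e → ∀ y : L, y ^ d = γ ^ e → d ∣ e)
    (τ : Λ) (hτ : τ ^ d = algebraMap L Λ γ) : (minpoly L τ).natDegree = d := by
  have hIntg : IsIntegral L τ := by
    refine ⟨X ^ d - C γ, monic_X_pow_sub_C γ hd.ne', ?_⟩
    simp [hτ]
  have hdvd : minpoly L τ ∣ X ^ d - C γ := minpoly.dvd L τ (by simp [hτ])
  have hle : (minpoly L τ).natDegree ≤ d := by
    have := natDegree_le_of_dvd hdvd (monic_X_pow_sub_C γ hd.ne').ne_zero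
    rwa [natDegree_X_pow_sub_C] at this
  set P := minpoly L τ with hP
  have hmonic : P.Monic := minpoly.monic hIntg
  have hpos : 0 < P.natDegree := minpoly.natDegree_pos hIntg
  have hsplit : (P.map (algebraMap L Λ)).Splits := IsAlgClosed.splits _
  have hc := hsplit.coeff_zero_eq_prod_roots_of_monic (hmonic.map _)
  have hpow : ((P.map (algebraMap L Λ)).roots.prod) ^ d = (algebraMap L Λ γ) ^ P.natDegree := by
    rw [← Multiset.map_id' (P.map (algebraMap L Λ)).roots, ← Multiset.prod_map_pow]
    have hcard : Multiset.card (P.map (algebraMap L Λ)).roots = P.natDegree := by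
      rw [← hsplit.natDegree_eq_card_roots, natDegree_map]
    have : ∀ x ∈ (P.map (algebraMap L Λ)).roots, x ^ d = algebraMap L Λ γ := by
      intro x hx
      have hx' : aeval x P = 0 := by
        have := isRoot_of_mem_roots hx
        simpa [IsRoot, eval_map, aeval_def] using this
      obtain ⟨R, hR⟩ := hdvd
      have h2 : aeval x (X ^ d - C γ) = 0 := by rw [hR]; simp [hx']
      simpa [sub_eq_zero] using h2
    rw [Multiset.map_congr rfl this, Multiset.map_const', Multiset.prod_replicate, hcard]
  have h2 : ((-1) ^ P.natDegree * P.coeff 0) ^ d = γ ^ P.natDegree := by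
    apply (algebraMap L Λ).injective
    rw [map_pow, map_mul, map_pow, map_neg, map_one, map_pow, ← hpow]
    congr 1
    rw [coeff_map] at hc
    rw [hc, natDegree_map, ← mul_assoc, ← mul_pow]
    simp
  have := h _ hpos _ h2
  exact le_antisymm hle (Nat.le_of_dvd hpos this)

lemma hasse_dvd {R : Type*} [CommRing R] (g : R[X]) (n : ℕ) : ∀ (l : ℕ) (f : R[X]),
    g ^ (n - l) ∣ hasseDeriv l (f * g ^ n) := by
  induction n with
  | zero => intro l f; simp
  | succ n ih =>
    intro l f
    rw [pow_succ, ← mul_assoc, hasseDeriv_mul]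
    apply Finset.dvd_sum
    rintro ⟨i, j⟩ hij
    rw [Finset.HasAntidiagonal.mem_antidiagonal] at hij
    simp only at hij ⊢
    rcases Nat.eq_zero_or_pos j with rfl | hj
    · simp only [add_zero] at hij
      subst hij
      rw [hasseDeriv_zero']
      exact (pow_dvd_pow g (by omega : n + 1 - i ≤ (n - i) + 1)).trans
        (by rw [pow_succ]; exact mul_dvd_mul (ih i f) dvd_rfl)
    · exact ((pow_dvd_pow g (by omega : n + 1 - l ≤ n - i)).trans (ih i f)).trans (dvd_mul_right _ _)

/-- A polynomial in `x` and `Y` with small `x`-degree vanishing at `Y = x ^ Q` is zero. -/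
lemma eval_frob_zero {K : Type*} [Field K] (Q : ℕ) (N : K[X][X]) (hN : N.natDegree < Q)
    (h : eval₂ (expand K Q : K[X] →ₐ[K] K[X]).toRingHom X N = 0) : N = 0 := by
  have hQ : 0 < Q := by omega
  ext n0 j0
  by_cases hn0 : n0 < Q
  swap
  · rw [coeff_eq_zero_of_natDegree_lt (p := N) (by omega)]; simp
  rw [eval₂_eq_sum_range' _ hN] at h
  have h1 := congrArg (fun f => f.coeff (j0 * Q + n0)) h
  simp only [finsetSum_coeff, coeff_zero] at h1
  rw [Finset.sum_eq_single n0] at h1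
  · simp only [AlgHom.toRingHom_eq_coe, RingHom.coe_coe, coeff_mul_X_pow] at h1
    rw [coeff_expand_mul hQ] at h1
    simpa using h1
  · intro n hn hne
    simp only [AlgHom.toRingHom_eq_coe, RingHom.coe_coe, coeff_mul_X_pow']
    split_ifs with hle
    · rw [coeff_expand hQ, if_neg]
      rintro ⟨t, ht⟩
      rw [Finset.mem_range] at hn
      apply hne
      have h3 : j0 * Q + n0 = Q * t + n := by omega
      have h4 := congrArg (· % Q) h3
      simp [Nat.add_mod, Nat.mod_eq_of_lt hn0, Nat.mod_eq_of_lt hn] at h4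
      exact h4.symm
    · rfl
  · intro hh; simp at hh; omega

/-- the circulant-like matrix -/
noncomputable def stepMat {B : Type*} [CommRing B] (d : ℕ) (gx gY : B) (A : ℕ → B) : Matrix (Fin d) (Fin d) B :=
  fun j k => if j.1 ≤ k.1 then gx * A (k.1 - j.1) else gY * A (k.1 + d - j.1)

lemma stepMat_mul {B : Type*} [CommRing B] (d : ℕ) (gx gY : B) (A : ℕ → B) (τ : B)
    (hτ : gx * τ ^ d = gY) (j : Fin d) :
    ∑ k, stepMat d gx gY A j k * τ ^ k.1 = gx * τ ^ j.1 * ∑ i ∈ Finset.range d, A i * τ ^ i := by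
  have hj := j.2
  simp only [stepMat]
  rw [Fin.sum_univ_eq_sum_range (fun k => (if j.1 ≤ k then gx * A (k - j.1) else gY * A (k + d - j.1)) * τ ^ k) d]
  rw [Finset.mul_sum]
  -- split the LHS
  have hL : Finset.range d = Finset.range (j.1 + (d - j.1)) := by congr 1; omega
  have hR : Finset.range d = Finset.range ((d - j.1) + j.1) := by congr 1; omega
  conv_lhs => rw [hL, Finset.sum_range_add]
  conv_rhs => rw [hR, Finset.sum_range_add]
  rw [add_comm]
  congr 1
  · apply Finset.sum_congr rfl
    intro i hi
    rw [if_pos (by omega), Nat.add_sub_cancel_left, pow_add]; ring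
  · apply Finset.sum_congr rfl
    intro i hi
    rw [Finset.mem_range] at hi
    rw [if_neg (by omega), ← hτ]
    have h1 : i + d - j.1 = d - j.1 + i := by omega
    rw [h1]
    have h2 : τ ^ d = τ ^ j.1 * τ ^ (d - j.1) := by rw [← pow_add]; congr 1; omega
    rw [h2, pow_add]; ring

lemma stepMat_map {B B' : Type*} [CommRing B] [CommRing B'] (f : B →+* B') (d : ℕ) (gx gY : B) (A : ℕ → B) :
    (stepMat d gx gY A).map f = stepMat d (f gx) (f gY) (fun i => f (A i)) := by
  ext j k
  simp only [stepMat, Matrix.map_apply]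
  split_ifs <;> simp

lemma rootMult_pow {B : Type*} [CommRing B] [IsDomain B] (p : B[X]) (hp : p ≠ 0) (x : B) (n : ℕ) :
    rootMultiplicity x (p ^ n) = n * rootMultiplicity x p := by
  rw [← count_roots, roots_pow, Multiset.count_nsmul, count_roots]

lemma step_indep {K : Type*} [Field K] (Q d w μ D : ℕ) (hd : 0 < d) (hw : d * w + 1 = Q)
    (g : K[X]) (hg : g.Monic) (hdeg : g.natDegree = μ) (hexp : expand K Q g = g ^ Q)
    (hgcd : ∀ e : ℕ, (∀ b : K, d ∣ e * g.rootMultiplicity b) → d ∣ e)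
    (hD : D + μ ≤ w) (A : ℕ → K[X][X]) (hA : ∀ i, (A i).degree < (D : ℕ))
    (h0 : ∑ i ∈ Finset.range d, eval₂ (expand K Q : K[X] →ₐ[K] K[X]).toRingHom X (A i) * (g ^ w) ^ i = 0) :
    ∀ i < d, A i = 0 := by
  set φ : K[X][X] →+* K[X] := eval₂RingHom (expand K Q : K[X] →ₐ[K] K[X]).toRingHom X with hφ
  set gx : K[X][X] := g.map C with hgx
  set gY : K[X][X] := C g with hgY
  have hφx : φ gx = g := by
    simp only [hφ, hgx, coe_eval₂RingHom, eval₂_map]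
    have : ((expand K Q : K[X] →ₐ[K] K[X]).toRingHom.comp C) = C := by
      ext a; simp
    rw [this, eval₂_C_X]
  have hφY : φ gY = g ^ Q := by
    simp only [hφ, hgY, coe_eval₂RingHom, eval₂_C]
    simpa using hexp
  set MM := stepMat d gx gY A with hMM
  have hkey : g * (g ^ w) ^ d = g ^ Q := by rw [← pow_mul, ← pow_succ', mul_comm w d, hw]
  -- determinant specialises to zero
  have hdet0 : φ MM.det = 0 := by
    rw [RingHom.map_det]
    have hmap : φ.mapMatrix MM = stepMat d g (g ^ Q) (fun i => φ (A i)) := by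
      rw [RingHom.mapMatrix_apply, hMM, stepMat_map, hφx, hφY]
    rw [hmap, ← Matrix.exists_mulVec_eq_zero_iff]
    refine ⟨fun k => (g ^ w) ^ k.1, ?_, ?_⟩
    · intro h
      have := congrFun h ⟨0, hd⟩
      simp at this
    · ext1 j
      have := stepMat_mul d g (g ^ Q) (fun i => φ (A i)) (g ^ w) hkey j
      simp only [Matrix.mulVec, dotProduct, Pi.zero_apply]
      rw [this]
      have h0' : ∑ i ∈ Finset.range d, φ (A i) * (g ^ w) ^ i = 0 := h0
      rw [h0', mul_zero]
  have hw1 : 1 ≤ w ∨ D = 0 := by omega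
  rcases hw1 with hw1 | hD0
  swap
  · intro i _
    have := hA i
    rw [hD0] at this
    exact Polynomial.degree_eq_bot.mp (by
      by_contra hne
      have h3 : A i ≠ 0 := fun h => hne (by simp [h])
      rw [degree_eq_natDegree h3] at this
      exact absurd this (by simp))
  have hent : ∀ j k, (MM j k).natDegree ≤ w - 1 := by
    intro j k
    have hAn : ∀ i, (A i).natDegree ≤ D - 1 ∨ A i = 0 := by
      intro i
      by_cases h : A i = 0
      · right; exact h
      · left
        have := hA i
        rw [degree_eq_natDegree h] at this
        have : (A i).natDegree < D := by exact_mod_cast this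
        omega
    have hgxn : gx.natDegree ≤ μ := by rw [← hdeg]; exact natDegree_map_le
    have hD1 : ∀ i, A i ≠ 0 → 1 ≤ D := by
      intro i h
      have := hA i
      rw [degree_eq_natDegree h] at this
      have : (A i).natDegree < D := by exact_mod_cast this
      omega
    simp only [hMM, stepMat]
    split_ifs
    · rcases hAn (k.1 - j.1) with h | h
      · by_cases hz : A (k.1 - j.1) = 0
        · simp [hz]
        · have := hD1 _ hz
          refine natDegree_mul_le.trans ?_
          omega
      · simp [h]
    · rcases hAn (k.1 + d - j.1) with h | h
      · by_cases hz : A (k.1 + d - j.1) = 0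
        · simp [hz]
        · have := hD1 _ hz
          refine natDegree_mul_le.trans ?_
          simp only [hgY, natDegree_C]
          omega
      · simp [h]
  have hdetdeg : MM.det.natDegree < Q := by
    rw [Matrix.det_apply]
    refine lt_of_le_of_lt (natDegree_sum_le_of_forall_le (n := d * (w - 1)) _ _ ?_) ?_
    · intro σ _
      refine (natDegree_smul_le _ _).trans ?_
      refine (natDegree_prod_le _ _).trans ?_
      refine (Finset.sum_le_sum (fun i _ => hent _ _)).trans ?_
      simp
    · have : d * (w - 1) ≤ d * w := Nat.mul_le_mul_left _ (by omega)
      omega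
  have hdet : MM.det = 0 := eval_frob_zero Q _ hdetdeg hdet0
  -- pass to the fraction field
  let L := FractionRing K[X][X]
  let Λ := AlgebraicClosure L
  let ι : K[X][X] →+* L := algebraMap _ _
  have hιinj : Function.Injective ι := IsFractionRing.injective _ _
  have hgx0 : gx ≠ 0 := (hg.map C).ne_zero
  have hgY0 : gY ≠ 0 := by simp only [hgY]; simpa using hg.ne_zero
  let γ : L := ι gY / ι gx
  have hιgx : ι gx ≠ 0 := by rwa [Ne, map_eq_zero_iff ι hιinj]
  have hγ : ∀ e : ℕ, 0 < e → ∀ y : L, y ^ d = γ ^ e → d ∣ e := by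
    intro e _ y hy
    apply hgcd
    intro b
    obtain ⟨a, c, hc, rfl⟩ := IsFractionRing.div_surjective (A := K[X][X]) y
    have hc0 : c ≠ 0 := nonZeroDivisors.ne_zero hc
    have hιc : ι c ≠ 0 := by rwa [Ne, map_eq_zero_iff ι hιinj]
    have heq : a ^ d * gx ^ e = c ^ d * gY ^ e := by
      apply hιinj
      simp only [map_mul, map_pow]
      have hy' : (ι a / ι c) ^ d = (ι gY / ι gx) ^ e := hy
      rw [div_pow, div_pow, div_eq_div_iff (pow_ne_zero _ hιc) (pow_ne_zero _ hιgx)] at hy'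
      rw [hy']; ring
    have ha0 : a ≠ 0 := by
      rintro rfl
      rw [zero_pow hd.ne', zero_mul] at heq
      exact mul_ne_zero (pow_ne_zero _ hc0) (pow_ne_zero _ hgY0) heq.symm
    have hrm := congrArg (rootMultiplicity (C b)) heq
    rw [rootMultiplicity_mul (mul_ne_zero (pow_ne_zero _ ha0) (pow_ne_zero _ hgx0)),
      rootMultiplicity_mul (mul_ne_zero (pow_ne_zero _ hc0) (pow_ne_zero _ hgY0)),
      rootMult_pow _ ha0, rootMult_pow _ hgx0, rootMult_pow _ hc0, rootMult_pow _ hgY0] at hrm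
    have h1 : rootMultiplicity (C b) gY = 0 := rootMultiplicity_C _ _
    have h2 : rootMultiplicity (C b) gx = rootMultiplicity b g := by
      rw [hgx, ← eq_rootMultiplicity_map C_injective]
    rw [h1, h2, mul_zero, add_zero] at hrm
    have h3 : d ∣ d * rootMultiplicity (C b) a + e * rootMultiplicity b g := by
      rw [hrm]; exact dvd_mul_right _ _
    exact (Nat.dvd_add_right (dvd_mul_right _ _)).mp h3
  obtain ⟨τ, hτ⟩ := IsAlgClosed.exists_pow_nat_eq (k := Λ) (algebraMap L Λ γ) hd
  have hmin := kummer_natDegree d hd γ hγ τ hτ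
  have hlin : ∀ v : Fin d → L, (∑ k, algebraMap L Λ (v k) * τ ^ k.1 = 0) → v = 0 := by
    intro v hv
    set p : L[X] := ∑ k : Fin d, C (v k) * X ^ k.1 with hp
    have hpτ : aeval τ p = 0 := by
      rw [hp]; simp only [map_sum, map_mul, aeval_C, map_pow, aeval_X]; exact hv
    have hpdeg : p.degree < (d : ℕ) := by
      rw [hp]
      refine (Polynomial.degree_sum_le _ _).trans_lt ?_
      rw [Finset.sup_lt_iff (by simp)]
      intro k _
      refine (degree_C_mul_X_pow_le _ _).trans_lt ?_
      exact_mod_cast k.2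
    have hp0 : p = 0 := by
      by_contra hne
      have := minpoly.degree_le_of_ne_zero L τ hne hpτ
      rw [degree_eq_natDegree (minpoly.ne_zero (by
        refine ⟨X ^ d - C γ, monic_X_pow_sub_C γ hd.ne', ?_⟩
        simp [hτ])), hmin] at this
      exact absurd (lt_of_le_of_lt this hpdeg) (lt_irrefl _)
    ext k
    have := congrArg (fun f => f.coeff k.1) hp0
    simp only [hp, finsetSum_coeff, coeff_C_mul, coeff_X_pow, coeff_zero] at this
    rw [Finset.sum_eq_single k] at this
    · simpa using this
    · intro b _ hb
      rw [if_neg, mul_zero]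
      intro h; exact hb (Fin.ext h.symm)
    · simp
  have hdetL : (ι.mapMatrix MM).det = 0 := by rw [← RingHom.map_det, hdet, map_zero]
  rw [← Matrix.exists_vecMul_eq_zero_iff] at hdetL
  obtain ⟨v, hv0, hv⟩ := hdetL
  let κ : L →+* Λ := algebraMap L Λ
  have hτ2 : κ (ι gx) * τ ^ d = κ (ι gY) := by
    rw [hτ]
    change κ _ * κ _ = κ _
    rw [← map_mul]; congr 1
    exact mul_div_cancel₀ _ hιgx
  have hprod : (∑ j, κ (v j) * τ ^ j.1) * (∑ i ∈ Finset.range d, κ (ι (A i)) * τ ^ i) = 0 := by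
    have h1 : ∀ j : Fin d, ∑ k, κ (ι (MM j k)) * τ ^ k.1
        = κ (ι gx) * τ ^ j.1 * ∑ i ∈ Finset.range d, κ (ι (A i)) * τ ^ i := by
      intro j
      have := stepMat_mul d (κ (ι gx)) (κ (ι gY)) (fun i => κ (ι (A i))) τ hτ2 j
      rw [← this]
      have h2 := stepMat_map (κ.comp ι) d gx gY A
      apply Finset.sum_congr rfl
      intro k _
      congr 1
      exact congrFun (congrFun h2 j) k
    have h3 : ∑ j, κ (v j) * ∑ k, κ (ι (MM j k)) * τ ^ k.1 = 0 := by
      simp_rw [Finset.mul_sum]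
      rw [Finset.sum_comm]
      apply Finset.sum_eq_zero
      intro k _
      have h4 := congrFun hv k
      simp only [Matrix.vecMul, dotProduct, Pi.zero_apply] at h4
      have h5 := congrArg κ h4
      rw [map_sum, map_zero] at h5
      simp only [map_mul] at h5
      simp_rw [← mul_assoc]
      rw [← Finset.sum_mul]
      have h6 : ∑ i, κ (v i) * κ (ι (MM i k)) = 0 := h5
      rw [h6, zero_mul]
    simp_rw [h1] at h3
    have h7 : κ (ι gx) * ((∑ j, κ (v j) * τ ^ j.1) * (∑ i ∈ Finset.range d, κ (ι (A i)) * τ ^ i)) = 0 := by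
      rw [← h3, Finset.sum_mul, Finset.mul_sum]
      apply Finset.sum_congr rfl
      intro j _; ring
    have h8 : κ (ι gx) ≠ 0 := by rwa [Ne, map_eq_zero]
    exact (mul_eq_zero.mp h7).resolve_left h8
  rcases mul_eq_zero.mp hprod with h | h
  · exact absurd (hlin v h) hv0
  · intro i hi
    rw [← Fin.sum_univ_eq_sum_range (fun i => κ (ι (A i)) * τ ^ i) d] at h
    have := congrFun (hlin (fun i => ι (A i.1)) h) ⟨i, hi⟩
    simp only [Pi.zero_apply] at this
    exact (map_eq_zero_iff ι hιinj).mp this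

end FM

open scoped Classical
open Polynomial Filter

namespace FM

lemma X_sub_C_pow_dvd_of_hasse {K : Type*} [Field K] (f : K[X]) (a : K) (n : ℕ)
    (h : ∀ l < n, (hasseDeriv l f).eval a = 0) : (X - C a) ^ n ∣ f := by
  rw [X_sub_C_pow_dvd_iff, X_pow_dvd_iff]
  intro l hl
  have := h l hl
  rw [← taylor_coeff] at this
  simpa [taylor_apply] using this

theorem stepanov_core {K : Type*} [Field K] (p : ℕ) [Fact p.Prime] [CharP K p] (h : ℕ)
    (Q d w μ D J ℓ : ℕ) (hQ : Q = p ^ h) (hd : 0 < d) (hw : d * w + 1 = Q)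
    (g : K[X]) (hg : g.Monic) (hdeg : g.natDegree = μ) (hexp : expand K Q g = g ^ Q)
    (hgcd : ∀ e : ℕ, (∀ b : K, d ∣ e * g.rootMultiplicity b) → d ∣ e)
    (hD : D + μ ≤ w) (hℓ : ℓ ≤ Q) (hcount : ℓ * (D + μ * ℓ + J) < d * (J * D))
    (z : K) (S : Finset K) (hS : ∀ a ∈ S, a ^ Q = a ∧ g.eval a ^ w = z) :
    S.card * ℓ ≤ J * Q + μ * (Q + ℓ) := by
  have hσ : ∀ l i n : ℕ, ∃ σ : K[X], l < ℓ →
      (hasseDeriv l (X ^ n * g ^ (i * w + ℓ)) = g ^ (i * w) * σ ∧ σ.natDegree ≤ n + μ * ℓ) := by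
    intro l i n
    by_cases hl : l < ℓ
    · have h1 := hasse_dvd g (i * w + ℓ) l (X ^ n)
      obtain ⟨σ, hσ⟩ := (pow_dvd_pow g (by omega : i * w ≤ i * w + ℓ - l)).trans h1
      refine ⟨σ, fun _ => ⟨hσ, ?_⟩⟩
      by_cases hs : σ = 0
      · simp [hs]
      have h2 : (g ^ (i * w) * σ).natDegree = i * w * μ + σ.natDegree := by
        rw [Polynomial.natDegree_mul (pow_ne_zero _ hg.ne_zero) hs, natDegree_pow, hdeg]
      have h3 := natDegree_hasseDeriv_le (X ^ n * g ^ (i * w + ℓ)) l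
      have h4 : (X ^ n * g ^ (i * w + ℓ)).natDegree ≤ n + (i * w + ℓ) * μ := by
        refine natDegree_mul_le.trans ?_
        rw [natDegree_X_pow, natDegree_pow, hdeg]
      rw [hσ, h2] at h3
      have h5 : (i * w + ℓ) * μ = i * w * μ + μ * ℓ := by ring
      omega
    · exact ⟨0, fun h => absurd h hl⟩
  choose σ hσ using hσ
  let V := Fin d × Fin J × Fin D
  let B : ℕ → V → K[X] := fun l v => C (z ^ v.1.1) * σ l v.1.1 v.2.2.1 * X ^ v.2.1.1
  let Φ : (V → K) →ₗ[K] (Fin ℓ × Fin (D + μ * ℓ + J) → K) :=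
    { toFun := fun r lm => ∑ v, r v * (B lm.1.1 v).coeff lm.2.1
      map_add' := by
        intro r s; ext lm; simp [add_mul, Finset.sum_add_distrib]
      map_smul' := by
        intro c r; ext lm; simp [Finset.mul_sum, mul_assoc] }
  have hker : LinearMap.ker Φ ≠ ⊥ := by
    apply LinearMap.ker_ne_bot_of_finrank_lt
    simp only [Module.finrank_fintype_fun_eq_card, V, Fintype.card_prod, Fintype.card_fin]
    exact hcount
  obtain ⟨r, hr, hr0⟩ := Submodule.exists_mem_ne_zero_of_ne_bot hker
  rw [LinearMap.mem_ker] at hr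
  have hBdeg : ∀ l < ℓ, ∀ v, (B l v).natDegree < D + μ * ℓ + J := by
    intro l hl v
    have h1 := (hσ l v.1.1 v.2.2.1 hl).2
    have h2 : (B l v).natDegree ≤ (σ l v.1.1 v.2.2.1).natDegree + v.2.1.1 := by
      refine natDegree_mul_le.trans ?_
      rw [natDegree_X_pow]
      exact Nat.add_le_add_right (natDegree_C_mul_le _ _) _
    have h3 := v.2.1.2
    have h4 := v.2.2.2
    omega
  have hpoly : ∀ l < ℓ, ∑ v, C (r v) * B l v = 0 := by
    intro l hl
    ext m
    rw [finsetSum_coeff, coeff_zero]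
    by_cases hm : m < D + μ * ℓ + J
    · have := congrFun hr (⟨l, hl⟩, ⟨m, hm⟩)
      simp only [coeff_C_mul]
      exact this
    · apply Finset.sum_eq_zero
      intro v _
      rw [coeff_C_mul, coeff_eq_zero_of_natDegree_lt, mul_zero]
      have := hBdeg l hl v
      omega
  let F : K[X] := ∑ v : V, C (r v) * (X ^ v.2.2.1 * g ^ (v.1.1 * w + ℓ)) * X ^ (v.2.1.1 * Q)
  have hF0 : F ≠ 0 := by
    intro hF
    apply hr0
    let A : ℕ → K[X][X] := fun i => if hi : i < d then
      ∑ jn : Fin J × Fin D, C (C (r (⟨i, hi⟩, jn)) * X ^ jn.1.1) * X ^ jn.2.1 else 0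
    have hA : ∀ i, (A i).degree < (D : ℕ) := by
      intro i
      simp only [A]
      split_ifs with hi
      · refine (Polynomial.degree_sum_le _ _).trans_lt ?_
        rw [Finset.sup_lt_iff (by exact_mod_cast WithBot.bot_lt_coe D)]
        intro jn _
        refine (degree_C_mul_X_pow_le _ _).trans_lt ?_
        exact_mod_cast jn.2.2
      · rw [degree_zero]; exact WithBot.bot_lt_coe D
    have hA0 := step_indep Q d w μ D hd hw g hg hdeg hexp hgcd hD A hA (by
      have h1 : g ^ ℓ * ∑ i ∈ Finset.range d, eval₂ (expand K Q : K[X] →ₐ[K] K[X]).toRingHom X (A i) * (g ^ w) ^ i = 0 := by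
        rw [← hF]
        simp only [F, V]
        rw [Fintype.sum_prod_type, ← Fin.sum_univ_eq_sum_range (fun i => eval₂ (expand K Q : K[X] →ₐ[K] K[X]).toRingHom X (A i) * (g ^ w) ^ i) d, Finset.mul_sum]
        apply Finset.sum_congr rfl
        intro i _
        simp only [A, dif_pos i.2]
        rw [eval₂_finsetSum, Finset.sum_mul, Finset.mul_sum]
        apply Finset.sum_congr rfl
        intro jn _
        rw [eval₂_mul, eval₂_C, eval₂_X_pow]
        simp only [AlgHom.toRingHom_eq_coe, RingHom.coe_coe, map_mul, expand_C, map_pow, expand_X]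
        rw [pow_add, ← pow_mul, ← pow_mul, mul_comm Q, mul_comm w]
        ring
      exact (mul_eq_zero.mp h1).resolve_left (pow_ne_zero _ hg.ne_zero))
    ext v
    obtain ⟨i, j, n⟩ := v
    have h1 := hA0 i.1 i.2
    simp only [A, dif_pos i.2] at h1
    have h2 := congrArg (fun f => (f.coeff n.1).coeff j.1) h1
    simp only [finsetSum_coeff, coeff_C_mul, coeff_X_pow, coeff_zero] at h2
    rw [Finset.sum_eq_single (j, n)] at h2
    · simpa using h2
    · rintro ⟨j', n'⟩ _ hne
      by_cases hn : n.1 = n'.1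
      · have hn' : n = n' := Fin.ext hn
        subst hn'
        have hj : j.1 ≠ j'.1 := fun hj => hne (by rw [Fin.ext hj])
        simp [coeff_X_pow, hj]
      · simp [hn]
    · simp
  have hdvd : ∀ a ∈ S, (X - C a) ^ ℓ ∣ F := by
    intro a ha
    obtain ⟨haQ, haz⟩ := hS a ha
    have hfrob : (X : K[X]) ^ Q - C a = (X - C a) ^ Q := by
      rw [hQ, sub_pow_char_pow, ← C_pow, ← hQ, haQ]
    let Fa : K[X] := ∑ v : V, C (r v) * (X ^ v.2.2.1 * g ^ (v.1.1 * w + ℓ)) * C a ^ v.2.1.1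
    have hFa : (X - C a) ^ ℓ ∣ Fa := by
      apply X_sub_C_pow_dvd_of_hasse
      intro l hl
      simp only [Fa]
      rw [map_sum, eval_finsetSum]
      have h1 := congrArg (eval a) (hpoly l hl)
      rw [eval_finsetSum, eval_zero] at h1
      rw [← h1]
      apply Finset.sum_congr rfl
      intro v _
      have h2 : C (r v) * (X ^ v.2.2.1 * g ^ (v.1.1 * w + ℓ)) * C a ^ v.2.1.1
          = (r v * a ^ v.2.1.1) • (X ^ v.2.2.1 * g ^ (v.1.1 * w + ℓ)) := by
        rw [smul_eq_C_mul, C_mul, C_pow]; ring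
      rw [h2, map_smul, (hσ l v.1.1 v.2.2.1 hl).1]
      simp only [B, eval_smul, eval_mul, eval_pow, eval_C, eval_X, smul_eq_mul]
      rw [mul_comm v.1.1 w, pow_mul, haz]
      ring
    have hsub : (X - C a) ^ ℓ ∣ F - Fa := by
      simp only [F, Fa]
      rw [← Finset.sum_sub_distrib]
      apply Finset.dvd_sum
      intro v _
      rw [← mul_sub]
      apply Dvd.dvd.mul_left
      refine (pow_dvd_pow _ hℓ).trans ?_
      rw [← hfrob, mul_comm v.2.1.1 Q, pow_mul]
      exact sub_dvd_pow_sub_pow _ _ _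
    have := dvd_add hsub hFa
    simpa using this
  have hprod : (∏ a ∈ S, (X - C a) ^ ℓ) ∣ F := by
    apply Finset.prod_dvd_of_coprime
    · intro a _ b _ hab
      exact (pairwise_coprime_X_sub_C (Function.injective_id) hab).pow
    · exact hdvd
  have hle := natDegree_le_of_dvd hprod hF0
  rw [natDegree_prod _ _ (fun a _ => pow_ne_zero _ (X_sub_C_ne_zero a))] at hle
  simp only [natDegree_pow, natDegree_X_sub_C, mul_one, Finset.sum_const, smul_eq_mul] at hle
  refine hle.trans ?_
  simp only [F]
  apply natDegree_sum_le_of_forall_le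
  intro v _
  have h1 : (C (r v) * (X ^ v.2.2.1 * g ^ (v.1.1 * w + ℓ)) * X ^ (v.2.1.1 * Q)).natDegree
      ≤ (v.2.2.1 + (v.1.1 * w + ℓ) * μ) + v.2.1.1 * Q := by
    refine natDegree_mul_le.trans ?_
    rw [natDegree_X_pow]
    refine Nat.add_le_add_right ((natDegree_C_mul_le _ _).trans ?_) _
    refine natDegree_mul_le.trans ?_
    rw [natDegree_X_pow, natDegree_pow, hdeg]
  refine h1.trans ?_
  have h2 := v.2.1.2
  have h3 := v.2.2.2
  have h4 : (v.2.1.1 + 1) * Q ≤ J * Q := Nat.mul_le_mul_right _ h2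
  have h5 : v.1.1 * w ≤ d * w := Nat.mul_le_mul_right _ v.1.2.le
  have h6 : (v.1.1 * w + ℓ) * μ ≤ (Q + ℓ) * μ := Nat.mul_le_mul_right _ (by omega)
  have h7 : D ≤ Q := by
    have : w ≤ d * w := Nat.le_mul_of_pos_left _ hd
    omega
  have h8 : μ * (Q + ℓ) = (Q + ℓ) * μ := mul_comm _ _
  have h9 : (v.2.1.1 + 1) * Q = v.2.1.1 * Q + Q := by ring
  omega

end FM

open scoped Classical
open Polynomial Filter

namespace FM

theorem stepanov_sum {K : Type*} [Field K] (p : ℕ) [Fact p.Prime] [CharP K p] (d μ : ℕ) (hd : 0 < d) :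
    ∃ C : ℝ, ∀ (h s Q w : ℕ), s = p ^ h → Q = s ^ 2 → d * w + 1 = Q →
    ∀ g : K[X], g.Monic → g.natDegree = μ → expand K Q g = g ^ Q →
    (∀ e : ℕ, (∀ b : K, d ∣ e * g.rootMultiplicity b) → d ∣ e) →
    ∀ T : Finset K, T.card = Q → (∀ a ∈ T, a ^ Q = a) →
    ∀ Z : Finset K, (∀ z, z ^ d = 1 → z ∈ Z) → Z.card ≤ d →
    ∀ θ : K → ℂ, (∀ z, ‖θ z‖ ≤ 1) → ∑ z ∈ Z, θ z = 0 →
    ‖∑ a ∈ T with g.eval a ≠ 0, θ (g.eval a ^ w)‖ ≤ C * s := by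
  set c : ℕ := d * (μ * d + 1) + 1 with hc
  set s0 : ℕ := d * c + c + c * μ * d + d + 1 with hs0
  refine ⟨(s0 + (c + 2 * μ * d) + μ : ℕ), ?_⟩
  intro h s Q w hs hQ hw g hg hdeg hexp hgcd T hT hTQ Z hZ hZc θ hθ hθ0
  have hspos : 1 ≤ s := by rw [hs]; exact Nat.one_le_pow _ _ (Fact.out (p := p.Prime)).pos
  by_cases hlt : s < s0
  · have h1 : ‖∑ a ∈ T with g.eval a ≠ 0, θ (g.eval a ^ w)‖ ≤ (Q : ℝ) := by
      refine (norm_sum_le _ _).trans ?_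
      refine (Finset.sum_le_sum (fun a _ => hθ _)).trans ?_
      simp only [Finset.sum_const, nsmul_eq_mul, mul_one]
      rw [← hT]
      exact_mod_cast Finset.card_filter_le _ _
    refine h1.trans ?_
    rw [hQ]
    have : s ^ 2 ≤ (s0 + (c + 2 * μ * d) + μ) * s := by
      rw [sq]; exact Nat.mul_le_mul_right _ (by omega)
    exact_mod_cast this
  push Not at hlt
  have hfib : ∀ z, (d : ℝ) * ((T.filter (fun a => g.eval a ^ w = z)).card : ℝ) ≤ Q + ((c + 2 * μ * d : ℕ) : ℝ) * s := by
    intro z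
    have hwμ : μ ≤ w := by
      by_contra hcon
      push Not at hcon
      have h1 : d * w ≤ d * μ := Nat.mul_le_mul_left _ hcon.le
      have h2 : s0 ≤ s ^ 2 := by nlinarith
      have : d * μ ≤ c * μ * d := by nlinarith
      omega
    have h1 := stepanov_core (K := K) p (h * 2) Q d w μ (w - μ) (s + c) (d * s) (by rw [hQ, hs, pow_mul]) hd hw g hg hdeg hexp hgcd
      (by omega) (by rw [hQ, sq]; exact Nat.mul_le_mul_right _ (by omega)) (by
        obtain ⟨t, rfl⟩ := Nat.exists_eq_add_of_le hwμ
        rw [Nat.add_sub_cancel_left]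
        have h2 : d * t + d * μ + 1 = s ^ 2 := by rw [← hQ, ← hw]; ring
        have h3 : s * s0 ≤ s * s := Nat.mul_le_mul_left _ hlt
        have h4 : d * (s * (μ * (d * s) + s + c)) < d * (c * t) := by
          have h5 : d * (s * (μ * (d * s) + s + c)) = (c - 1) * (s * s) + d * c * s := by
            rw [hc, Nat.add_sub_cancel]; ring
          have h6 : d * (c * t) + c * (d * μ) + c = c * (s * s) := by
            rw [← sq, ← h2]; ring
          have h7 : c * (s * s) = (c - 1) * (s * s) + s * s := by
            rw [hc, Nat.add_sub_cancel]; ring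
          have h8 : s * s0 = d * c * s + s * (c + c * μ * d + d + 1) := by rw [hs0]; ring
          have h9 : 1 * (c + c * μ * d + d + 1) ≤ s * (c + c * μ * d + d + 1) := Nat.mul_le_mul_right _ hspos
          have h10 : c * (d * μ) = c * μ * d := by ring
          omega
        have h5 : s * (μ * (d * s) + s + c) < c * t := Nat.lt_of_mul_lt_mul_left h4
        have h6 : d * s * (t + μ * (d * s) + (s + c)) = d * (s * t) + d * (s * (μ * (d * s) + s + c)) := by ring
        have h7 : d * ((s + c) * t) = d * (s * t) + d * (c * t) := by ring
        omega) z (T.filter (fun a => g.eval a ^ w = z)) (by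
        intro a ha
        rw [Finset.mem_filter] at ha
        exact ⟨hTQ a ha.1, ha.2⟩)
    set N := (T.filter (fun a => g.eval a ^ w = z)).card
    have h2 : (d * N) * s ≤ (Q + (c + 2 * μ * d) * s) * s := by
      have e1 : (d * N) * s = N * (d * s) := by ring
      rw [e1]
      refine h1.trans ?_
      rw [hQ]
      nlinarith [Nat.zero_le (μ * s), Nat.mul_le_mul_left (μ * d * s) hspos, Nat.mul_le_mul_left (μ * s * s) hd]
    have h3 : d * N ≤ Q + (c + 2 * μ * d) * s := Nat.le_of_mul_le_mul_right h2 hspos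
    exact_mod_cast h3
  -- fibrewise
  set T' := T.filter (fun a => g.eval a ≠ 0) with hT'
  have hmaps : ∀ a ∈ T', g.eval a ^ w ∈ Z := by
    intro a ha
    rw [hT', Finset.mem_filter] at ha
    apply hZ
    have h1 : g.eval a ^ Q = g.eval a := by
      have := congrArg (eval a) hexp
      rw [expand_eval, hTQ a ha.1, eval_pow] at this
      exact this.symm
    have h2 : g.eval a * (g.eval a ^ w) ^ d = g.eval a * 1 := by
      rw [← pow_mul, ← pow_succ', mul_comm w d, hw, h1, mul_one]
    exact mul_left_cancel₀ ha.2 h2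
  have hcardT' : (Q : ℝ) - μ ≤ T'.card := by
    have h1 : (T.filter (fun a => ¬ (g.eval a ≠ 0))).card ≤ μ := by
      rw [← hdeg]
      refine le_trans ?_ (card_roots' g)
      refine le_trans ?_ (Multiset.toFinset_card_le _)
      apply Finset.card_le_card
      intro a ha
      rw [Finset.mem_filter] at ha
      simp only [Multiset.mem_toFinset, mem_roots hg.ne_zero]
      simpa using ha.2
    have h2 := Finset.card_filter_add_card_filter_not (s := T) (fun a => g.eval a ≠ 0)
    have h3 : Q ≤ T'.card + μ := by rw [← hT, ← h2, hT']; exact Nat.add_le_add_left h1 _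
    have h4 : (Q : ℝ) ≤ T'.card + μ := by exact_mod_cast h3
    linarith
  have hsum : ∑ a ∈ T', θ (g.eval a ^ w) = ∑ z ∈ Z, ((T'.filter (fun a => g.eval a ^ w = z)).card : ℂ) * θ z := by
    rw [← Finset.sum_fiberwise_of_maps_to hmaps]
    apply Finset.sum_congr rfl
    intro z _
    rw [Finset.sum_congr rfl (g := fun _ => θ z)]
    · simp
    · intro a ha
      rw [(Finset.mem_filter.mp ha).2]
  set B : ℝ := (Q + ((c + 2 * μ * d : ℕ) : ℝ) * s) / d with hB
  have hd' : (0 : ℝ) < d := by exact_mod_cast hd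
  have hNB : ∀ z, ((T'.filter (fun a => g.eval a ^ w = z)).card : ℝ) ≤ B := by
    intro z
    rw [hB, le_div_iff₀ hd', mul_comm]
    refine le_trans ?_ (hfib z)
    apply mul_le_mul_of_nonneg_left _ hd'.le
    have : (T'.filter (fun a => g.eval a ^ w = z)).card ≤ (T.filter (fun a => g.eval a ^ w = z)).card := by
      apply Finset.card_le_card
      exact Finset.filter_subset_filter _ (Finset.filter_subset _ _)
    exact_mod_cast this
  have hsum2 : ∑ a ∈ T', θ (g.eval a ^ w) = ∑ z ∈ Z, (((T'.filter (fun a => g.eval a ^ w = z)).card : ℂ) - B) * θ z := by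
    rw [hsum]
    simp_rw [sub_mul]
    rw [Finset.sum_sub_distrib, ← Finset.mul_sum, hθ0, mul_zero, sub_zero]
  rw [hsum2]
  have hB0 : 0 ≤ B := by positivity
  calc ‖∑ z ∈ Z, (((T'.filter (fun a => g.eval a ^ w = z)).card : ℂ) - B) * θ z‖
      ≤ ∑ z ∈ Z, (B - (T'.filter (fun a => g.eval a ^ w = z)).card) := by
        refine (norm_sum_le _ _).trans (Finset.sum_le_sum ?_)
        intro z _
        rw [norm_mul]
        have h1 : ‖(((T'.filter (fun a => g.eval a ^ w = z)).card : ℂ) - B)‖ = B - (T'.filter (fun a => g.eval a ^ w = z)).card := by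
          rw [← Complex.ofReal_natCast, ← Complex.ofReal_sub, Complex.norm_real, Real.norm_eq_abs, abs_sub_comm, abs_of_nonneg]
          linarith [hNB z]
        rw [h1]
        exact mul_le_of_le_one_right (by linarith [hNB z]) (hθ z)
    _ = Z.card * B - T'.card := by
        rw [Finset.sum_sub_distrib, Finset.sum_const, nsmul_eq_mul]
        congr 1
        rw [← Nat.cast_sum, Finset.card_eq_sum_card_fiberwise hmaps]
    _ ≤ d * B - (Q - μ) := by
        have : (Z.card : ℝ) ≤ d := by exact_mod_cast hZc
        have := mul_le_mul_of_nonneg_right this hB0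
        linarith
    _ = ((c + 2 * μ * d : ℕ) : ℝ) * s + μ := by
        rw [hB]; field_simp; ring
    _ ≤ _ := by
        have : (c + 2 * μ * d) * s + μ ≤ (s0 + (c + 2 * μ * d) + μ) * s := by nlinarith
        exact_mod_cast this

end FM

open scoped Classical
open Polynomial Filter

set_option linter.unusedSectionVars false
set_option linter.unusedVariables false
namespace FM

section Basics
variable {F : Type} [Field F] [Fintype F]

/-- polynomials of degree `< n` -/
noncomputable def lt (F : Type) [Field F] [Fintype F] (n : ℕ) : Finset F[X] :=
  Finset.univ.image (fun v : Fin n → F => (((degreeLTEquiv F n).symm v : degreeLT F n) : F[X]))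

/-- monic polynomials of degree `n` -/
noncomputable def mon (F : Type) [Field F] [Fintype F] (n : ℕ) : Finset F[X] :=
  (lt F n).image (fun g => X ^ n + g)

lemma mem_lt {n : ℕ} {f : F[X]} : f ∈ lt F n ↔ f.degree < n := by
  simp only [lt, Finset.mem_image, Finset.mem_univ, true_and]
  constructor
  · rintro ⟨v, rfl⟩
    exact mem_degreeLT.mp ((degreeLTEquiv F n).symm v).2
  · intro h
    exact ⟨degreeLTEquiv F n ⟨f, mem_degreeLT.mpr h⟩, by simp⟩

lemma card_lt (n : ℕ) : (lt F n).card = Fintype.card F ^ n := by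
  rw [lt, Finset.card_image_of_injective]
  · simp
  · intro a b hab
    exact (degreeLTEquiv F n).symm.injective (Subtype.ext hab)

lemma mem_mon {n : ℕ} {f : F[X]} : f ∈ mon F n ↔ f.Monic ∧ f.natDegree = n := by
  simp only [mon, Finset.mem_image, mem_lt]
  constructor
  · rintro ⟨g, hg, rfl⟩
    refine ⟨monic_X_pow_add hg, ?_⟩
    rw [natDegree_add_eq_left_of_degree_lt] <;> simp [hg]
  · rintro ⟨h1, h2⟩
    refine ⟨f - X ^ n, ?_, by ring⟩
    have h3 := degree_sub_lt_left (p := f) (q := X ^ n) (by rw [degree_eq_natDegree h1.ne_zero, h2]; simp) h1.ne_zero (by rw [h1.leadingCoeff]; simp)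
    rwa [degree_eq_natDegree h1.ne_zero, h2] at h3

lemma card_mon (n : ℕ) : (mon F n).card = Fintype.card F ^ n := by
  rw [mon, Finset.card_image_of_injective _ (add_right_injective _), card_lt]

lemma mon_zero : mon F 0 = {1} := by
  ext f
  rw [mem_mon, Finset.mem_singleton]
  constructor
  · rintro ⟨h1, h2⟩
    exact h1.natDegree_eq_zero.mp h2
  · rintro rfl
    simp

lemma mul_mem_mon {i j : ℕ} {f g : F[X]} (hf : f ∈ mon F i) (hg : g ∈ mon F j) : f * g ∈ mon F (i + j) := by
  rw [mem_mon] at *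
  exact ⟨hf.1.mul hg.1, by rw [hf.1.natDegree_mul hg.1, hf.2, hg.2]⟩

/-- monic divisors -/
noncomputable def dv (f : F[X]) : Finset F[X] :=
  ((Finset.range (f.natDegree + 1)).biUnion (mon F)).filter (· ∣ f)

lemma mem_dv {f a : F[X]} (hf : f ≠ 0) : a ∈ dv f ↔ a.Monic ∧ a ∣ f := by
  simp only [dv, Finset.mem_filter, Finset.mem_biUnion, Finset.mem_range, mem_mon]
  constructor
  · rintro ⟨⟨n, _, h1, _⟩, h2⟩; exact ⟨h1, h2⟩
  · rintro ⟨h1, h2⟩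
    exact ⟨⟨a.natDegree, by have := natDegree_le_of_dvd h2 hf; omega, h1, rfl⟩, h2⟩

lemma sum_pairs {β : Type*} [AddCommMonoid β] (n : ℕ) (G : F[X] → F[X] → β) :
    ∑ ij ∈ Finset.HasAntidiagonal.antidiagonal n, ∑ a ∈ mon F ij.1, ∑ c ∈ mon F ij.2, G a c
      = ∑ f ∈ mon F n, ∑ a ∈ dv f, G a (f / a) := by
  have h1 : ∑ ij ∈ Finset.HasAntidiagonal.antidiagonal n, ∑ a ∈ mon F ij.1, ∑ c ∈ mon F ij.2, G a c
    = ∑ x ∈ (Finset.HasAntidiagonal.antidiagonal n).sigma (fun ij => mon F ij.1 ×ˢ mon F ij.2), G x.2.1 x.2.2 := by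
    rw [Finset.sum_sigma]
    apply Finset.sum_congr rfl
    intro ij _
    rw [Finset.sum_product]
  rw [h1, Finset.sum_sigma']
  refine Finset.sum_bij' (fun x _ => ⟨x.2.1 * x.2.2, x.2.1⟩) (fun y _ => ⟨(y.2.natDegree, (y.1 / y.2).natDegree), (y.2, y.1 / y.2)⟩) ?_ ?_ ?_ ?_ ?_
  · rintro ⟨⟨i, k⟩, ⟨a, c⟩⟩ h
    simp only [Finset.mem_sigma, Finset.HasAntidiagonal.mem_antidiagonal, Finset.mem_product] at h ⊢
    have hm := mul_mem_mon h.2.1 h.2.2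
    rw [h.1] at hm
    refine ⟨hm, ?_⟩
    rw [mem_dv (mem_mon.mp hm).1.ne_zero]
    exact ⟨(mem_mon.mp h.2.1).1, dvd_mul_right _ _⟩
  · rintro ⟨f, a⟩ h
    simp only [Finset.mem_sigma, Finset.HasAntidiagonal.mem_antidiagonal, Finset.mem_product] at h ⊢
    obtain ⟨hf, ha⟩ := h
    rw [mem_mon] at hf
    rw [mem_dv hf.1.ne_zero] at ha
    obtain ⟨ha1, c, rfl⟩ := ha
    have hc : c.Monic := ha1.of_mul_monic_left hf.1
    rw [mul_div_cancel_left₀ _ ha1.ne_zero]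
    refine ⟨by rw [← hf.2, ha1.natDegree_mul hc], ?_, ?_⟩ <;> rw [mem_mon] <;> simp [ha1, hc]
  · rintro ⟨⟨i, k⟩, ⟨a, c⟩⟩ h
    simp only [Finset.mem_sigma, Finset.HasAntidiagonal.mem_antidiagonal, Finset.mem_product, mem_mon] at h ⊢
    obtain ⟨h1, ⟨h2, h3⟩, h4, h5⟩ := h
    rw [mul_div_cancel_left₀ _ h2.ne_zero, h3, h5]
  · rintro ⟨f, a⟩ h
    simp only [Finset.mem_sigma] at h
    obtain ⟨hf, ha⟩ := h
    rw [mem_mon] at hf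
    rw [mem_dv hf.1.ne_zero] at ha
    obtain ⟨ha1, c, rfl⟩ := ha
    simp only
    rw [mul_div_cancel_left₀ _ ha1.ne_zero]
  · rintro ⟨⟨i, k⟩, ⟨a, c⟩⟩ h
    simp only [Finset.mem_sigma, Finset.HasAntidiagonal.mem_antidiagonal, Finset.mem_product, mem_mon] at h ⊢
    rw [mul_div_cancel_left₀ _ h.2.1.1.ne_zero]

lemma pmu_one : pmu (1 : F[X]) = 1 := by
  simp [pmu]

lemma pmu_abs_le (f : F[X]) : |pmu f| ≤ 1 := by
  unfold pmu
  split_ifs <;> simp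

lemma pmu_norm_le (f : F[X]) : ‖((pmu f : ℤ) : ℂ)‖ ≤ 1 := by
  have := pmu_abs_le f
  rw [Complex.norm_intCast]
  exact_mod_cast this

lemma pmu_prime_mul (P b : F[X]) (hP : Irreducible P) (hb : b ≠ 0) (h : ¬ P ∣ b) :
    pmu (P * b) = - pmu b := by
  unfold pmu
  have hco : IsRelPrime P b := (hP.isRelPrime_iff_not_dvd).mpr h
  have : Squarefree (P * b) ↔ Squarefree b := by
    rw [squarefree_mul_iff]
    exact ⟨fun h => h.2.2, fun h => ⟨hco, hP.squarefree, h⟩⟩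
  simp only [this]
  split_ifs
  · rw [UniqueFactorizationMonoid.normalizedFactors_mul hP.ne_zero hb,
      UniqueFactorizationMonoid.normalizedFactors_irreducible hP, Multiset.card_add]
    simp [pow_add]
  · simp

lemma pmu_prime_mul_dvd (P b : F[X]) (hP : Irreducible P) (h : P ∣ b) :
    pmu (P * b) = 0 := by
  unfold pmu
  rw [if_neg]
  intro hs
  obtain ⟨c, rfl⟩ := h
  exact hP.not_isUnit (hs P ⟨c, by ring⟩)

lemma exists_monic_irreducible_factor (f : F[X]) (hf : f.Monic) (h1 : f ≠ 1) :
    ∃ P : F[X], P.Monic ∧ Irreducible P ∧ P ∣ f := by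
  obtain ⟨P, hP, hd⟩ := f.exists_monic_irreducible_factor (fun hu => h1 (hf.eq_one_of_isUnit hu))
  exact ⟨P, hP, hd.1, hd.2⟩

lemma sum_pmu_dv (f : F[X]) (hf : f.Monic) : ∑ a ∈ dv f, pmu a = if f = 1 then 1 else 0 := by
  split_ifs with h1
  · subst h1
    have : dv (1 : F[X]) = {1} := by
      ext a
      rw [mem_dv one_ne_zero, Finset.mem_singleton]
      exact ⟨fun h => h.1.eq_one_of_isUnit (isUnit_of_dvd_one h.2), fun h => by subst h; simp⟩
    simp [this, pmu_one]
  · obtain ⟨P, hPm, hP, hPf⟩ := exists_monic_irreducible_factor f hf h1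
    have hf0 := hf.ne_zero
    rw [← Finset.sum_filter_add_sum_filter_not (dv f) (fun a => P ∣ a)]
    have h2 : ∑ a ∈ (dv f).filter (fun a => P ∣ a), pmu a
        = ∑ b ∈ (dv f).filter (fun b => P * b ∣ f), pmu (P * b) := by
      symm
      refine Finset.sum_bij (fun b _ => P * b) ?_ ?_ ?_ ?_
      · intro b hb
        rw [Finset.mem_filter, mem_dv hf0] at hb ⊢
        exact ⟨⟨hPm.mul hb.1.1, hb.2⟩, dvd_mul_right _ _⟩
      · intro b _ b' _ h
        exact mul_left_cancel₀ hP.ne_zero h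
      · intro a ha
        rw [Finset.mem_filter, mem_dv hf0] at ha
        obtain ⟨⟨ham, haf⟩, c, rfl⟩ := ha
        refine ⟨c, ?_, rfl⟩
        rw [Finset.mem_filter, mem_dv hf0]
        exact ⟨⟨hPm.of_mul_monic_left ham, (dvd_mul_left _ _).trans haf⟩, haf⟩
      · intro b _; rfl
    have h3 : ∑ b ∈ (dv f).filter (fun b => P * b ∣ f), pmu (P * b)
        = ∑ b ∈ (dv f).filter (fun b => ¬ P ∣ b), - pmu b := by
      rw [← Finset.sum_filter_add_sum_filter_not ((dv f).filter (fun b => P * b ∣ f)) (fun a => P ∣ a)]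
      rw [Finset.sum_eq_zero, zero_add, Finset.filter_filter]
      · apply Finset.sum_congr
        · ext b
          simp only [Finset.mem_filter, mem_dv hf0]
          constructor
          · rintro ⟨h, _, h'⟩; exact ⟨h, h'⟩
          · rintro ⟨h, h'⟩
            exact ⟨h, (IsCoprime.mul_dvd ((hP.coprime_iff_not_dvd).mpr h') hPf h.2), h'⟩
        · intro b hb
          simp only [Finset.mem_filter, mem_dv hf0] at hb
          exact pmu_prime_mul P b hP hb.1.1.ne_zero hb.2
      · intro b hb
        simp only [Finset.mem_filter] at hb
        exact pmu_prime_mul_dvd P b hP hb.2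
    rw [h2, h3]
    simp

/-- (I1) -/
lemma sum_pmu_pairs (n : ℕ) (W : F[X] → ℂ) :
    ∑ ij ∈ Finset.HasAntidiagonal.antidiagonal n, ∑ a ∈ mon F ij.1, ∑ c ∈ mon F ij.2, (pmu a : ℂ) * W (a * c)
      = if n = 0 then W 1 else 0 := by
  rw [sum_pairs n (fun a c => (pmu a : ℂ) * W (a * c))]
  have h1 : ∀ f ∈ mon F n, ∑ a ∈ dv f, (pmu a : ℂ) * W (a * (f / a)) = if f = 1 then W f else 0 := by
    intro f hf
    rw [mem_mon] at hf
    have h2 : ∀ a ∈ dv f, (pmu a : ℂ) * W (a * (f / a)) = (pmu a : ℂ) * W f := by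
      intro a ha
      rw [mem_dv hf.1.ne_zero] at ha
      obtain ⟨ha1, c, rfl⟩ := ha
      rw [mul_div_cancel_left₀ _ ha1.ne_zero]
    rw [Finset.sum_congr rfl h2, ← Finset.sum_mul, ← Int.cast_sum, sum_pmu_dv f hf.1]
    split_ifs <;> simp
  rw [Finset.sum_congr rfl h1]
  split_ifs with hn
  · subst hn
    simp [mon_zero]
  · apply Finset.sum_eq_zero
    intro f hf
    rw [if_neg]
    rintro rfl
    rw [mem_mon] at hf
    simp at hf
    exact hn hf.symm

end Basics
end FM

open scoped Classical
open Polynomial Filter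
set_option linter.unusedSectionVars false
set_option linter.unusedVariables false
namespace FM

section Basics2
variable {F : Type} [Field F] [Fintype F]
open UniqueFactorizationMonoid

lemma one_lt_q : 1 < Fintype.card F := Fintype.one_lt_card

/-- monic irreducible polynomials of degree at most `n` -/
noncomputable def irr (F : Type) [Field F] [Fintype F] (n : ℕ) : Finset F[X] :=
  ((Finset.range (n + 1)).biUnion (mon F)).filter Irreducible

lemma mem_irr {n : ℕ} {P : F[X]} : P ∈ irr F n ↔ P.Monic ∧ P.natDegree ≤ n ∧ Irreducible P := by
  simp only [irr, Finset.mem_filter, Finset.mem_biUnion, Finset.mem_range, mem_mon]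
  constructor
  · rintro ⟨⟨m, hm, h1, h2⟩, h3⟩; exact ⟨h1, by omega, h3⟩
  · rintro ⟨h1, h2, h3⟩; exact ⟨⟨_, by omega, h1, rfl⟩, h3⟩

lemma monic_of_mem_nf {f P : F[X]} (h : P ∈ normalizedFactors f) : P.Monic := by
  have h1 := normalize_normalized_factor P h
  have h2 := (irreducible_of_normalized_factor P h).ne_zero
  rw [← h1]
  exact Polynomial.monic_normalize h2

lemma natDegree_eq_sum_nf {f : F[X]} (hf : f ≠ 0) :
    f.natDegree = ∑ P ∈ (normalizedFactors f).toFinset, (normalizedFactors f).count P * P.natDegree := by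
  have h1 : f.natDegree = (normalizedFactors f).prod.natDegree :=
    (natDegree_eq_of_degree_eq (degree_eq_degree_of_associated (prod_normalizedFactors hf))).symm
  rw [h1, natDegree_multiset_prod_of_monic _ (fun g hg => monic_of_mem_nf hg), Finset.sum_multiset_map_count]
  simp

lemma pow_dvd_iff_count {f P : F[X]} (hf : f ≠ 0) (hP : Irreducible P) (hPm : P.Monic) (j : ℕ) :
    P ^ j ∣ f ↔ j ≤ (normalizedFactors f).count P := by
  rw [pow_dvd_iff_le_emultiplicity, emultiplicity_eq_count_normalizedFactors hP hf,
    hPm.normalize_eq_self]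
  exact_mod_cast Iff.rfl

lemma count_dvd {f P : F[X]} (hf : f ≠ 0) (hP : Irreducible P) (hPm : P.Monic) {n : ℕ} (hn : f.natDegree ≤ n) :
    ((Finset.Icc 1 n).filter (fun k => P.natDegree ∣ k ∧ P ^ (k / P.natDegree) ∣ f)).card
      = (normalizedFactors f).count P := by
  have hpos : 0 < P.natDegree := hP.natDegree_pos
  have : (Finset.Icc 1 n).filter (fun k => P.natDegree ∣ k ∧ P ^ (k / P.natDegree) ∣ f)
      = (Finset.Icc 1 ((normalizedFactors f).count P)).image (fun j => j * P.natDegree) := by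
    ext k
    simp only [Finset.mem_filter, Finset.mem_Icc, Finset.mem_image]
    constructor
    · rintro ⟨⟨h1, h2⟩, ⟨j, rfl⟩, h3⟩
      rw [Nat.mul_div_cancel_left _ hpos, pow_dvd_iff_count hf hP hPm] at h3
      refine ⟨j, ⟨?_, h3⟩, mul_comm _ _⟩
      rcases Nat.eq_zero_or_pos j with rfl | h
      · simp at h1
      · exact h
    · rintro ⟨j, ⟨h1, h2⟩, rfl⟩
      rw [Nat.mul_div_cancel _ hpos]
      have h3 := (pow_dvd_iff_count hf hP hPm j).mpr h2
      refine ⟨⟨?_, ?_⟩, dvd_mul_left _ _, h3⟩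
      · exact Nat.mul_pos h1 hpos
      · have := natDegree_le_of_dvd h3 hf
        rw [natDegree_pow] at this
        omega
  rw [this, Finset.card_image_of_injective]
  · simp
  · intro a b h
    exact Nat.eq_of_mul_eq_mul_right hpos h

/-- power sums of prime powers -/
noncomputable def pS (χ : F[X] → ℂ) (k : ℕ) : ℂ :=
  ∑ P ∈ (irr F k).filter (fun P => P.natDegree ∣ k), (P.natDegree : ℂ) * χ P ^ (k / P.natDegree)

lemma degree_identity {f : F[X]} (hf : f ≠ 0) {n : ℕ} (hn : f.natDegree = n) :
    (n : ℂ) = ∑ k ∈ Finset.Icc 1 n, ∑ P ∈ (irr F k).filter (fun P => P.natDegree ∣ k),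
      if P ^ (k / P.natDegree) ∣ f then (P.natDegree : ℂ) else 0 := by
  have h1 : ∀ k ∈ Finset.Icc 1 n, ∑ P ∈ (irr F k).filter (fun P => P.natDegree ∣ k),
      (if P ^ (k / P.natDegree) ∣ f then (P.natDegree : ℂ) else 0) =
      ∑ P ∈ irr F n, if P.natDegree ∣ k ∧ P ^ (k / P.natDegree) ∣ f then (P.natDegree : ℂ) else 0 := by
    intro k hk
    rw [Finset.mem_Icc] at hk
    rw [Finset.sum_filter]
    have hsub : irr F k ⊆ irr F n := by
      intro P hP
      rw [mem_irr] at *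
      exact ⟨hP.1, by omega, hP.2.2⟩
    rw [← Finset.sum_subset hsub]
    · apply Finset.sum_congr rfl
      intro P hP
      by_cases h : P.natDegree ∣ k <;> simp [h]
    · intro P hP hP'
      rw [if_neg]
      rintro ⟨h, _⟩
      apply hP'
      rw [mem_irr] at *
      exact ⟨hP.1, Nat.le_of_dvd (by omega) h, hP.2.2⟩
  rw [Finset.sum_congr rfl h1, Finset.sum_comm]
  have h2 : ∀ P ∈ irr F n, ∑ k ∈ Finset.Icc 1 n, (if P.natDegree ∣ k ∧ P ^ (k / P.natDegree) ∣ f then (P.natDegree : ℂ) else 0)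
      = (((normalizedFactors f).count P * P.natDegree : ℕ) : ℂ) := by
    intro P hP
    rw [mem_irr] at hP
    rw [← Finset.sum_filter, Finset.sum_const, count_dvd hf hP.2.2 hP.1 hn.le]
    simp
  rw [Finset.sum_congr rfl h2, ← Nat.cast_sum]
  congr 1
  conv_lhs => rw [← hn, natDegree_eq_sum_nf hf]
  apply Finset.sum_subset
  · intro P hP
    rw [Multiset.mem_toFinset] at hP
    rw [mem_irr]
    refine ⟨monic_of_mem_nf hP, ?_, irreducible_of_normalized_factor P hP⟩
    rw [← hn]
    exact natDegree_le_of_dvd (dvd_of_mem_normalizedFactors hP) hf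
  · intro P _ hP
    rw [Multiset.mem_toFinset] at hP
    rw [Multiset.count_eq_zero.mpr hP, zero_mul]

lemma sum_dvd_mon {n i : ℕ} {Q : F[X]} (hQ : Q ∈ mon F i) (hi : i ≤ n) (W : F[X] → ℂ) :
    ∑ f ∈ mon F n, (if Q ∣ f then W f else 0) = ∑ g ∈ mon F (n - i), W (Q * g) := by
  rw [← Finset.sum_filter]
  symm
  refine Finset.sum_bij (fun g _ => Q * g) ?_ ?_ ?_ ?_
  · intro g hg
    rw [Finset.mem_filter]
    have := mul_mem_mon hQ hg
    rw [Nat.add_sub_cancel' hi] at this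
    exact ⟨this, dvd_mul_right _ _⟩
  · intro a _ b _ h
    exact mul_left_cancel₀ (mem_mon.mp hQ).1.ne_zero h
  · intro f hf
    rw [Finset.mem_filter, mem_mon] at hf
    obtain ⟨⟨h1, h2⟩, g, rfl⟩ := hf
    have hg : g.Monic := (mem_mon.mp hQ).1.of_mul_monic_left h1
    refine ⟨g, ?_, rfl⟩
    rw [mem_mon]
    rw [(mem_mon.mp hQ).1.natDegree_mul hg, (mem_mon.mp hQ).2] at h2
    exact ⟨hg, by omega⟩
  · intros; rfl

/-- (I2) -/
lemma newton_L (χ : F[X] → ℂ) (hχ : ∀ f g, χ (f * g) = χ f * χ g) (h1 : χ 1 = 1) (n : ℕ) :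
    (n : ℂ) * ∑ f ∈ mon F n, χ f = ∑ k ∈ Finset.Icc 1 n, pS χ k * ∑ g ∈ mon F (n - k), χ g := by
  have hpow : ∀ (P : F[X]) (j : ℕ), χ (P ^ j) = χ P ^ j := by
    intro P j
    induction j with
    | zero => simp [h1]
    | succ j ih => rw [pow_succ, hχ, ih, pow_succ]
  rw [Finset.mul_sum]
  have h2 : ∀ f ∈ mon F n, (n : ℂ) * χ f = ∑ k ∈ Finset.Icc 1 n, ∑ P ∈ (irr F k).filter (fun P => P.natDegree ∣ k),
      (P.natDegree : ℂ) * (if P ^ (k / P.natDegree) ∣ f then χ f else 0) := by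
    intro f hf
    rw [mem_mon] at hf
    conv_lhs => rw [degree_identity hf.1.ne_zero hf.2, Finset.sum_mul]
    apply Finset.sum_congr rfl
    intro k _
    rw [Finset.sum_mul]
    apply Finset.sum_congr rfl
    intro P _
    split_ifs <;> simp
  rw [Finset.sum_congr rfl h2, Finset.sum_comm]
  apply Finset.sum_congr rfl
  intro k hk
  rw [Finset.mem_Icc] at hk
  rw [Finset.sum_comm, pS, Finset.sum_mul]
  apply Finset.sum_congr rfl
  intro P hP
  rw [Finset.mem_filter, mem_irr] at hP
  rw [← Finset.mul_sum, sum_dvd_mon (i := k) _ hk.2, mul_assoc, Finset.mul_sum]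
  · simp_rw [hχ, hpow, Finset.mul_sum]
  · rw [mem_mon]
    exact ⟨hP.1.1.pow _, by rw [natDegree_pow, Nat.div_mul_cancel hP.2]⟩

lemma card_dv_le {f : F[X]} (hf : f ≠ 0) :
    (dv f).card ≤ ∏ P ∈ (normalizedFactors f).toFinset, ((normalizedFactors f).count P + 1) := by
  rw [← Multiset.card_Iic]
  apply Finset.card_le_card_of_injOn normalizedFactors
  · intro a ha
    rw [Finset.mem_coe, mem_dv hf] at ha
    rw [Finset.mem_coe, Finset.mem_Iic]
    exact (dvd_iff_normalizedFactors_le_normalizedFactors ha.1.ne_zero hf).mp ha.2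
  · intro a ha b hb hab
    rw [Finset.mem_coe, mem_dv hf] at ha hb
    have := (associated_iff_normalizedFactors_eq_normalizedFactors ha.1.ne_zero hb.1.ne_zero).mpr hab
    exact eq_of_monic_of_associated ha.1 hb.1 this

theorem dv_bound (F : Type) [Field F] [Fintype F] (ε : ℝ) (hε : 0 < ε) : ∃ C : ℝ, 1 ≤ C ∧ ∀ f : F[X], f ≠ 0 →
    ((dv f).card : ℝ) ≤ C * (Fintype.card F : ℝ) ^ (ε * f.natDegree) := by
  have hq : (1 : ℝ) < Fintype.card F := by exact_mod_cast (one_lt_q (F := F))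
  set q : ℝ := (Fintype.card F : ℝ)
  set y : ℝ := q ^ ε with hy
  have hy1 : 1 < y := Real.one_lt_rpow hq hε
  set C0 : ℝ := 1 + 1 / (y - 1) with hC0
  have hym : 0 < y - 1 := by linarith
  have hC01 : 1 ≤ C0 := by
    have : 0 < 1 / (y - 1) := by positivity
    linarith
  obtain ⟨Kd, hKd⟩ := pow_unbounded_of_one_lt 2 hy1
  have hbern : ∀ e : ℕ, (e : ℝ) + 1 ≤ C0 * y ^ e := by
    intro e
    have h1 := one_add_mul_le_pow (a := y - 1) (by linarith) e
    have h2 : 1 + (y - 1) = y := by ring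
    rw [h2] at h1
    calc (e : ℝ) + 1 ≤ C0 * (1 + e * (y - 1)) := by
          have h3 : C0 * (1 + e * (y - 1)) = 1 + e * (y - 1) + 1 / (y - 1) + e := by
            rw [hC0]; field_simp; ring
          rw [h3]
          have : 0 ≤ (e : ℝ) * (y - 1) := by positivity
          have : 0 < 1 / (y - 1) := by positivity
          linarith
      _ ≤ _ := by gcongr
  refine ⟨C0 ^ (irr F Kd).card, one_le_pow₀ hC01, ?_⟩
  intro f hf
  set s := normalizedFactors f
  have hterm : ∀ P ∈ s.toFinset, ((s.count P : ℝ) + 1) ≤ (if P ∈ irr F Kd then C0 else 1) * y ^ (s.count P * P.natDegree) := by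
    intro P hP
    rw [Multiset.mem_toFinset] at hP
    have hPi := irreducible_of_normalized_factor P hP
    have hPm := monic_of_mem_nf hP
    split_ifs with h
    · refine (hbern _).trans ?_
      apply mul_le_mul_of_nonneg_left _ (by linarith)
      exact pow_le_pow_right₀ hy1.le (Nat.le_mul_of_pos_right _ hPi.natDegree_pos)
    · have hdeg : Kd ≤ P.natDegree := by
        by_contra hcon
        exact h (mem_irr.mpr ⟨hPm, by omega, hPi⟩)
      rw [one_mul, mul_comm, pow_mul]
      have h1 : (2 : ℝ) ≤ y ^ P.natDegree := hKd.le.trans (pow_le_pow_right₀ hy1.le hdeg)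
      have h2 : ((s.count P : ℝ) + 1) ≤ 2 ^ (s.count P) := by
        exact_mod_cast (Nat.lt_two_pow_self (n := s.count P))
      exact h2.trans (pow_le_pow_left₀ (by norm_num) h1 _)
  calc ((dv f).card : ℝ) ≤ ∏ P ∈ s.toFinset, ((s.count P : ℝ) + 1) := by
        have := card_dv_le hf
        exact_mod_cast this
    _ ≤ ∏ P ∈ s.toFinset, ((if P ∈ irr F Kd then C0 else 1) * y ^ (s.count P * P.natDegree)) :=
        Finset.prod_le_prod (fun _ _ => by positivity) hterm
    _ = (∏ P ∈ s.toFinset, (if P ∈ irr F Kd then C0 else 1)) * y ^ f.natDegree := by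
        rw [Finset.prod_mul_distrib, Finset.prod_pow_eq_pow_sum, natDegree_eq_sum_nf hf]
    _ ≤ C0 ^ (irr F Kd).card * y ^ f.natDegree := by
        apply mul_le_mul_of_nonneg_right _ (by positivity)
        rw [Finset.prod_ite, Finset.prod_const, Finset.prod_const_one, mul_one]
        apply pow_le_pow_right₀ hC01
        apply Finset.card_le_card
        intro P hP
        exact (Finset.mem_filter.mp hP).2
    _ = _ := by
        rw [hy, ← Real.rpow_natCast (q ^ ε), ← Real.rpow_mul (by positivity)]

end Basics2
end FM

open scoped Classical
open Polynomial Filter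
set_option linter.unusedSectionVars false
set_option linter.unusedVariables false
namespace FM

/-- the recursion for coefficients -/
def NRec (L S : ℕ → ℂ) : Prop := ∀ n : ℕ, (n : ℂ) * L n = ∑ k ∈ Finset.Icc 1 n, S k * L (n - k)

lemma NRec.unique {L S S' : ℕ → ℂ} (h0 : L 0 = 1) (h : NRec L S) (h' : NRec L S') :
    ∀ k, 1 ≤ k → S k = S' k := by
  intro k
  induction k using Nat.strong_induction_on with
  | _ n ih =>
    intro hn
    have h1 := h n
    have h2 := h' n
    rw [h1] at h2
    obtain ⟨n, rfl⟩ : ∃ t, n = t + 1 := ⟨n - 1, by omega⟩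
    rw [Finset.sum_Icc_succ_top (by omega), Finset.sum_Icc_succ_top (by omega), Nat.sub_self, h0] at h2
    have h3 : ∑ k ∈ Finset.Icc 1 n, S k * L (n + 1 - k) = ∑ k ∈ Finset.Icc 1 n, S' k * L (n + 1 - k) := by
      apply Finset.sum_congr rfl
      intro k hk
      rw [Finset.mem_Icc] at hk
      rw [ih k (by omega) (by omega)]
    rw [h3] at h2
    simpa using h2

open PowerSeries in
lemma nrec_iff (L S : ℕ → ℂ) : NRec L S ↔
    (PowerSeries.X : PowerSeries ℂ) * PowerSeries.derivative ℂ (PowerSeries.mk L)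
      = PowerSeries.mk (fun k => if k = 0 then 0 else S k) * PowerSeries.mk L := by
  rw [PowerSeries.ext_iff]
  apply forall_congr'
  intro n
  have h1 : (PowerSeries.coeff n) ((PowerSeries.X : PowerSeries ℂ) * PowerSeries.derivative ℂ (PowerSeries.mk L)) = n * L n := by
    cases n with
    | zero => simp
    | succ n =>
      rw [PowerSeries.coeff_succ_X_mul, PowerSeries.coeff_derivative, PowerSeries.coeff_mk]
      push_cast; ring
  rw [h1, PowerSeries.coeff_mul, Finset.Nat.sum_antidiagonal_eq_sum_range_succ_mk]
  have h2 : ∑ k ∈ Finset.range n.succ, (PowerSeries.coeff k) (PowerSeries.mk (fun k => if k = 0 then 0 else S k)) * (PowerSeries.coeff (n - k)) (PowerSeries.mk L)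
      = ∑ k ∈ Finset.Icc 1 n, S k * L (n - k) := by
    simp only [PowerSeries.coeff_mk]
    rw [Finset.sum_range_succ']
    simp only [if_true, zero_mul, add_zero, Nat.succ_ne_zero, if_false]
    rw [Finset.range_eq_Ico, Finset.sum_Ico_add' (fun k => S k * L (n - k)) 0 n 1]
    rfl
  simp only
  rw [h2]

lemma nrec_inv {L A S : ℕ → ℂ} (h : NRec L S)
    (hLA : PowerSeries.mk L * PowerSeries.mk A = 1) : NRec A (fun k => - S k) := by
  rw [nrec_iff] at *
  have e : PowerSeries.mk (fun k => if k = 0 then (0 : ℂ) else - S k) = - PowerSeries.mk (fun k => if k = 0 then 0 else S k) := by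
    ext k; simp only [PowerSeries.coeff_mk, map_neg]; split_ifs <;> simp
  rw [e]
  set l := PowerSeries.mk L
  set a := PowerSeries.mk A
  set s := PowerSeries.mk (fun k => if k = 0 then 0 else S k)
  have h1 : PowerSeries.derivative ℂ (l * a) = 0 := by rw [hLA]; simp
  rw [Derivation.leibniz, smul_eq_mul, smul_eq_mul] at h1
  have h2 : PowerSeries.X * PowerSeries.derivative ℂ a = (l * a) * (PowerSeries.X * PowerSeries.derivative ℂ a) := by rw [hLA, one_mul]
  rw [h2]
  have h3 : l * PowerSeries.derivative ℂ a = - (a * PowerSeries.derivative ℂ l) := by linear_combination h1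
  calc l * a * (PowerSeries.X * PowerSeries.derivative ℂ a) = a * PowerSeries.X * (l * PowerSeries.derivative ℂ a) := by ring
    _ = - (a * a * (PowerSeries.X * PowerSeries.derivative ℂ l)) := by rw [h3]; ring
    _ = - (a * (l * a) * s) := by rw [h]; ring
    _ = _ := by rw [hLA]; ring

lemma nrec_mul {L S : ℕ → ℂ} (h : NRec L S) (α : ℂ) :
    NRec (fun n => PowerSeries.coeff n (PowerSeries.mk L * (1 - PowerSeries.C α * PowerSeries.X))) (fun k => S k - α ^ k) := by
  rw [nrec_iff] at *
  have e1 : PowerSeries.mk (fun n => PowerSeries.coeff n (PowerSeries.mk L * (1 - PowerSeries.C α * PowerSeries.X))) = PowerSeries.mk L * (1 - PowerSeries.C α * PowerSeries.X) := by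
    ext n; simp
  rw [e1]
  set g : PowerSeries ℂ := PowerSeries.mk (fun k => if k = 0 then (0 : ℂ) else α ^ k) with hg
  have e2 : PowerSeries.mk (fun k => if k = 0 then (0 : ℂ) else S k - α ^ k) = PowerSeries.mk (fun k => if k = 0 then (0 : ℂ) else S k) - g := by
    ext k; simp only [hg, PowerSeries.coeff_mk, map_sub]; split_ifs <;> simp
  have e3 : g * (1 - PowerSeries.C α * PowerSeries.X) = PowerSeries.C α * PowerSeries.X := by
    ext n
    rw [mul_sub, mul_one, map_sub]
    rw [show g * (PowerSeries.C α * PowerSeries.X) = PowerSeries.C α * (g * PowerSeries.X) by ring]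
    rw [PowerSeries.coeff_C_mul, PowerSeries.coeff_C_mul]
    rcases n with _ | n
    · simp [hg]
    · rw [PowerSeries.coeff_succ_mul_X, hg, PowerSeries.coeff_mk, PowerSeries.coeff_mk, PowerSeries.coeff_X]
      rcases n with _ | n
      · simp
      · simp [pow_succ']
  rw [e2, Derivation.leibniz, smul_eq_mul, smul_eq_mul]
  have e4 : PowerSeries.derivative ℂ ((1 : PowerSeries ℂ) - PowerSeries.C α * PowerSeries.X) = - PowerSeries.C α := by
    rw [map_sub, Derivation.leibniz]
    simp
  rw [e4]
  set l := PowerSeries.mk L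
  linear_combination (1 - PowerSeries.C α * PowerSeries.X) * h + l * e3

lemma nrec_multiset (s : Multiset ℂ) :
    NRec (fun n => PowerSeries.coeff n (s.map (fun α => 1 - PowerSeries.C α * PowerSeries.X)).prod) (fun k => - (s.map (fun α => α ^ k)).sum) := by
  induction s using Multiset.induction_on with
  | empty =>
    intro n
    simp only [Multiset.map_zero, Multiset.prod_zero, Multiset.sum_zero, neg_zero, zero_mul, Finset.sum_const_zero]
    rw [PowerSeries.coeff_one]
    split_ifs with h <;> simp [h]
  | cons a s ih =>
    have := nrec_mul ih a
    convert this using 2 with k n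
    · rw [Multiset.map_cons, Multiset.prod_cons, mul_comm]
      congr 2
      ext n; simp
    · simp; ring

lemma exists_alphas {L S : ℕ → ℂ} (h0 : L 0 = 1) (h : NRec L S) (m : ℕ) (hm : ∀ n, m ≤ n → L n = 0) :
    ∃ s : Multiset ℂ, Multiset.card s ≤ m ∧ ∀ k, 1 ≤ k → S k = - (s.map (fun α => α ^ k)).sum := by
  set p : ℂ[X] := ∑ n ∈ Finset.range m, Polynomial.monomial n (L n) with hp
  have hcoeff : ∀ n, p.coeff n = L n := by
    intro n
    rw [hp, finsetSum_coeff]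
    simp only [Polynomial.coeff_monomial]
    rw [Finset.sum_ite_eq']
    split_ifs with hh
    · rfl
    · rw [Finset.mem_range, not_lt] at hh; exact (hm n hh).symm
  have hp0 : p ≠ 0 := by
    intro hh
    have := hcoeff 0
    rw [hh, h0] at this
    simp at this
  have hsplit := (IsAlgClosed.splits p).eq_prod_roots
  have hev : p.eval 0 = 1 := by rw [← coeff_zero_eq_eval_zero, hcoeff, h0]
  have hr0 : ∀ ρ ∈ p.roots, ρ ≠ 0 := by
    rintro ρ hρ rfl
    have := isRoot_of_mem_roots hρ
    rw [IsRoot, hev] at this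
    exact one_ne_zero this
  have hprod : p = (p.roots.map (fun ρ => 1 - Polynomial.C ρ⁻¹ * X)).prod := by
    have h1 : (p.roots.map (fun ρ => X - Polynomial.C ρ)).prod
        = (p.roots.map (fun ρ => Polynomial.C (-ρ))).prod * (p.roots.map (fun ρ => 1 - Polynomial.C ρ⁻¹ * X)).prod := by
      rw [← Multiset.prod_map_mul]
      congr 1
      apply Multiset.map_congr rfl
      intro ρ hρ
      have : Polynomial.C (-ρ) * (1 - Polynomial.C ρ⁻¹ * X) = Polynomial.C (-ρ) - Polynomial.C (-ρ * ρ⁻¹) * X := by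
        rw [C_mul]; ring
      rw [this, neg_mul, mul_inv_cancel₀ (hr0 ρ hρ)]
      simp; ring
    have h2 := congrArg (Polynomial.eval 0) hsplit
    rw [hev, h1] at h2
    rw [h1] at hsplit
    have h3 : (p.roots.map (fun ρ => Polynomial.C (-ρ))).prod = Polynomial.C (p.roots.map (fun ρ => -ρ)).prod := by
      rw [← Multiset.prod_hom, Multiset.map_map]; rfl
    have h4 : Polynomial.eval 0 (p.roots.map (fun ρ => 1 - Polynomial.C ρ⁻¹ * X)).prod = 1 := by
      rw [eval_multiset_prod, Multiset.map_map]
      apply Multiset.prod_eq_one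
      intro x hx
      rw [Multiset.mem_map] at hx
      obtain ⟨ρ, _, rfl⟩ := hx
      simp
    rw [eval_mul, eval_mul, h4, eval_C, h3, eval_C, mul_one] at h2
    rw [h3, ← mul_assoc, ← C_mul, ← h2, C_1, one_mul] at hsplit
    exact hsplit
  refine ⟨p.roots.map (fun ρ => ρ⁻¹), ?_, ?_⟩
  · rw [Multiset.card_map]
    refine (card_roots' p).trans ?_
    rw [hp]
    apply natDegree_sum_le_of_forall_le
    intro n hn
    rw [Finset.mem_range] at hn
    exact (natDegree_monomial_le _).trans hn.le
  · have h5 := nrec_multiset (p.roots.map (fun ρ => ρ⁻¹))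
    have h6 : (fun n => PowerSeries.coeff n ((p.roots.map (fun ρ => ρ⁻¹)).map (fun α => 1 - PowerSeries.C α * PowerSeries.X)).prod) = L := by
      ext n
      rw [← hcoeff n]
      conv_rhs => rw [hprod]
      rw [← Polynomial.coeff_coe]
      congr 1
      have : ∀ f : ℂ[X], (f : PowerSeries ℂ) = Polynomial.coeToPowerSeries.ringHom f := fun f => rfl
      rw [this, map_multiset_prod, Multiset.map_map, Multiset.map_map]
      congr 1
      apply Multiset.map_congr rfl
      intro ρ _
      simp
    rw [h6] at h5
    exact fun k hk => NRec.unique h0 h h5 k hk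

/-- If power sums are bounded then all numbers are in the unit disc. -/
lemma norm_le_one_of_power_sums {ι : Type} [Fintype ι] (β : ι → ℂ) (C : ℝ)
    (h : ∀ n : ℕ, 1 ≤ n → ‖∑ i, β i ^ n‖ ≤ C) (i : ι) : ‖β i‖ ≤ 1 := by
  by_contra hcon
  push Not at hcon
  have hu : ∀ j, ∃ u : Circle, β j = ‖β j‖ * (u : ℂ) := by
    intro j
    by_cases hj : β j = 0
    · exact ⟨1, by simp [hj]⟩
    · refine ⟨Circle.exp (Complex.arg (β j)), ?_⟩
      rw [Circle.coe_exp]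
      exact (Complex.norm_mul_exp_arg_mul_I _).symm
  choose u hu using hu
  obtain ⟨N, hN⟩ := pow_unbounded_of_one_lt (2 * C) hcon
  have hcl := mapClusterPt_one_atTop_pow (u : ι → Circle)
  have hU : ∀ᶠ v in nhds (1 : ι → Circle), ∀ j, 1 / 2 < ((v j : Circle) : ℂ).re := by
    rw [eventually_all]
    intro j
    have hc : Continuous (fun v : ι → Circle => ((v j : Circle) : ℂ).re) := by fun_prop
    have := hc.continuousAt (x := (1 : ι → Circle))
    apply this.eventually (lt_mem_nhds _)
    simp; norm_num
  have hfr := hcl.frequently hU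
  obtain ⟨n, hn, hn2⟩ := (hfr.and_eventually (eventually_ge_atTop (N + 1))).exists
  have h1 := h n (by omega)
  have h2 : (∑ j, β j ^ n).re = ∑ j, ‖β j‖ ^ n * (((u j ^ n : Circle) : ℂ)).re := by
    rw [Complex.re_sum]
    apply Finset.sum_congr rfl
    intro j _
    conv_lhs => rw [hu j, mul_pow]
    rw [← Complex.ofReal_pow, Complex.re_ofReal_mul]
    simp
  have h3 : ‖β i‖ ^ n * (1 / 2) ≤ (∑ j, β j ^ n).re := by
    rw [h2]
    have h4 : ∀ j, 0 ≤ ‖β j‖ ^ n * (((u j ^ n : Circle) : ℂ)).re := by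
      intro j
      have := hn j
      simp only [Pi.pow_apply] at this
      have h5 : 0 ≤ (((u j ^ n : Circle) : ℂ)).re := by linarith
      positivity
    refine le_trans ?_ (Finset.single_le_sum (fun j _ => h4 j) (Finset.mem_univ i))
    have := hn i
    simp only [Pi.pow_apply] at this
    gcongr
  have h5 := (Complex.re_le_norm _).trans h1
  have h6 : ‖β i‖ ^ N ≤ ‖β i‖ ^ n := pow_le_pow_right₀ hcon.le (by omega)
  linarith

/-- From bounds along multiples to bounds for all `k`. -/
lemma S_bound {L S : ℕ → ℂ} (h0 : L 0 = 1) (h : NRec L S) (m : ℕ) (hm : ∀ n, m ≤ n → L n = 0)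
    (q : ℝ) (hq : 0 < q) (r : ℕ) (hr : 0 < r) (C : ℝ)
    (hS : ∀ n, 1 ≤ n → ‖S (r * n)‖ ≤ C * (Real.sqrt q) ^ (r * n)) (k : ℕ) (hk : 1 ≤ k) :
    ‖S k‖ ≤ m * (Real.sqrt q) ^ k := by
  obtain ⟨s, hs, hsk⟩ := exists_alphas h0 h m hm
  have hsq : 0 < Real.sqrt q := Real.sqrt_pos.mpr hq
  have hα : ∀ α ∈ s, ‖α‖ ≤ Real.sqrt q := by
    intro α hα
    let l := s.toList
    have hl : s = (l : Multiset ℂ) := (Multiset.coe_toList s).symm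
    obtain ⟨i, hi, hi2⟩ := List.getElem_of_mem (show α ∈ l from (Multiset.mem_toList).mpr hα)
    have h1 := norm_le_one_of_power_sums (ι := Fin l.length) (fun j => l[j] ^ r / (Real.sqrt q : ℂ) ^ r) C (by
      intro n hn
      have h2 := hS n hn
      rw [hsk _ (by nlinarith), norm_neg, hl, Multiset.map_coe, Multiset.sum_coe] at h2
      have h3 : (∑ j : Fin l.length, (l[j] ^ r / (Real.sqrt q : ℂ) ^ r) ^ n) = (l.map (fun α => α ^ (r * n))).sum / (Real.sqrt q : ℂ) ^ (r * n) := by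
        rw [← Fin.sum_univ_fun_getElem, Finset.sum_div]
        apply Finset.sum_congr rfl
        intro j _
        rw [div_pow, ← pow_mul, ← pow_mul]
        rfl
      rw [h3, norm_div, norm_pow, Complex.norm_real, Real.norm_of_nonneg hsq.le]
      rw [div_le_iff₀ (by positivity)]
      exact h2) ⟨i, hi⟩
    simp only [Fin.getElem_fin, hi2] at h1
    rw [norm_div, norm_pow, norm_pow, Complex.norm_real, Real.norm_of_nonneg hsq.le, div_le_one (by positivity)] at h1
    exact le_of_pow_le_pow_left₀ hr.ne' hsq.le h1
  rw [hsk k hk, norm_neg]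
  refine (norm_multiset_sum_le _).trans ?_
  rw [Multiset.map_map]
  refine (Multiset.sum_le_card_nsmul _ ((Real.sqrt q) ^ k) ?_).trans ?_
  · intro x hx
    rw [Multiset.mem_map] at hx
    obtain ⟨α, ha, rfl⟩ := hx
    simp only [Function.comp, norm_pow]
    exact pow_le_pow_left₀ (norm_nonneg _) (hα α ha) _
  · rw [Multiset.card_map, nsmul_eq_mul]
    have : (Multiset.card s : ℝ) ≤ m := by exact_mod_cast hs
    gcongr

/-- Gronwall type inequality for the recursion. -/
lemma gronwall_rec (c w : ℕ → ℝ) (hc : ∀ n, 0 ≤ c n) (hw : ∀ n, 0 ≤ w n) (hc0 : c 0 ≤ 1)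
    (h : ∀ n : ℕ, (n : ℝ) * c n ≤ ∑ k ∈ Finset.Icc 1 n, w k * c (n - k)) (N : ℕ) :
    c N ≤ Real.exp (∑ k ∈ Finset.Icc 1 N, w k / k) := by
  set f : ℝ → ℝ := fun t => ∑ n ∈ Finset.range (N + 1), c n * t ^ n with hf
  set v : ℝ → ℝ := fun t => ∑ k ∈ Finset.Icc 1 N, w k / k * t ^ k with hv
  have hf' : ∀ t, HasDerivAt f (∑ n ∈ Finset.range (N + 1), c n * (n * t ^ (n - 1))) t := by
    intro t
    apply HasDerivAt.fun_sum
    intro n _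
    exact (hasDerivAt_pow n t).const_mul _
  have hv' : ∀ t, HasDerivAt v (∑ k ∈ Finset.Icc 1 N, w k / k * (k * t ^ (k - 1))) t := by
    intro t
    apply HasDerivAt.fun_sum
    intro n _
    exact (hasDerivAt_pow n t).const_mul _
  have hanti : AntitoneOn (fun t => f t * Real.exp (- v t)) (Set.Icc 0 1) := by
    apply antitoneOn_of_deriv_nonpos (convex_Icc 0 1)
    · intro t _
      exact ((hf' t).continuousAt.mul (hv' t).neg.exp.continuousAt).continuousWithinAt
    · intro t _
      exact ((hf' t).mul (hv' t).neg.exp).differentiableAt.differentiableWithinAt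
    · intro t ht
      rw [interior_Icc] at ht
      have hd := ((hf' t).mul (hv' t).neg.exp).deriv
      have hd' : deriv (fun t => f t * Real.exp (- v t)) t = _ := hd
      rw [hd']
      set f1 := ∑ n ∈ Finset.range (N + 1), c n * (n * t ^ (n - 1)) with hf1
      set v1 := ∑ k ∈ Finset.Icc 1 N, w k / k * (k * t ^ (k - 1)) with hv1
      have hkey : t * f1 ≤ t * (v1 * f t) := by
        have e1 : t * f1 = ∑ n ∈ Finset.range (N + 1), (n * c n) * t ^ n := by
          rw [hf1, Finset.mul_sum]
          apply Finset.sum_congr rfl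
          intro n _
          rcases n with _ | n
          · simp
          · simp only [Nat.add_sub_cancel]; rw [pow_succ]; ring
        have e2 : t * v1 = ∑ k ∈ Finset.Icc 1 N, w k * t ^ k := by
          rw [hv1, Finset.mul_sum]
          apply Finset.sum_congr rfl
          intro k hk
          rw [Finset.mem_Icc] at hk
          obtain ⟨k, rfl⟩ : ∃ j, k = j + 1 := ⟨k - 1, by omega⟩
          have : ((k + 1 : ℕ) : ℝ) ≠ 0 := by positivity
          simp only [Nat.add_sub_cancel]; rw [pow_succ]; field_simp
        rw [← mul_assoc, e1, e2, hf, Finset.sum_mul]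
        calc ∑ n ∈ Finset.range (N + 1), (n * c n) * t ^ n
            ≤ ∑ n ∈ Finset.range (N + 1), (∑ k ∈ Finset.Icc 1 n, w k * c (n - k)) * t ^ n := by
              apply Finset.sum_le_sum
              intro n _
              exact mul_le_mul_of_nonneg_right (h n) (pow_nonneg ht.1.le _)
          _ = ∑ n ∈ Finset.range (N + 1), ∑ k ∈ Finset.Icc 1 N, if k ≤ n then w k * t ^ k * (c (n - k) * t ^ (n - k)) else 0 := by
              apply Finset.sum_congr rfl
              intro n hn
              rw [Finset.mem_range] at hn
              rw [Finset.sum_mul, ← Finset.sum_filter]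
              have : (Finset.Icc 1 N).filter (fun k => k ≤ n) = Finset.Icc 1 n := by
                ext k; simp only [Finset.mem_filter, Finset.mem_Icc]; omega
              rw [this]
              apply Finset.sum_congr rfl
              intro k hk
              rw [Finset.mem_Icc] at hk
              have : t ^ n = t ^ k * t ^ (n - k) := by rw [← pow_add]; congr 1; omega
              rw [this]; ring
          _ = ∑ k ∈ Finset.Icc 1 N, w k * t ^ k * ∑ n ∈ (Finset.range (N + 1)).filter (fun n => k ≤ n), c (n - k) * t ^ (n - k) := by
              rw [Finset.sum_comm]
              apply Finset.sum_congr rfl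
              intro k _
              rw [Finset.mul_sum, Finset.sum_filter]
          _ ≤ ∑ k ∈ Finset.Icc 1 N, w k * t ^ k * ∑ n ∈ Finset.range (N + 1), c n * t ^ n := by
              apply Finset.sum_le_sum
              intro k _
              apply mul_le_mul_of_nonneg_left _ (mul_nonneg (hw k) (pow_nonneg ht.1.le _))
              rw [← Finset.sum_image (s := (Finset.range (N + 1)).filter (fun n => k ≤ n)) (g := fun n => n - k) (f := fun n => c n * t ^ n)]
              · apply Finset.sum_le_sum_of_subset_of_nonneg
                · intro x hx
                  simp only [Finset.mem_image, Finset.mem_filter, Finset.mem_range] at hx ⊢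
                  omega
                · intro n _ _
                  exact mul_nonneg (hc n) (pow_nonneg ht.1.le _)
              · intro a ha b hb hab
                simp only [Finset.coe_filter, Finset.mem_range, Set.mem_ofPred_eq] at ha hb
                simp only at hab
                omega
      have hkey2 : f1 ≤ v1 * f t := le_of_mul_le_mul_left hkey ht.1
      have := Real.exp_pos (- v t)
      simp only [Pi.neg_apply]
      have h9 := mul_le_mul_of_nonneg_right hkey2 this.le
      nlinarith
  have h01 := hanti (Set.left_mem_Icc.mpr zero_le_one) (Set.right_mem_Icc.mpr zero_le_one) zero_le_one
  have hf0 : f 0 = c 0 := by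
    rw [hf]
    simp only
    rw [Finset.sum_eq_single 0]
    · simp
    · intro b _ hb
      rw [zero_pow hb, mul_zero]
    · intro hb
      exact absurd (Finset.mem_range.mpr (Nat.succ_pos N)) hb
  have hv0 : v 0 = 0 := by
    rw [hv]
    apply Finset.sum_eq_zero
    intro k hk
    rw [Finset.mem_Icc] at hk
    simp; omega
  have hv1 : v 1 = ∑ k ∈ Finset.Icc 1 N, w k / k := by simp [hv]
  have hfN : c N ≤ f 1 := by
    rw [hf]
    simp only [one_pow, mul_one]
    exact Finset.single_le_sum (fun n _ => hc n) (Finset.mem_range.mpr (by omega))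
  simp only [hf0, hv0, neg_zero, Real.exp_zero, mul_one] at h01
  rw [← hv1]
  have h2 : f 1 * Real.exp (- v 1) ≤ 1 := h01.trans hc0
  rw [Real.exp_neg, ← div_eq_mul_inv, div_le_one (Real.exp_pos _)] at h2
  exact hfN.trans h2

lemma coeff_bound (q : ℝ) (hq : 1 < q) (ε : ℝ) (hε : 0 < ε) : ∃ C : ℝ, 0 < C ∧ ∀ (m : ℕ) (a S : ℕ → ℂ),
    a 0 = 1 → NRec a S → (∀ k, 1 ≤ k → ‖S k‖ ≤ q ^ k) → (∀ k, 1 ≤ k → ‖S k‖ ≤ m * (Real.sqrt q) ^ k) →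
    ∀ n, ‖a n‖ ≤ C * q ^ (ε * m) * q ^ ((1 / 2 + ε) * n) := by
  have hq0 : 0 < q := by linarith
  set y : ℝ := q ^ (1 / 2 + ε) with hy
  have hy1 : 0 < y := Real.rpow_pos_of_pos hq0 _
  set ρ : ℝ := Real.sqrt q / y with hρ
  have hρ1 : ρ < 1 := by
    rw [hρ, div_lt_one hy1, hy, Real.sqrt_eq_rpow]
    exact Real.rpow_lt_rpow_of_exponent_lt hq (by linarith)
  have hρ0 : 0 < ρ := by
    rw [hρ]; have := Real.sqrt_pos.mpr hq0; positivity
  have hsum : Summable (fun k : ℕ => ρ ^ k) := summable_geometric_of_lt_one hρ0.le hρ1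
  have hlog : 0 < ε * Real.log q := mul_pos hε (Real.log_pos hq)
  obtain ⟨K0, hK0⟩ := ((tendsto_sum_nat_add (fun k => ρ ^ k)).eventually (gt_mem_nhds hlog)).exists
  set C1 : ℝ := ∑ k ∈ Finset.range K0, (q / y) ^ k with hC1
  refine ⟨Real.exp C1, Real.exp_pos _, ?_⟩
  intro m a S ha0 hrec hS1 hS2 n
  set c : ℕ → ℝ := fun n => ‖a n‖ / y ^ n with hc
  set w : ℕ → ℝ := fun k => ‖S k‖ / y ^ k with hw
  have hg := gronwall_rec c w (fun n => by positivity) (fun n => by positivity) (by simp [hc, ha0]) (by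
    intro n
    have h1 : (n : ℝ) * ‖a n‖ ≤ ∑ k ∈ Finset.Icc 1 n, ‖S k‖ * ‖a (n - k)‖ := by
      have h2 := congrArg norm (hrec n)
      rw [norm_mul, Complex.norm_natCast] at h2
      rw [h2]
      refine (norm_sum_le _ _).trans (le_of_eq ?_)
      simp only [norm_mul]
    simp only [hc, hw]
    rw [← mul_div_assoc, div_le_iff₀ (by positivity), Finset.sum_mul]
    refine h1.trans (le_of_eq ?_)
    apply Finset.sum_congr rfl
    intro k hk
    rw [Finset.mem_Icc] at hk
    have : y ^ n = y ^ k * y ^ (n - k) := by rw [← pow_add]; congr 1; omega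
    rw [this]
    field_simp) n
  have hV : ∑ k ∈ Finset.Icc 1 n, w k / k ≤ C1 + m * (ε * Real.log q) := by
    have hb : ∀ k ∈ Finset.Icc 1 n, w k / k ≤ (if k < K0 then (q / y) ^ k else 0) + (if K0 ≤ k then m * ρ ^ k else 0) := by
      intro k hk
      rw [Finset.mem_Icc] at hk
      have h1 : w k / k ≤ w k := div_le_self (by positivity) (by exact_mod_cast hk.1)
      refine h1.trans ?_
      simp only [hw]
      by_cases hlt : k < K0
      · rw [if_pos hlt, if_neg (by omega), add_zero, div_pow]
        have := hS1 k hk.1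
        gcongr
      · rw [if_neg hlt, if_pos (by omega), zero_add, hρ, div_pow, ← mul_div_assoc]
        have := hS2 k hk.1
        gcongr
    refine (Finset.sum_le_sum hb).trans ?_
    rw [Finset.sum_add_distrib]
    have hm0 : (0 : ℝ) ≤ m := by positivity
    apply add_le_add
    · rw [← Finset.sum_filter]
      apply Finset.sum_le_sum_of_subset_of_nonneg
      · intro k hk
        rw [Finset.mem_filter] at hk
        exact Finset.mem_range.mpr hk.2
      · intros; positivity
    · rw [← Finset.sum_filter, ← Finset.mul_sum]
      apply mul_le_mul_of_nonneg_left _ hm0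
      refine le_trans ?_ hK0.le
      have hs2 : Summable (fun k : ℕ => ρ ^ (k + K0)) := (summable_nat_add_iff K0).mpr hsum
      have : ∑ k ∈ (Finset.Icc 1 n).filter (fun k => K0 ≤ k), ρ ^ k = ∑ j ∈ ((Finset.Icc 1 n).filter (fun k => K0 ≤ k)).image (fun k => k - K0), ρ ^ (j + K0) := by
        rw [Finset.sum_image]
        · apply Finset.sum_congr rfl
          intro k hk
          rw [Finset.mem_filter] at hk
          congr 1; omega
        · intro a ha b hb hab
          simp only [Finset.coe_filter, Set.mem_ofPred_eq] at ha hb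
          simp only at hab
          omega
      rw [this]
      exact hs2.sum_le_tsum _ (fun k _ => by positivity)
  have h3 := hg.trans (Real.exp_le_exp.mpr hV)
  simp only [hc] at h3
  rw [div_le_iff₀ (by positivity)] at h3
  refine h3.trans (le_of_eq ?_)
  rw [Real.exp_add, hy, ← Real.rpow_natCast (q ^ (1 / 2 + ε)), ← Real.rpow_mul hq0.le, Real.rpow_def_of_pos hq0 (ε * m)]
  congr 3
  ring

end FM

open scoped Classical
open Polynomial Filter
set_option linter.unusedSectionVars false
set_option linter.unusedVariables false
set_option linter.style.haveILetI false
namespace FM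

/-- A faithful complex character on the `n`-th roots of unity of an algebraically closed field. -/
lemma theta_exists (K : Type) [Field K] [IsAlgClosed K] (n : ℕ) (hn : 0 < n) (hnK : (n : K) ≠ 0) :
    ∃ θ : K → ℂ, (∀ z, ‖θ z‖ ≤ 1) ∧ (∀ z w, z ^ n = 1 → w ^ n = 1 → θ (z * w) = θ z * θ w) ∧
      θ 1 = 1 ∧ (∀ z, z ^ n = 1 → θ z = 1 → z = 1) ∧ (∀ z, z ^ n ≠ 1 → θ z = 0) ∧
      ∀ ρ : rootsOfUnity n K →* ℂˣ, ∃ e : ℕ, 1 ≤ e ∧ ∀ z : rootsOfUnity n K,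
        (ρ z : ℂ) = θ (((z : Kˣ) : K) ^ e) := by
  have : NeZero n := ⟨hn.ne'⟩
  have : NeZero (n : K) := ⟨hnK⟩
  have hc : Nat.card (rootsOfUnity n K) = Nat.card (rootsOfUnity n ℂ) := by
    rw [HasEnoughRootsOfUnity.natCard_rootsOfUnity, HasEnoughRootsOfUnity.natCard_rootsOfUnity]
  let E : rootsOfUnity n K ≃* rootsOfUnity n ℂ := mulEquivOfCyclicCardEq hc
  have hmk : ∀ z : K, z ^ n = 1 → ∃ u : rootsOfUnity n K, ((u : Kˣ) : K) = z := by
    intro z hz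
    refine ⟨rootsOfUnity.mkOfPowEq z hz, rfl⟩
  let θ : K → ℂ := fun z => if hz : z ^ n = 1 then (((E (rootsOfUnity.mkOfPowEq z hz)) : ℂˣ) : ℂ) else 0
  have hθ : ∀ u : rootsOfUnity n K, θ ((u : Kˣ) : K) = ((E u : ℂˣ) : ℂ) := by
    intro u
    have hu : ((u : Kˣ) : K) ^ n = 1 := by
      exact (mem_rootsOfUnity' n _).mp u.2
    have h2 : rootsOfUnity.mkOfPowEq ((u : Kˣ) : K) hu = u := by
      apply Subtype.ext
      apply Units.ext
      rfl
    simp only [θ, dif_pos hu, h2]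
  have hnorm : ∀ u : rootsOfUnity n ℂ, ‖((u : ℂˣ) : ℂ)‖ = 1 := by
    intro u
    apply Complex.norm_eq_one_of_pow_eq_one (n := n) _ hn.ne'
    exact (mem_rootsOfUnity' n _).mp u.2
  refine ⟨θ, ?_, ?_, ?_, ?_, ?_, ?_⟩
  · intro z
    by_cases hz : z ^ n = 1
    · obtain ⟨u, rfl⟩ := hmk z hz
      rw [hθ, hnorm]
    · simp only [θ, dif_neg hz, norm_zero, zero_le_one]
  · intro z w hz hw
    obtain ⟨u, rfl⟩ := hmk z hz
    obtain ⟨v, rfl⟩ := hmk w hw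
    have := hθ (u * v)
    rw [hθ, hθ]
    simpa using this
  · have := hθ 1
    simpa using this
  · intro z hz h1
    obtain ⟨u, rfl⟩ := hmk z hz
    rw [hθ] at h1
    have h3 : E u = 1 := by
      apply Subtype.ext
      apply Units.ext
      simpa using h1
    rw [map_eq_one_iff E E.injective] at h3
    rw [h3]; rfl
  · intro z hz
    simp only [θ, dif_neg hz]
  · intro ρ
    have hρ : ∀ z, ρ z ∈ rootsOfUnity n ℂ := by
      intro z
      rw [mem_rootsOfUnity, ← map_pow]
      have : z ^ n = 1 := by
        apply Subtype.ext
        have := z.2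
        rw [mem_rootsOfUnity] at this
        simpa using this
      rw [this, map_one]
    let σ : rootsOfUnity n K →* rootsOfUnity n K := E.symm.toMonoidHom.comp (ρ.codRestrict _ hρ)
    obtain ⟨m, hm⟩ := MonoidHom.map_cyclic σ
    obtain ⟨e, he1, he⟩ : ∃ e : ℕ, 1 ≤ e ∧ (n : ℤ) ∣ e - m := by
      refine ⟨(m % n).toNat + n, by omega, ?_⟩
      have h0 : 0 ≤ m % n := Int.emod_nonneg _ (by omega)
      push_cast
      rw [Int.toNat_of_nonneg h0]
      have : m % n + n - m = n - n * (m / n) := by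
        have := Int.emod_add_mul_ediv m n
        linarith
      rw [this]
      exact Dvd.intro (1 - m / n) (by ring)
    refine ⟨e, he1, ?_⟩
    intro z
    have h1 : σ z = z ^ e := by
      rw [hm]
      obtain ⟨t, ht⟩ := he
      have : m = e - n * t := by linarith
      have h5 : z ^ n = 1 := by
        apply Subtype.ext
        have := z.2
        rw [mem_rootsOfUnity] at this
        simpa using this
      rw [this, zpow_sub, zpow_mul, zpow_natCast, zpow_natCast, h5]
      simp
    have h2 : E (σ z) = (ρ.codRestrict _ hρ) z := by
      simp [σ]
    rw [h1] at h2
    have h3 := hθ (z ^ e)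
    rw [h2] at h3
    simp at h3
    rw [h3]

section Frob
variable {F : Type} [Field F] [Fintype F] {K : Type} [Field K] [Algebra F K]

/-- exponentiation by `q^i` as a ring hom compat -/
lemma aeval_pow_q (f : F[X]) (x : K) (i : ℕ) :
    aeval (x ^ (Fintype.card F ^ i)) f = (aeval x f) ^ (Fintype.card F ^ i) := by
  induction i with
  | zero => simp
  | succ i ih =>
    rw [pow_succ, pow_mul, pow_mul, ← ih]
    rw [← expand_aeval, FiniteField.expand_card, map_pow]

lemma sub_pow_q (x y : K) (i : ℕ) :
    (x - y) ^ (Fintype.card F ^ i) = x ^ (Fintype.card F ^ i) - y ^ (Fintype.card F ^ i) := by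
  obtain ⟨p, hp⟩ := CharP.exists F
  have := hp
  have : CharP K p := charP_of_injective_algebraMap (algebraMap F K).injective p
  obtain ⟨n, hpp, hn⟩ := FiniteField.card F p
  have : Fact p.Prime := ⟨hpp⟩
  rw [hn, ← pow_mul]
  exact sub_pow_char_pow _ _ _

lemma poly_sub_pow_q (x y : K[X]) (i : ℕ) :
    (x - y) ^ (Fintype.card F ^ i) = x ^ (Fintype.card F ^ i) - y ^ (Fintype.card F ^ i) := by
  obtain ⟨p, hp⟩ := CharP.exists F
  have := hp
  have : CharP K p := charP_of_injective_algebraMap (algebraMap F K).injective p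
  obtain ⟨n, hpp, hn⟩ := FiniteField.card F p
  have : Fact p.Prime := ⟨hpp⟩
  rw [hn, ← pow_mul]
  exact sub_pow_char_pow _ _ _

lemma deg_dvd_iff {P : F[X]} (hP : Irreducible P) {x : K} (hx : aeval x P = 0) (n : ℕ) :
    P.natDegree ∣ n ↔ x ^ (Fintype.card F ^ n) = x := by
  rw [hP.natDegree_dvd_iff_dvd_X_pow_card_pow_sub_X, ← hP.dvd_iff_aeval_eq_zero hx, Nat.card_eq_fintype_card]
  simp [sub_eq_zero]

lemma map_irr_eq {P : F[X]} (hP : Irreducible P) (hm : P.Monic) {x : K} (hx : aeval x P = 0) :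
    P.map (algebraMap F K) = ∏ i ∈ Finset.range P.natDegree, (X - C (x ^ (Fintype.card F ^ i))) := by
  have hinj : ∀ i ∈ Finset.range P.natDegree, ∀ j ∈ Finset.range P.natDegree,
      x ^ (Fintype.card F ^ i) = x ^ (Fintype.card F ^ j) → i = j := by
    have key : ∀ i j, i < j → j < P.natDegree → x ^ (Fintype.card F ^ i) ≠ x ^ (Fintype.card F ^ j) := by
      intro i j hij hj h
      have h2 : (x - x ^ (Fintype.card F ^ (j - i))) ^ (Fintype.card F ^ i) = 0 := by
        rw [sub_pow_q, ← pow_mul, ← pow_add, h, Nat.sub_add_cancel hij.le, sub_self]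
      have h3 := pow_eq_zero_iff (n := Fintype.card F ^ i) (pow_pos Fintype.card_pos _).ne' |>.mp h2
      rw [sub_eq_zero] at h3
      have h4 := (deg_dvd_iff hP hx (j - i)).mpr h3.symm
      have := Nat.le_of_dvd (by omega) h4
      omega
    intro i hi j hj h
    rw [Finset.mem_range] at hi hj
    rcases lt_trichotomy i j with h1 | h1 | h1
    · exact absurd h (key i j h1 hj)
    · exact h1
    · exact absurd h.symm (key j i h1 hi)
  have hdvd : ∏ i ∈ Finset.range P.natDegree, (X - C (x ^ (Fintype.card F ^ i))) ∣ P.map (algebraMap F K) := by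
    apply Finset.prod_dvd_of_coprime
    · intro i hi j hj hij
      apply isCoprime_X_sub_C_of_isUnit_sub
      apply IsUnit.mk0
      rw [sub_ne_zero]
      intro h
      exact hij (hinj i hi j hj h)
    · intro i _
      rw [dvd_iff_isRoot, IsRoot, eval_map_algebraMap, aeval_pow_q, hx, zero_pow]
      exact (pow_pos Fintype.card_pos _).ne'
  refine (eq_of_monic_of_dvd_of_natDegree_le ?_ ?_ hdvd ?_)
  · exact monic_prod_of_monic _ _ (fun i _ => monic_X_sub_C _)
  · exact hm.map _
  · rw [natDegree_map, natDegree_prod_of_monic _ _ (fun i _ => monic_X_sub_C _)]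
    simp only [natDegree_X_sub_C, Finset.sum_const, Finset.card_range, smul_eq_mul, mul_one, le_refl]

/-- value of the `k`-norm polynomial. -/
lemma aeval_norm {P : F[X]} (hP : Irreducible P) (hm : P.Monic) {x : K} (hx : aeval x P = 0)
    {k : ℕ} (hk : P.natDegree ∣ k) (a : K) :
    aeval a (P ^ (k / P.natDegree)) = ∏ i ∈ Finset.range k, (a - x ^ (Fintype.card F ^ i)) := by
  obtain ⟨t, rfl⟩ := hk
  have hd : 0 < P.natDegree := hP.natDegree_pos
  rw [Nat.mul_div_cancel_left _ hd, map_pow]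
  have h1 : aeval a P = ∏ i ∈ Finset.range P.natDegree, (a - x ^ (Fintype.card F ^ i)) := by
    rw [← eval_map_algebraMap, map_irr_eq hP hm hx, eval_prod]
    simp
  rw [h1]
  have hper : ∀ i, x ^ (Fintype.card F ^ (i + P.natDegree)) = x ^ (Fintype.card F ^ i) := by
    intro i
    rw [add_comm, pow_add, pow_mul, (deg_dvd_iff hP hx P.natDegree).mp (dvd_refl _)]
  have hper2 : ∀ t i, x ^ (Fintype.card F ^ (P.natDegree * t + i)) = x ^ (Fintype.card F ^ i) := by
    intro t
    induction t with
    | zero => simp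
    | succ t ih =>
      intro i
      rw [show P.natDegree * (t + 1) + i = (P.natDegree * t + i) + P.natDegree by ring, hper, ih]
  induction t with
  | zero => simp
  | succ t ih =>
    rw [pow_succ, ih, Nat.mul_succ, Finset.prod_range_add]
    congr 1
    apply Finset.prod_congr rfl
    intro i _
    rw [hper2]

lemma norm_split (a x : K) (r : ℕ) (ha : a ^ (Fintype.card F ^ r) = a) (n : ℕ) :
    ∏ i ∈ Finset.range (r * n), (a - x ^ (Fintype.card F ^ i)) =
      (∏ i ∈ Finset.range r, (a - x ^ (Fintype.card F ^ i))) ^ (∑ j ∈ Finset.range n, (Fintype.card F ^ r) ^ j) := by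
  have ha2 : ∀ n, a ^ (Fintype.card F ^ (r * n)) = a := by
    intro n
    induction n with
    | zero => simp
    | succ n ih => rw [Nat.mul_succ, pow_add, pow_mul, ih, ha]
  induction n with
  | zero => simp
  | succ n ih =>
    rw [Nat.mul_succ, Finset.prod_range_add, ih, Finset.sum_range_succ, pow_add]
    congr 1
    rw [← Finset.prod_pow]
    apply Finset.prod_congr rfl
    intro i _
    rw [← pow_mul, sub_pow_q, ha2, ← pow_mul, ← pow_add, add_comm]

variable [IsAlgClosed K]

/-- the finite subfield with `q^k` elements, as a finset. -/
noncomputable def fld (F K : Type) [Field F] [Fintype F] [Field K] [Algebra F K] (k : ℕ) : Finset K :=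
  ((X ^ (Fintype.card F ^ k) - X : K[X])).roots.toFinset

lemma mem_fld {k : ℕ} (hk : 1 ≤ k) {x : K} : x ∈ fld F K k ↔ x ^ (Fintype.card F ^ k) = x := by
  have h1 : 1 < Fintype.card F ^ k := Nat.one_lt_pow (by omega) one_lt_q
  have h0 : (X ^ (Fintype.card F ^ k) - X : K[X]) ≠ 0 := FiniteField.X_pow_card_sub_X_ne_zero K h1
  simp [fld, Multiset.mem_toFinset, mem_roots h0, sub_eq_zero]

lemma q_cast_zero : ((Fintype.card F : ℕ) : K) = 0 := by
  have h : ((Fintype.card F : ℕ) : F) = 0 := FiniteField.cast_card_eq_zero F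
  rw [← map_natCast (algebraMap F K), h, map_zero]

lemma card_fld {k : ℕ} (hk : 1 ≤ k) : (fld F K k).card = Fintype.card F ^ k := by
  have h1 : 1 < Fintype.card F ^ k := Nat.one_lt_pow (by omega) one_lt_q
  have hq : ((Fintype.card F ^ k : ℕ) : K) = 0 := by
    push_cast
    rw [q_cast_zero (F := F), zero_pow (by omega)]
  have hsep : (X ^ (Fintype.card F ^ k) - X : K[X]).Separable := by
    have : derivative (X ^ (Fintype.card F ^ k) - X : K[X]) = -1 := by
      rw [derivative_sub, derivative_X_pow, derivative_X, hq]
      simp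
    rw [Polynomial.Separable, this]
    exact isCoprime_one_right.neg_right
  rw [fld, Multiset.toFinset_card_of_nodup (nodup_roots hsep)]
  refine Eq.trans ?_ (FiniteField.X_pow_card_sub_X_natDegree_eq K h1)
  exact (IsAlgClosed.splits (X ^ (Fintype.card F ^ k) - X : K[X])).natDegree_eq_card_roots.symm

lemma pS_eq (χ : F[X] → ℂ) {k : ℕ} (hk : 1 ≤ k) :
    pS χ k = ∑ x ∈ fld F K k, χ (minpoly F x) ^ (k / (minpoly F x).natDegree) := by
  have hIntg : ∀ x ∈ fld F K k, IsIntegral F x := by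
    intro x hx
    rw [mem_fld hk] at hx
    refine ⟨X ^ (Fintype.card F ^ k) - X, ?_, ?_⟩
    · exact monic_X_pow_sub (by rw [degree_X]; exact_mod_cast Nat.one_lt_pow (by omega) one_lt_q)
    · simp [hx]
  have hmaps : ∀ x ∈ fld F K k, minpoly F x ∈ (irr F k).filter (fun P => P.natDegree ∣ k) := by
    intro x hx
    have h1 := minpoly.irreducible (hIntg x hx)
    have h2 : (minpoly F x).natDegree ∣ k :=
      (deg_dvd_iff h1 (minpoly.aeval F x) k).mpr ((mem_fld hk).mp hx)
    rw [Finset.mem_filter, mem_irr]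
    exact ⟨⟨minpoly.monic (hIntg x hx), Nat.le_of_dvd (by omega) h2, h1⟩, h2⟩
  rw [← Finset.sum_fiberwise_of_maps_to hmaps, pS]
  apply Finset.sum_congr rfl
  intro P hP
  rw [Finset.mem_filter, mem_irr] at hP
  obtain ⟨⟨hm, _, hi⟩, hd⟩ := hP
  have hfib : (fld F K k).filter (fun x => minpoly F x = P) = (P.map (algebraMap F K)).roots.toFinset := by
    ext x
    rw [Finset.mem_filter, Multiset.mem_toFinset, mem_roots (hm.map _).ne_zero, IsRoot, eval_map_algebraMap]
    constructor
    · rintro ⟨h1, rfl⟩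
      exact minpoly.aeval F x
    · intro h
      exact ⟨(mem_fld hk).mpr ((deg_dvd_iff hi h k).mp hd), (minpoly.eq_of_irreducible_of_monic hi h hm).symm⟩
  have hcard : ((fld F K k).filter (fun x => minpoly F x = P)).card = P.natDegree := by
    rw [hfib, Multiset.toFinset_card_of_nodup, ← (IsAlgClosed.splits _).natDegree_eq_card_roots, natDegree_map]
    exact nodup_roots ((PerfectField.separable_of_irreducible hi).map)
  rw [Finset.sum_congr rfl (g := fun _ => χ P ^ (k / P.natDegree)), Finset.sum_const, hcard, nsmul_eq_mul]
  intro x hx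
  rw [Finset.mem_filter] at hx
  rw [hx.2]

end Frob
end FM

open scoped Classical
open Polynomial Filter
set_option linter.unusedSectionVars false
set_option linter.unusedVariables false
set_option linter.style.haveILetI false
namespace FM

section GRH
variable {F : Type} [Field F] [Fintype F]
open UniqueFactorizationMonoid

/-- The prime factors. -/
noncomputable def pf (M : F[X]) : Finset F[X] := (normalizedFactors M).toFinset

lemma mem_pf {M P : F[X]} (hM : M ≠ 0) : P ∈ pf M ↔ P.Monic ∧ Irreducible P ∧ P ∣ M := by
  rw [pf, Multiset.mem_toFinset]
  constructor
  · intro h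
    exact ⟨monic_of_mem_nf h, irreducible_of_normalized_factor P h, dvd_of_mem_normalizedFactors h⟩
  · rintro ⟨h1, h2, h3⟩
    rw [mem_normalizedFactors_iff' hM]
    exact ⟨h2, h1.normalize_eq_self, h3⟩

lemma pf_coprime {M f : F[X]} (hM : M ≠ 0) : IsCoprime f M ↔ ∀ P ∈ pf M, ¬ P ∣ f := by
  constructor
  · intro h P hP hPf
    rw [mem_pf hM] at hP
    exact hP.2.1.not_isUnit (h.isUnit_of_dvd' hPf hP.2.2)
  · intro h
    apply isCoprime_of_irreducible_dvd
    · rintro ⟨_, h0⟩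
      exact hM h0
    · intro z hz hzf hzM
      have hz0 := hz.ne_zero
      apply h (normalize z)
      · rw [mem_pf hM]
        exact ⟨monic_normalize hz0, (associated_normalize z).irreducible hz, normalize_dvd_iff.mpr hzM⟩
      · exact normalize_dvd_iff.mpr hzf

lemma dvd_of_pf {M f : F[X]} (hM : M.Monic) (hs : Squarefree M) (h : ∀ P ∈ pf M, P ∣ f) : M ∣ f := by
  have h0 := hM.ne_zero
  have h1 : (pf M).prod id ∣ f := by
    apply Finset.prod_dvd_of_coprime
    · intro P hP Q hQ hPQ
      rw [Finset.mem_coe, mem_pf h0] at hP hQ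
      simp only [id, Function.onFun]
      rw [hP.2.1.coprime_iff_not_dvd]
      intro hd
      apply hPQ
      exact eq_of_monic_of_associated hP.1 hQ.1 ((hP.2.1.dvd_irreducible_iff_associated hQ.2.1).mp hd)
    · exact h
  refine dvd_trans ?_ h1
  have h2 : (pf M).prod id = (normalizedFactors M).prod := by
    rw [pf, Finset.prod, Multiset.toFinset_val, Multiset.map_id,
      ((squarefree_iff_nodup_normalizedFactors h0).mp hs).dedup]
  rw [h2]
  exact (prod_normalizedFactors h0).symm.dvd

lemma isUnit_mk_iff {M f : F[X]} : IsUnit (Ideal.Quotient.mk (Ideal.span {M}) f) ↔ IsCoprime f M := by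
  constructor
  · intro h
    obtain ⟨y, hy⟩ := h.exists_right_inv
    obtain ⟨g, rfl⟩ := Ideal.Quotient.mk_surjective y
    rw [← map_mul, ← map_one (Ideal.Quotient.mk (Ideal.span {M})), Ideal.Quotient.eq, Ideal.mem_span_singleton] at hy
    obtain ⟨c, hc⟩ := hy
    exact ⟨g, -c, by linear_combination hc⟩
  · rintro ⟨g, c, h⟩
    apply IsUnit.of_mul_eq_one (Ideal.Quotient.mk (Ideal.span {M}) g)
    rw [← map_mul, ← map_one (Ideal.Quotient.mk (Ideal.span {M})), Ideal.Quotient.eq, Ideal.mem_span_singleton]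
    exact ⟨-c, by linear_combination h⟩

lemma mk_eq_iff {D f g : F[X]} : Ideal.Quotient.mk (Ideal.span {D}) f = Ideal.Quotient.mk (Ideal.span {D}) g ↔ D ∣ f - g := by
  rw [Ideal.Quotient.eq, Ideal.mem_span_singleton]

lemma mk_eq_zero_iff {D f : F[X]} : Ideal.Quotient.mk (Ideal.span {D}) f = 0 ↔ D ∣ f := by
  rw [Ideal.Quotient.eq_zero_iff_mem, Ideal.mem_span_singleton]

lemma mk_inj_lt {D : F[X]} (hD : D.Monic) {f g : F[X]} (hf : f ∈ lt F D.natDegree) (hg : g ∈ lt F D.natDegree)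
    (h : Ideal.Quotient.mk (Ideal.span {D}) f = Ideal.Quotient.mk (Ideal.span {D}) g) : f = g := by
  rw [mk_eq_iff] at h
  rw [mem_lt] at hf hg
  rw [← sub_eq_zero]
  apply eq_zero_of_dvd_of_degree_lt h
  rw [degree_eq_natDegree hD.ne_zero]
  exact lt_of_le_of_lt (degree_sub_le _ _) (max_lt hf hg)

lemma mk_surj_lt {D : F[X]} (hD : D.Monic) (x : F[X] ⧸ Ideal.span {D}) :
    ∃ f ∈ lt F D.natDegree, Ideal.Quotient.mk (Ideal.span {D}) f = x := by
  obtain ⟨f, rfl⟩ := Ideal.Quotient.mk_surjective x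
  refine ⟨f %ₘ D, ?_, ?_⟩
  · rw [mem_lt, ← degree_eq_natDegree hD.ne_zero]
    exact degree_modByMonic_lt _ hD
  · rw [mk_eq_iff]
    exact ⟨-(f /ₘ D), by linear_combination modByMonic_add_div f D⟩

lemma quot_finite {D : F[X]} (hD : D.Monic) : Finite (F[X] ⧸ Ideal.span {D}) := by
  apply Finite.of_surjective (fun f : lt F D.natDegree => Ideal.Quotient.mk (Ideal.span {D}) (f : F[X]))
  intro x
  obtain ⟨f, hf, rfl⟩ := mk_surj_lt hD x
  exact ⟨⟨f, hf⟩, rfl⟩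

lemma sum_lt_quot {β : Type*} [AddCommMonoid β] {D : F[X]} (hD : D.Monic) [Fintype (F[X] ⧸ Ideal.span {D})] (G : F[X] ⧸ Ideal.span {D} → β) :
    ∑ f ∈ lt F D.natDegree, G (Ideal.Quotient.mk _ f) = ∑ x, G x := by
  apply Finset.sum_bij (fun f _ => Ideal.Quotient.mk (Ideal.span {D}) f)
  · intros; exact Finset.mem_univ _
  · intro f hf g hg h
    exact mk_inj_lt hD hf hg h
  · intro x _
    obtain ⟨f, hf, h⟩ := mk_surj_lt hD x
    exact ⟨f, hf, h⟩
  · intros; rfl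

lemma card_quot {D : F[X]} (hD : D.Monic) [Fintype (F[X] ⧸ Ideal.span {D})] :
    Fintype.card (F[X] ⧸ Ideal.span {D}) = Fintype.card F ^ D.natDegree := by
  have := sum_lt_quot hD (fun _ => (1 : ℕ))
  rw [Finset.sum_const, Finset.sum_const, card_lt] at this
  simpa using this.symm

/-- Sums over long intervals of monic polynomials. -/
lemma sum_mon_mod {D : F[X]} (hD : D.Monic) [Fintype (F[X] ⧸ Ideal.span {D})] (G : F[X] ⧸ Ideal.span {D} → ℂ)
    {n : ℕ} (hn : D.natDegree ≤ n) :
    ∑ f ∈ mon F n, G (Ideal.Quotient.mk _ f) = (Fintype.card F : ℂ) ^ (n - D.natDegree) * ∑ x, G x := by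
  have h1 : ∑ f ∈ mon F n, G (Ideal.Quotient.mk _ f) =
      ∑ z ∈ (mon F (n - D.natDegree)) ×ˢ (lt F D.natDegree), G (Ideal.Quotient.mk _ z.2) := by
    symm
    apply Finset.sum_bij (fun z _ => z.1 * D + z.2)
    · rintro ⟨h, r⟩ hz
      rw [Finset.mem_product, mem_mon, mem_lt] at hz
      obtain ⟨⟨h1, h2⟩, h3⟩ := hz
      simp only at h1 h2 h3 ⊢
      rw [← degree_eq_natDegree hD.ne_zero] at h3
      have hlt : r.degree < (h * D).degree := by
        rw [hD.degree_mul, degree_eq_natDegree h1.ne_zero]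
        refine lt_of_lt_of_le h3 ?_
        exact le_add_of_nonneg_left (by exact_mod_cast Nat.zero_le _)
      rw [mem_mon]
      refine ⟨(h1.mul hD).add_of_left hlt, ?_⟩
      rw [natDegree_add_eq_left_of_degree_lt hlt, h1.natDegree_mul hD, h2]
      omega
    · rintro ⟨h, r⟩ hz ⟨h', r'⟩ hz' heq
      rw [Finset.mem_product, mem_lt] at hz hz'
      simp only at hz hz' heq
      rw [← degree_eq_natDegree hD.ne_zero] at hz hz'
      have e1 := div_modByMonic_unique h r hD ⟨(by ring : r + D * h = h * D + r), hz.2⟩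
      have e2 := div_modByMonic_unique h' r' hD ⟨(by rw [heq]; ring : r' + D * h' = h * D + r), hz'.2⟩
      rw [Prod.mk.injEq]
      exact ⟨e1.1.symm.trans e2.1, e1.2.symm.trans e2.2⟩
    · intro f hf
      rw [mem_mon] at hf
      refine ⟨(f /ₘ D, f %ₘ D), ?_, ?_⟩
      · rw [Finset.mem_product, mem_mon, mem_lt, ← degree_eq_natDegree hD.ne_zero]
        refine ⟨⟨?_, ?_⟩, degree_modByMonic_lt _ hD⟩
        · rw [Monic, leadingCoeff_divByMonic_of_monic hD, hf.1]
          rw [degree_eq_natDegree hD.ne_zero, degree_eq_natDegree hf.1.ne_zero, hf.2]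
          exact_mod_cast hn
        · rw [natDegree_divByMonic _ hD, hf.2]
      · simp only
        linear_combination modByMonic_add_div f D
    · rintro ⟨h, r⟩ hz
      simp only
      congr 1
      rw [mk_eq_iff]
      exact ⟨-h, by ring⟩
  rw [h1, Finset.sum_product]
  simp only
  rw [Finset.sum_const, card_mon, sum_lt_quot hD]
  simp

lemma char_repr {K : Type} [Field K] [Algebra F K] [IsAlgClosed K] {M : F[X]} (hM : M.Monic) (hs : Squarefree M)
    (χ : MulChar (F[X] ⧸ Ideal.span {M}) ℂ) (a : F[X] → K) (ha : ∀ P ∈ pf M, aeval (a P) P = 0)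
    (N r : ℕ) (hr : 1 ≤ r) (hN : N + 1 = Fintype.card F ^ r) (hd : ∀ P ∈ pf M, P.natDegree ∣ r) (θ : K → ℂ)
    (hθ1 : ∀ z w, z ^ N = 1 → w ^ N = 1 → θ (z * w) = θ z * θ w) (hθone : θ 1 = 1)
    (hθ2 : ∀ ρ : rootsOfUnity N K →* ℂˣ, ∃ e : ℕ, 1 ≤ e ∧ ∀ z : rootsOfUnity N K,
        (ρ z : ℂ) = θ (((z : Kˣ) : K) ^ e)) :
    ∃ e : F[X] → ℕ, (∀ P, 1 ≤ e P) ∧ ∀ f, IsCoprime f M →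
      χ (Ideal.Quotient.mk _ f) = θ (∏ P ∈ pf M, (aeval (a P) f) ^ e P) := by
  have hM0 := hM.ne_zero
  have hN0 : N ≠ 0 := by
    rintro rfl
    have : 1 < Fintype.card F ^ r := Nat.one_lt_pow (by omega) one_lt_q
    omega
  have : NeZero N := ⟨hN0⟩
  have hfin : Finite (F[X] ⧸ Ideal.span {M}) := by
    exact quot_finite hM
  let ev : pf M → (F[X] ⧸ Ideal.span {M}) →+* K := fun P =>
    Ideal.Quotient.lift _ (aeval (a P) : F[X] →ₐ[F] K).toRingHom (by
      intro f hf
      rw [Ideal.mem_span_singleton] at hf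
      have h1 := dvd_trans ((mem_pf hM0).mp P.2).2.2 hf
      obtain ⟨g, rfl⟩ := h1
      simp [ha P P.2])
  have hev : ∀ P f, ev P (Ideal.Quotient.mk _ f) = aeval (a P) f := by
    intro P f
    simp only [ev, Ideal.Quotient.lift_mk]
    rfl
  have hroot : ∀ (P : pf M) (u : (F[X] ⧸ Ideal.span {M})ˣ), Units.map (ev P).toMonoidHom u ∈ rootsOfUnity N K := by
    intro P u
    obtain ⟨f, hf⟩ := Ideal.Quotient.mk_surjective (u : F[X] ⧸ Ideal.span {M})
    have hz : ((Units.map (ev P).toMonoidHom u : Kˣ) : K) = aeval (a P) f := by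
      rw [← hev, hf]; rfl
    rw [mem_rootsOfUnity', hz]
    have hz0 : aeval (a P) f ≠ 0 := by rw [← hz]; exact Units.ne_zero _
    have h2 := aeval_pow_q f (a (P : F[X])) r
    rw [(deg_dvd_iff ((mem_pf hM0).mp P.2).2.1 (ha P P.2) r).mp (hd P P.2), ← hN, pow_succ] at h2
    exact mul_right_cancel₀ hz0 (by rw [one_mul]; exact h2.symm)
  let Φ : (F[X] ⧸ Ideal.span {M})ˣ →* (pf M → rootsOfUnity N K) :=
    MonoidHom.pi (fun P => (Units.map (ev P).toMonoidHom).codRestrict (rootsOfUnity N K) (hroot P))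
  have hΦ : ∀ u P, (((Φ u P : rootsOfUnity N K) : Kˣ) : K) = ev P u := by
    intro u P; rfl
  have hinj : Function.Injective Φ := by
    rw [injective_iff_map_eq_one]
    intro u hu
    obtain ⟨f, hf⟩ := Ideal.Quotient.mk_surjective (u : F[X] ⧸ Ideal.span {M})
    have h1 : M ∣ f - 1 := by
      apply dvd_of_pf hM hs
      intro P hP
      have h2 := hΦ u ⟨P, hP⟩
      rw [hu, ← hf, hev] at h2
      rw [← ((mem_pf hM0).mp hP).2.1.dvd_iff_aeval_eq_zero (ha P hP), map_sub, map_one, ← h2]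
      simp
    apply Units.ext
    rw [← hf, Units.val_one, ← map_one (Ideal.Quotient.mk (Ideal.span {M})), Ideal.Quotient.eq, Ideal.mem_span_singleton]
    exact h1
  let E := MonoidHom.ofInjective hinj
  obtain ⟨φ, hφ⟩ := MonoidHom.domRestrict_surjective (M := ℂ) Φ.range (χ.toUnitHom.comp E.symm.toMonoidHom)
  have hφ2 : ∀ u, φ (Φ u) = χ.toUnitHom u := by
    intro u
    have h1 := DFunLike.congr_fun hφ (E u)
    simp at h1
    exact h1
  choose e he1 he2 using fun P : pf M => hθ2 (φ.comp (MonoidHom.mulSingle (fun _ : pf M => rootsOfUnity N K) P))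
  refine ⟨fun P => if h : P ∈ pf M then e ⟨P, h⟩ else 1, ?_, ?_⟩
  · intro P
    simp only
    split_ifs
    · exact he1 _
    · exact le_refl _
  · intro f hf
    obtain ⟨u, hu⟩ := isUnit_mk_iff.mpr hf
    have h1 : χ (Ideal.Quotient.mk _ f) = ((φ (Φ u) : ℂˣ) : ℂ) := by
      rw [hφ2, MulChar.coe_toUnitHom, hu]
    have h2 : Φ u = ∏ P, Pi.mulSingle P (Φ u P) := (Finset.univ_prod_mulSingle _).symm
    have h3 : ((φ (Φ u) : ℂˣ) : ℂ) = ∏ P : pf M, θ ((aeval (a P) f) ^ e P) := by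
      rw [h2, map_prod, Units.coe_prod]
      apply Finset.prod_congr rfl
      intro P _
      rw [← hev, ← hu, ← hΦ]
      exact he2 P (Φ u P)
    rw [h1, h3]
    have hpow : ∀ P : pf M, ((aeval (a P) f) ^ e P) ^ N = 1 := by
      intro P
      rw [← pow_mul, mul_comm, pow_mul, ← hev, ← hu, ← hΦ]
      have := (mem_rootsOfUnity' N _).mp (Φ u P).2
      rw [this, one_pow]
    have h4 : ∀ s : Finset (pf M), (∏ P ∈ s, (aeval (a P) f) ^ e P) ^ N = 1 ∧
        ∏ P ∈ s, θ ((aeval (a P) f) ^ e P) = θ (∏ P ∈ s, (aeval (a P) f) ^ e P) := by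
      intro s
      induction s using Finset.induction_on with
      | empty => simp [hθone]
      | insert P s hP ih =>
        rw [Finset.prod_insert hP, Finset.prod_insert hP, hθ1 _ _ (hpow P) ih.1, ih.2, mul_pow, hpow P, ih.1]
        simp
    rw [(h4 Finset.univ).2]
    congr 1
    rw [← Finset.prod_coe_sort (pf M)]
    apply Finset.prod_congr rfl
    intro P _
    simp

end GRH
end FM

open scoped Classical
open Polynomial Filter
set_option linter.unusedSectionVars false
set_option linter.unusedVariables false
set_option linter.style.haveILetI false
namespace FM

section GRH2
variable {F : Type} [Field F] [Fintype F]

lemma rootMult_prod {K : Type} [Field K] {ι : Type} (s : Finset ι) (f : ι → K[X]) (hf : ∀ i ∈ s, f i ≠ 0) (b : K) :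
    rootMultiplicity b (∏ i ∈ s, f i) = ∑ i ∈ s, rootMultiplicity b (f i) := by
  induction s using Finset.induction_on with
  | empty => simp
  | insert i s hi ih =>
    rw [Finset.prod_insert hi, Finset.sum_insert hi, rootMultiplicity_mul, ih]
    · intro j hj; exact hf j (Finset.mem_insert_of_mem hj)
    · apply mul_ne_zero (hf i (Finset.mem_insert_self _ _))
      rw [Finset.prod_ne_zero_iff]
      intro j hj; exact hf j (Finset.mem_insert_of_mem hj)

lemma sum_dvd_geom (q d u : ℕ) (hd : 0 < d) :
    ∑ i ∈ Finset.range (d * u), (if d ∣ i then q ^ i else 0) = ∑ j ∈ Finset.range u, (q ^ d) ^ j := by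
  induction u with
  | zero => simp
  | succ u ih =>
    rw [Nat.mul_succ, Finset.sum_range_add, ih, Finset.sum_range_succ]
    congr 1
    rw [Finset.sum_eq_single 0]
    · simp [pow_mul]
    · intro i hi h0
      rw [Finset.mem_range] at hi
      rw [if_neg]
      intro h
      rw [Nat.dvd_add_right (Dvd.intro u rfl)] at h
      exact absurd (Nat.le_of_dvd (by omega) h) (by omega)
    · intro h
      exact absurd (Finset.mem_range.mpr hd) h

lemma rootMult_fac {K : Type} [Field K] [Algebra F K] (a b : K) (i : ℕ) :
    rootMultiplicity b (X ^ (Fintype.card F ^ i) - C a) = if b ^ (Fintype.card F ^ i) = a then Fintype.card F ^ i else 0 := by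
  split_ifs with h
  · rw [← h, C_pow, ← poly_sub_pow_q (F := F), rootMultiplicity_X_sub_C_pow]
  · apply rootMultiplicity_eq_zero
    simp only [IsRoot, eval_sub, eval_pow, eval_X, eval_C]
    exact sub_ne_zero.mpr h

lemma sum_theta_zero {K : Type} [Field K] [IsAlgClosed K] (N d : ℕ) (hd : 1 < d) (hdN : d ∣ N) (hNK : (N : K) ≠ 0) (θ : K → ℂ)
    (hθ1 : ∀ z w, z ^ N = 1 → w ^ N = 1 → θ (z * w) = θ z * θ w)
    (hθ2 : ∀ z, z ^ N = 1 → θ z = 1 → z = 1) :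
    ∑ z ∈ (nthRoots d (1 : K)).toFinset, θ z = 0 := by
  have hdK : (d : K) ≠ 0 := by
    obtain ⟨t, rfl⟩ := hdN
    push_cast at hNK
    exact left_ne_zero_of_mul hNK
  have : NeZero (d : K) := ⟨hdK⟩
  have : NeZero d := ⟨by omega⟩
  obtain ⟨ζ, hζ⟩ := HasEnoughRootsOfUnity.exists_primitiveRoot K d
  have hpow : ∀ z : K, z ^ d = 1 → z ^ N = 1 := by
    intro z hz
    obtain ⟨t, rfl⟩ := hdN
    rw [pow_mul, hz, one_pow]
  have h1 : θ ζ ≠ 1 := by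
    intro h
    exact hζ.ne_one hd (hθ2 ζ (hpow ζ hζ.pow_eq_one) h)
  have h2 : ∑ z ∈ (nthRoots d (1 : K)).toFinset, θ z = θ ζ * ∑ z ∈ (nthRoots d (1 : K)).toFinset, θ z := by
    rw [Finset.mul_sum]
    symm
    have hζ0 : ζ ≠ 0 := hζ.ne_zero (by omega)
    apply Finset.sum_bij (fun z _ => ζ * z)
    · intro z hz
      rw [Multiset.mem_toFinset, mem_nthRoots (by omega)] at hz ⊢
      rw [mul_pow, hz, hζ.pow_eq_one, one_mul]
    · intro z _ w _ h
      exact mul_left_cancel₀ hζ0 h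
    · intro z hz
      rw [Multiset.mem_toFinset, mem_nthRoots (by omega)] at hz
      refine ⟨ζ⁻¹ * z, ?_, ?_⟩
      · rw [Multiset.mem_toFinset, mem_nthRoots (by omega), mul_pow, hz, inv_pow, hζ.pow_eq_one]
        simp
      · rw [mul_inv_cancel_left₀ hζ0]
    · intro z hz
      rw [Multiset.mem_toFinset, mem_nthRoots (by omega)] at hz
      exact (hθ1 _ _ (hpow ζ hζ.pow_eq_one) (hpow z hz)).symm
  have h3 : (1 - θ ζ) * ∑ z ∈ (nthRoots d (1 : K)).toFinset, θ z = 0 := by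
    linear_combination h2
  rcases mul_eq_zero.mp h3 with h | h
  · exact absurd (sub_eq_zero.mp h).symm h1
  · exact h

/-- Extraction of the maximal power. -/
lemma extract_root {K : Type} [Field K] [IsAlgClosed K] (G : K[X]) (hG : G.Monic) (N : ℕ) (hN : 0 < N) :
    ∃ (t d : ℕ) (g : K[X]), t * d = N ∧ g.Monic ∧ g ^ t = G ∧
      (∀ e, (∀ b : K, d ∣ e * g.rootMultiplicity b) → d ∣ e) ∧
      (d = 1 → ∀ b, N ∣ G.rootMultiplicity b) ∧
      (∀ (Q : ℕ), (∀ b, G.IsRoot b → (X - C b) ^ Q = X ^ Q - C b) → expand K Q g = g ^ Q) := by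
  set S := G.roots.toFinset with hS
  set t := Nat.gcd N (S.gcd (fun b => G.rootMultiplicity b)) with ht
  have htN : t ∣ N := Nat.gcd_dvd_left _ _
  have ht0 : 0 < t := Nat.gcd_pos_of_pos_left _ hN
  have htb : ∀ b, t ∣ G.rootMultiplicity b := by
    intro b
    by_cases hb : b ∈ S
    · exact (Nat.gcd_dvd_right _ _).trans (Finset.gcd_dvd hb)
    · rw [hS, Multiset.mem_toFinset, mem_roots hG.ne_zero] at hb
      rw [rootMultiplicity_eq_zero hb]
      exact dvd_zero _
  obtain ⟨d, hd⟩ := htN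
  set g : K[X] := ∏ b ∈ S, (X - C b) ^ (G.rootMultiplicity b / t) with hg
  have hgt : g ^ t = G := by
    rw [hg, ← Finset.prod_pow]
    have h1 := (IsAlgClosed.splits G).eq_prod_roots_of_monic hG
    conv_rhs => rw [h1]
    rw [Finset.prod_multiset_map_count]
    apply Finset.prod_congr rfl
    intro b _
    rw [← pow_mul, Nat.div_mul_cancel (htb b), count_roots]
  have hgm : g.Monic := monic_prod_of_monic _ _ (fun b _ => (monic_X_sub_C b).pow _)
  refine ⟨t, d, g, hd.symm, hgm, hgt, ?_, ?_, ?_⟩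
  · intro e he
    have h1 : ∀ b, N ∣ e * G.rootMultiplicity b := by
      intro b
      rw [← hgt, rootMult_pow _ hgm.ne_zero, hd, mul_left_comm]
      exact Nat.mul_dvd_mul_left t (he b)
    have h2 : N ∣ e * t := by
      rw [ht, ← Nat.gcd_mul_left]
      apply Nat.dvd_gcd (Dvd.intro_left e rfl)
      have := Finset.dvd_gcd (s := S) (f := fun b => e * G.rootMultiplicity b) (a := N) (fun b _ => h1 b)
      rw [Finset.gcd_mul_left] at this
      simpa using this
    rw [hd, mul_comm e t] at h2
    exact Nat.dvd_of_mul_dvd_mul_left ht0 h2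
  · rintro rfl b
    rw [hd, mul_one]
    exact htb b
  · intro Q hQ
    rw [hg, map_prod, ← Finset.prod_pow]
    apply Finset.prod_congr rfl
    intro b hb
    rw [hS, Multiset.mem_toFinset, mem_roots hG.ne_zero] at hb
    rw [map_pow, map_sub, expand_X, expand_C, ← hQ b hb, ← pow_mul, ← pow_mul, mul_comm]

theorem S_rn {M : F[X]} (hM : M.Monic) (hs : Squarefree M)
    (χ : MulChar (F[X] ⧸ Ideal.span {M}) ℂ) (hχ : χ ≠ 1) :
    ∃ (r : ℕ) (C : ℝ), 0 < r ∧ ∀ n, 1 ≤ n →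
      ‖pS (fun f => χ (Ideal.Quotient.mk _ f)) (r * n)‖ ≤ C * (Real.sqrt (Fintype.card F)) ^ (r * n) := by
  have hM0 := hM.ne_zero
  let K := AlgebraicClosure F
  set q := Fintype.card F with hq
  obtain ⟨a, ha⟩ : ∃ a : F[X] → K, ∀ P ∈ pf M, aeval (a P) P = 0 := by
    have : ∀ P : F[X], ∃ x : K, P ∈ pf M → aeval x P = 0 := by
      intro P
      by_cases hP : P ∈ pf M
      · obtain ⟨x, hx⟩ := IsAlgClosed.exists_aeval_eq_zero K P (by
          have := ((mem_pf hM0).mp hP).2.1.degree_pos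
          exact this.ne')
        exact ⟨x, fun _ => hx⟩
      · exact ⟨0, fun h => absurd h hP⟩
    choose a ha using this
    exact ⟨a, ha⟩
  set r0 := ∏ P ∈ pf M, P.natDegree with hr0
  have hr0p : 0 < r0 := Finset.prod_pos (fun P hP => ((mem_pf hM0).mp hP).2.1.natDegree_pos)
  set r := 2 * r0 with hr
  have hdr : ∀ P ∈ pf M, P.natDegree ∣ r := fun P hP => Dvd.dvd.mul_left (Finset.dvd_prod_of_mem _ hP) 2
  have haR : ∀ P ∈ pf M, (a P) ^ (q ^ r) = a P := fun P hP =>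
    (deg_dvd_iff ((mem_pf hM0).mp hP).2.1 (ha P hP) r).mp (hdr P hP)
  have hR1 : 1 < q ^ r := Nat.one_lt_pow (by omega) one_lt_q
  obtain ⟨N, hN⟩ : ∃ N, N + 1 = q ^ r := ⟨q ^ r - 1, by omega⟩
  have hN0 : 0 < N := by omega
  have hNK : (N : K) ≠ 0 := by
    have h1 : ((N + 1 : ℕ) : K) = 0 := by
      rw [hN]; push_cast
      rw [hq, q_cast_zero (F := F), zero_pow (by omega)]
    push_cast at h1
    intro h
    rw [h, zero_add] at h1
    exact one_ne_zero h1
  obtain ⟨θ, hθn, hθm, hθ1, hθinj, hθ0, hθe⟩ := theta_exists K N hN0 hNK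
  obtain ⟨e, he1, he⟩ := char_repr hM hs χ a ha N r (by omega) hN hdr θ hθm hθ1 hθe
  set G : K[X] := ∏ P ∈ pf M, (∏ i ∈ Finset.range r, (X ^ (q ^ i) - C (a P))) ^ e P with hG
  have hfm : ∀ (x : K) (i : ℕ), (X ^ (q ^ i) - C x : K[X]).Monic := fun x i =>
    monic_X_pow_sub_C x (pow_pos Fintype.card_pos _).ne'
  have hGm : G.Monic := monic_prod_of_monic _ _ (fun P _ =>
    (monic_prod_of_monic _ _ (fun i _ => hfm _ _)).pow _)
  obtain ⟨t, d, g, htd, hgm, hgt, hdiv, hd1, hexp⟩ := extract_root G hGm N hN0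
  have hd0 : 0 < d := by
    rcases Nat.eq_zero_or_pos d with h | h
    · rw [h, mul_zero] at htd; omega
    · exact h
  have ht0 : t ≠ 0 := by
    rintro rfl; rw [zero_mul] at htd; omega
  have hdone : d ≠ 1 := by
    intro h
    apply hχ
    have hdv := hd1 h
    have hone : ∀ f, IsCoprime f M → χ (Ideal.Quotient.mk _ f) = 1 := by
      intro f hf
      rw [he f hf, Finset.prod_eq_one, hθ1]
      intro P hP
      obtain ⟨hPm, hPi, hPM⟩ := (mem_pf hM0).mp hP
      have hmult : G.rootMultiplicity (a P) = e P * ∑ i ∈ Finset.range r, (if P.natDegree ∣ i then q ^ i else 0) := by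
        rw [hG, rootMult_prod _ _ (fun P _ => ((monic_prod_of_monic _ _ (fun i _ => hfm _ _)).pow _).ne_zero)]
        rw [Finset.sum_eq_single P]
        · rw [rootMult_pow _ (monic_prod_of_monic _ _ (fun i _ => hfm _ _)).ne_zero,
            rootMult_prod _ _ (fun i _ => (hfm _ _).ne_zero)]
          congr 1
          apply Finset.sum_congr rfl
          intro i _
          rw [hq, rootMult_fac (F := F)]
          simp only [deg_dvd_iff hPi (ha P hP) i]
        · intro P' hP' hne
          rw [rootMult_pow _ (monic_prod_of_monic _ _ (fun i _ => hfm _ _)).ne_zero,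
            rootMult_prod _ _ (fun i _ => (hfm _ _).ne_zero), Finset.sum_eq_zero, mul_zero]
          intro i _
          rw [hq, rootMult_fac (F := F), if_neg]
          intro h5
          apply hne
          obtain ⟨hPm', hPi', hPM'⟩ := (mem_pf hM0).mp hP'
          have h6 : aeval (a P') P = 0 := by
            rw [← h5, aeval_pow_q, ha P hP, zero_pow (pow_pos Fintype.card_pos _).ne']
          exact (minpoly.eq_of_irreducible_of_monic hPi' (ha P' hP') hPm').trans (minpoly.eq_of_irreducible_of_monic hPi h6 hPm).symm
        · intro h; exact absurd hP h
      obtain ⟨u, hu⟩ := hdr P hP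
      have hdP := hPi.natDegree_pos
      have h7 := hdv (a P)
      rw [hmult, hu, sum_dvd_geom _ _ _ hdP] at h7
      have h8 := Nat.geomSum_eq (m := q ^ P.natDegree) (Nat.one_lt_pow hdP.ne' one_lt_q) u
      have hqd : 1 < q ^ P.natDegree := Nat.one_lt_pow hdP.ne' one_lt_q
      obtain ⟨v, hv⟩ : ∃ v, v + 1 = q ^ P.natDegree := ⟨q ^ P.natDegree - 1, by omega⟩
      have h9 : (∑ j ∈ Finset.range u, (q ^ P.natDegree) ^ j) * v = N := by
        have := geom_sum_mul_add v u
        rw [hv, ← pow_mul, ← hu, ← hN] at this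
        omega
      rw [← h9, mul_comm (e P)] at h7
      have hW : 0 < ∑ j ∈ Finset.range u, (q ^ P.natDegree) ^ j := by
        rcases Nat.eq_zero_or_pos (∑ j ∈ Finset.range u, (q ^ P.natDegree) ^ j) with h | h
        · rw [h, zero_mul] at h9; omega
        · exact h
      obtain ⟨y, hy⟩ := Nat.dvd_of_mul_dvd_mul_left hW h7
      have hz0 : aeval (a P) f ≠ 0 := by
        intro h0
        rw [hPi.dvd_iff_aeval_eq_zero (ha P hP)] at h0
        exact (pf_coprime hM0).mp hf P hP h0
      have h10 := aeval_pow_q f (a P) P.natDegree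
      rw [(deg_dvd_iff hPi (ha P hP) _).mp (dvd_refl _), ← hq, ← hv, pow_succ] at h10
      have h11 : aeval (a P) f ^ v = 1 := mul_right_cancel₀ hz0 (by rw [one_mul]; exact h10.symm)
      rw [hy, pow_mul, h11, one_pow]
    ext u
    obtain ⟨f, hf⟩ := Ideal.Quotient.mk_surjective (u : F[X] ⧸ Ideal.span {M})
    rw [MulChar.one_apply_coe, ← hf]
    apply hone
    rw [← isUnit_mk_iff, hf]
    exact u.isUnit
  have hd2 : 1 < d := by omega
  -- Stepanov
  obtain ⟨p, hp⟩ := CharP.exists F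
  have : CharP K p := charP_of_injective_algebraMap (algebraMap F K).injective p
  obtain ⟨fp, hpp, hfp⟩ := FiniteField.card F p
  have : Fact p.Prime := ⟨hpp⟩
  obtain ⟨C0, hC0⟩ := stepanov_sum (K := K) p d g.natDegree hd0
  refine ⟨r, C0, by omega, ?_⟩
  intro n hn
  have hrn : 1 ≤ r * n := Nat.mul_pos (by omega) hn
  set w' := ∑ j ∈ Finset.range n, (q ^ r) ^ j with hw'
  have hNw : N * w' + 1 = q ^ (r * n) := by
    have := geom_sum_mul_add N n
    rw [hN, ← pow_mul] at this
    rw [mul_comm, ← this]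
  have hw'0 : w' ≠ 0 := by
    intro h0
    rw [h0, mul_zero, zero_add] at hNw
    have : 1 < q ^ (r * n) := Nat.one_lt_pow (by omega) one_lt_q
    omega
  have hfrob : ∀ b, G.IsRoot b → b ^ (q ^ r) = b := by
    intro b hb
    rw [IsRoot, hG, eval_prod, Finset.prod_eq_zero_iff] at hb
    obtain ⟨P, hP, h1⟩ := hb
    rw [eval_pow, pow_eq_zero_iff (by have := he1 P; omega), eval_prod, Finset.prod_eq_zero_iff] at h1
    obtain ⟨i, _, h2⟩ := h1
    rw [eval_sub, eval_pow, eval_X, eval_C, sub_eq_zero] at h2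
    have h3 := haR P hP
    rw [← h2, ← pow_mul, mul_comm, pow_mul] at h3
    have h4 : (b ^ (q ^ r) - b) ^ (q ^ i) = 0 := by
      rw [hq, sub_pow_q, ← hq, h3, sub_self]
    rw [pow_eq_zero_iff (pow_pos Fintype.card_pos _).ne', sub_eq_zero] at h4
    exact h4
  have hfrob2 : ∀ n b, G.IsRoot b → b ^ (q ^ (r * n)) = b := by
    intro n b hb
    induction n with
    | zero => simp
    | succ n ih => rw [Nat.mul_succ, pow_add, pow_mul, ih, hfrob b hb]
  have hmain := hC0 (fp * (r0 * n)) (q ^ (r0 * n)) (q ^ (r * n)) (t * w')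
    (by rw [hq, hfp, ← pow_mul]) (by rw [← pow_mul, hr]; congr 1; ring) (by rw [← hNw, ← htd]; ring)
    g hgm rfl (hexp _ (fun b hb => by
      rw [hq, poly_sub_pow_q, ← C_pow, ← hq, hfrob2 n b hb])) hdiv (fld F K (r * n)) (card_fld hrn)
    (fun x hx => (mem_fld hrn).mp hx) (nthRoots d (1 : K)).toFinset (fun z hz => by
      rw [Multiset.mem_toFinset, mem_nthRoots hd0]; exact hz)
    ((Multiset.toFinset_card_le _).trans (card_nthRoots d 1)) θ hθn
    (sum_theta_zero N d hd2 (Dvd.intro_left t htd) hNK θ hθm hθinj)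
  have hsum : pS (fun f => χ (Ideal.Quotient.mk _ f)) (r * n) =
      ∑ x ∈ fld F K (r * n) with g.eval x ≠ 0, θ (g.eval x ^ (t * w')) := by
    rw [pS_eq (K := K) _ hrn, Finset.sum_filter]
    apply Finset.sum_congr rfl
    intro x hx
    have hx2 := (mem_fld hrn).mp hx
    have hIntg : IsIntegral F x := Algebra.IsIntegral.isIntegral x
    have hmi := minpoly.irreducible hIntg
    have hmm := minpoly.monic hIntg
    have hmr := minpoly.aeval F x
    have hmd := (deg_dvd_iff hmi hmr (r * n)).mpr hx2
    set fx := (minpoly F x) ^ (r * n / (minpoly F x).natDegree) with hfx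
    have h1 : χ (Ideal.Quotient.mk _ (minpoly F x)) ^ (r * n / (minpoly F x).natDegree) = χ (Ideal.Quotient.mk _ fx) := by
      rw [hfx, map_pow, map_pow]
    rw [h1]
    have hval : ∀ P ∈ pf M, aeval (a P) fx = (∏ i ∈ Finset.range r, (x ^ (q ^ i) - a P)) ^ w' := by
      intro P hP
      rw [hfx, aeval_norm hmi hmm hmr hmd, norm_split _ _ r (haR P hP)]
      congr 1
      rw [Finset.prod_congr rfl (fun i _ => (neg_sub (x ^ (q ^ i)) (a P)).symm), Finset.prod_neg, Finset.card_range, hr, pow_mul]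
      simp
    have hGx : G.eval x = ∏ P ∈ pf M, (∏ i ∈ Finset.range r, (x ^ (q ^ i) - a P)) ^ e P := by
      rw [hG, eval_prod]
      simp [eval_prod]
    have hgG : g.eval x ^ t = G.eval x := by rw [← hgt, eval_pow]
    by_cases hgx : g.eval x = 0
    · rw [if_neg (by simpa using hgx)]
      apply MulChar.map_nonunit
      rw [isUnit_mk_iff, pf_coprime hM0]
      push Not
      rw [hgx, zero_pow ht0] at hgG
      rw [← hgG] at hGx
      obtain ⟨P, hP, h2⟩ := Finset.prod_eq_zero_iff.mp hGx.symm
      rw [pow_eq_zero_iff (by have := he1 P; omega)] at h2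
      refine ⟨P, hP, ?_⟩
      rw [← ((mem_pf hM0).mp hP).2.1.dvd_iff_aeval_eq_zero (ha P hP), hval P hP, h2, zero_pow hw'0]
    · rw [if_pos hgx]
      have hcop : IsCoprime fx M := by
        rw [pf_coprime hM0]
        intro P hP hdv
        rw [← ((mem_pf hM0).mp hP).2.1.dvd_iff_aeval_eq_zero (ha P hP), hval P hP, pow_eq_zero_iff hw'0] at hdv
        apply hgx
        have : G.eval x = 0 := by
          rw [hGx]
          apply Finset.prod_eq_zero hP
          rw [hdv, zero_pow]
          have := he1 P; omega
        rw [← hgG, pow_eq_zero_iff ht0] at this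
        exact this
      rw [he fx hcop, pow_mul, hgG, hGx, ← Finset.prod_pow]
      congr 1
      apply Finset.prod_congr rfl
      intro P hP
      rw [hval P hP, ← pow_mul, ← pow_mul, mul_comm]
  rw [hsum]
  refine hmain.trans (le_of_eq ?_)
  congr 1
  rw [hr, mul_assoc, pow_mul (Real.sqrt _), Real.sq_sqrt (by positivity)]
  push_cast
  rfl

end GRH2
end FM

open scoped Classical
open Polynomial Filter
set_option linter.unusedSectionVars false
set_option linter.unusedVariables false
set_option linter.style.haveILetI false
namespace FM
section GRH3
variable {F : Type} [Field F] [Fintype F]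

lemma mulchar_norm_le {M : F[X]} (hM : M.Monic) (χ : MulChar (F[X] ⧸ Ideal.span {M}) ℂ) (x) : ‖χ x‖ ≤ 1 := by
  have := quot_finite hM
  by_cases hx : IsUnit x
  · obtain ⟨u, rfl⟩ := hx
    obtain ⟨n, hn, h⟩ := (isOfFinOrder_iff_pow_eq_one.mp (isOfFinOrder_of_finite u))
    have : (χ u) ^ n = 1 := by
      rw [← map_pow, ← Units.val_pow_eq_pow_val, h]; simp
    exact (Complex.norm_eq_one_of_pow_eq_one this (by omega)).le
  · rw [χ.map_nonunit hx]; simp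

lemma pS_norm_le (χ : F[X] → ℂ) (h : ∀ f, ‖χ f‖ ≤ 1) {k : ℕ} (hk : 1 ≤ k) : ‖pS χ k‖ ≤ (Fintype.card F : ℝ) ^ k := by
  rw [pS_eq (K := AlgebraicClosure F) χ hk]
  refine (norm_sum_le _ _).trans ?_
  have : ∀ x ∈ fld F (AlgebraicClosure F) k, ‖χ (minpoly F x) ^ (k / (minpoly F x).natDegree)‖ ≤ 1 := by
    intro x _
    rw [norm_pow]
    exact pow_le_one₀ (norm_nonneg _) (h _)
  refine (Finset.sum_le_sum this).trans ?_
  simp [card_fld hk]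

lemma mk_L_mul (χ : F[X] → ℂ) (hχ : ∀ f g, χ (f * g) = χ f * χ g) (h1 : χ 1 = 1) :
    PowerSeries.mk (fun n => ∑ f ∈ mon F n, χ f) * PowerSeries.mk (fun n => ∑ f ∈ mon F n, (pmu f : ℂ) * χ f) = 1 := by
  rw [mul_comm]
  ext n
  rw [PowerSeries.coeff_mul, PowerSeries.coeff_one]
  simp only [PowerSeries.coeff_mk]
  have := sum_pmu_pairs n χ
  rw [h1] at this
  rw [← this]
  apply Finset.sum_congr rfl
  intro ij _
  rw [Finset.sum_mul_sum]
  apply Finset.sum_congr rfl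
  intro a _
  apply Finset.sum_congr rfl
  intro c _
  rw [hχ]; ring

theorem grh (F : Type) [Field F] [Fintype F] (ε : ℝ) (hε : 0 < ε) : ∃ C : ℝ, 0 < C ∧ ∀ M : F[X], M.Monic → Squarefree M →
    ∀ χ : MulChar (F[X] ⧸ Ideal.span {M}) ℂ, ∀ n : ℕ,
    ‖∑ f ∈ mon F n, (pmu f : ℂ) * χ (Ideal.Quotient.mk _ f)‖ ≤
      C * (Fintype.card F : ℝ) ^ (ε * M.natDegree) * (Fintype.card F : ℝ) ^ ((1 / 2 + ε) * n) := by
  set q : ℝ := (Fintype.card F : ℝ) with hqdef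
  have hq1 : 1 < q := by rw [hqdef]; exact_mod_cast one_lt_q
  obtain ⟨C, hC, hb⟩ := coeff_bound q hq1 ε hε
  refine ⟨C * (1 + q), by positivity, ?_⟩
  intro M hM hs χ n
  have hfin := quot_finite hM
  have : Fintype (F[X] ⧸ Ideal.span {M}) := Fintype.ofFinite _
  set m := M.natDegree with hm
  set c : F[X] → ℂ := fun f => χ (Ideal.Quotient.mk _ f) with hc
  have hcm : ∀ f g, c (f * g) = c f * c g := by intro f g; simp [hc]
  have hc1 : c 1 = 1 := by simp [hc]
  have hcn : ∀ f, ‖c f‖ ≤ 1 := fun f => mulchar_norm_le hM χ _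
  set L : ℕ → ℂ := fun n => ∑ f ∈ mon F n, c f with hL
  set a : ℕ → ℂ := fun n => ∑ f ∈ mon F n, (pmu f : ℂ) * c f with ha
  have hL0 : L 0 = 1 := by simp [hL, mon_zero, hc1]
  have ha0 : a 0 = 1 := by simp [ha, mon_zero, hc1, pmu_one]
  have hLa : PowerSeries.mk L * PowerSeries.mk a = 1 := mk_L_mul c hcm hc1
  have hrec : NRec L (pS c) := newton_L c hcm hc1
  have hSq : ∀ k, 1 ≤ k → ‖pS c k‖ ≤ q ^ k := fun k hk => pS_norm_le c hcn hk
  change ‖a n‖ ≤ _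
  have hpos : 0 ≤ C * q ^ (ε * m) * q ^ ((1 / 2 + ε) * n) := by positivity
  by_cases hχ : χ = 1
  · set Lt : ℕ → ℂ := fun n => PowerSeries.coeff n (PowerSeries.mk L * (1 - PowerSeries.C (q : ℂ) * PowerSeries.X)) with hLt
    have hrt : NRec Lt (fun k => pS c k - (q : ℂ) ^ k) := nrec_mul hrec _
    set b : ℕ → ℂ := fun n => PowerSeries.coeff n (PowerSeries.mk a * PowerSeries.mk (fun n => (q : ℂ) ^ n)) with hbd
    have hgeo : PowerSeries.mk (fun n => (q : ℂ) ^ n) * (1 - PowerSeries.C (q : ℂ) * PowerSeries.X) = 1 := by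
      ext j
      rw [mul_sub, mul_one, mul_left_comm, map_sub, PowerSeries.coeff_C_mul, PowerSeries.coeff_mk, PowerSeries.coeff_one]
      cases j with
      | zero => simp
      | succ j => rw [PowerSeries.coeff_succ_mul_X, PowerSeries.coeff_mk, if_neg (by omega), pow_succ]; ring
    have hmkb : PowerSeries.mk b = PowerSeries.mk a * PowerSeries.mk (fun n => (q : ℂ) ^ n) := by
      ext j; simp [hbd]
    have hmkL : PowerSeries.mk Lt = PowerSeries.mk L * (1 - PowerSeries.C (q : ℂ) * PowerSeries.X) := by
      ext j; simp [hLt]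
    have hLb : PowerSeries.mk Lt * PowerSeries.mk b = 1 := by
      rw [hmkb, hmkL]
      calc _ = (PowerSeries.mk L * PowerSeries.mk a) * (PowerSeries.mk (fun n => (q : ℂ) ^ n) * (1 - PowerSeries.C (q : ℂ) * PowerSeries.X)) := by ring
        _ = 1 := by rw [hLa, hgeo, one_mul]
    have hrb := nrec_inv hrt hLb
    have hb0 : b 0 = 1 := by simp [hbd, ha0]
    have hcount : ∀ k, 1 ≤ k → ‖pS c k - (q : ℂ) ^ k‖ ≤ q ^ k ∧ ‖pS c k - (q : ℂ) ^ k‖ ≤ m := by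
      intro k hk
      have e1 : pS c k - (q : ℂ) ^ k = ∑ x ∈ fld F (AlgebraicClosure F) k, (c (minpoly F x) ^ (k / (minpoly F x).natDegree) - 1) := by
        rw [Finset.sum_sub_distrib, ← pS_eq c hk]
        simp [card_fld hk, hqdef]
      have e2 : ∀ x ∈ fld F (AlgebraicClosure F) k, ‖c (minpoly F x) ^ (k / (minpoly F x).natDegree) - 1‖ ≤ if x ∈ (M.map (algebraMap F (AlgebraicClosure F))).roots.toFinset then (1 : ℝ) else 0 := by
        intro x hx
        have hIntg : IsIntegral F x := Algebra.IsIntegral.isIntegral x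
        by_cases hcop : IsCoprime (minpoly F x) M
        · have : c (minpoly F x) = 1 := by
            simp only [hc, hχ]
            exact MulChar.one_apply (isUnit_mk_iff.mpr hcop)
          rw [this]
          split_ifs <;> simp
        · have h0 : c (minpoly F x) = 0 := by
            simp only [hc]
            exact χ.map_nonunit (fun h => hcop (isUnit_mk_iff.mp h))
          have hd : minpoly F x ∣ M := by
            by_contra hnd
            exact hcop (((minpoly.irreducible hIntg).coprime_iff_not_dvd).mpr hnd)
          rw [if_pos, h0]
          · by_cases he : k / (minpoly F x).natDegree = 0
            · rw [he]; simp
            · rw [zero_pow he]; simp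
          · rw [Multiset.mem_toFinset, mem_roots (Polynomial.map_ne_zero hM.ne_zero), IsRoot, eval_map_algebraMap]
            exact (minpoly.dvd_iff).mp hd
      have e3 := (norm_sum_le _ _).trans (Finset.sum_le_sum e2)
      rw [← e1] at e3
      constructor
      · refine e3.trans ((Finset.sum_le_sum (g := fun _ => (1 : ℝ)) (by intro x _; split_ifs <;> norm_num)).trans ?_)
        simp [card_fld hk, hqdef]
      · refine e3.trans ?_
        rw [Finset.sum_ite, Finset.sum_const_zero, add_zero, Finset.sum_const, nsmul_eq_mul, mul_one]
        have h1 : (Finset.filter (fun x => x ∈ (M.map (algebraMap F (AlgebraicClosure F))).roots.toFinset) (fld F (AlgebraicClosure F) k)).card ≤ (M.map (algebraMap F (AlgebraicClosure F))).roots.toFinset.card :=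
          Finset.card_le_card (fun x hx => (Finset.mem_filter.mp hx).2)
        have h2 := Multiset.toFinset_card_le (M.map (algebraMap F (AlgebraicClosure F))).roots
        have h3 := card_roots' (M.map (algebraMap F (AlgebraicClosure F)))
        rw [natDegree_map] at h3
        exact_mod_cast h1.trans (h2.trans h3)
    have hbb := hb m b _ hb0 hrb (fun k hk => by rw [norm_neg]; exact (hcount k hk).1)
      (fun k hk => by
        rw [norm_neg]
        refine (hcount k hk).2.trans ?_
        have : 1 ≤ Real.sqrt q ^ k := one_le_pow₀ (by rw [Real.one_le_sqrt]; exact hq1.le)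
        have h0 : (0:ℝ) ≤ m := by positivity
        nlinarith)
    have hab : PowerSeries.mk a = PowerSeries.mk b - PowerSeries.C (q : ℂ) * (PowerSeries.mk b * PowerSeries.X) := by
      rw [hmkb]
      calc PowerSeries.mk a = PowerSeries.mk a * (PowerSeries.mk (fun n => (q : ℂ) ^ n) * (1 - PowerSeries.C (q : ℂ) * PowerSeries.X)) := by rw [hgeo, mul_one]
        _ = _ := by ring
    have han := congrArg (PowerSeries.coeff n) hab
    rw [PowerSeries.coeff_mk, map_sub, PowerSeries.coeff_C_mul, PowerSeries.coeff_mk] at han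
    cases n with
    | zero =>
      have hz : ‖a 0‖ ≤ C * q ^ (ε * m) * q ^ ((1 / 2 + ε) * (0 : ℕ)) := by
        rw [ha0, ← hb0]; exact hbb 0
      have : 0 ≤ q := by linarith
      nlinarith
    | succ j =>
      rw [PowerSeries.coeff_succ_mul_X, PowerSeries.coeff_mk] at han
      rw [han]
      refine (norm_sub_le _ _).trans ?_
      rw [norm_mul, Complex.norm_real, Real.norm_of_nonneg (by linarith)]
      have h1 := hbb (j + 1)
      have h2 := hbb j
      have h3 : C * q ^ (ε * m) * q ^ ((1 / 2 + ε) * j) ≤ C * q ^ (ε * m) * q ^ ((1 / 2 + ε) * (j + 1 : ℕ)) := by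
        apply mul_le_mul_of_nonneg_left _ (by positivity)
        apply Real.rpow_le_rpow_of_exponent_le hq1.le
        push_cast
        nlinarith
      have h4 := mul_le_mul_of_nonneg_left (h2.trans h3) (show 0 ≤ q by linarith)
      linarith
  · have hLm : ∀ n, m ≤ n → L n = 0 := by
      intro n hn
      simp only [hL, hc]
      rw [sum_mon_mod hM (fun x => χ x) hn, MulChar.sum_eq_zero_of_ne_one hχ, mul_zero]
    obtain ⟨r, C', hr, hS⟩ := S_rn hM hs χ hχ
    have hSb := S_bound hL0 hrec m hLm q (by linarith) r hr C' hS
    have hra := nrec_inv hrec hLa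
    have := hb m a _ ha0 hra (fun k hk => by rw [norm_neg]; exact hSq k hk) (fun k hk => by rw [norm_neg]; exact hSb k hk) n
    have : 0 ≤ q := by linarith
    nlinarith

end GRH3
end FM

open scoped Classical
open Polynomial Filter
set_option linter.unusedSectionVars false
set_option linter.unusedVariables false
set_option linter.style.haveILetI false
namespace FM
section CharExp

lemma char_norm_one {G : Type} [CommGroup G] [Finite G] (φ : G →* ℂˣ) (u : G) : ‖(φ u : ℂ)‖ = 1 := by
  obtain ⟨n, hn, h⟩ := (isOfFinOrder_iff_pow_eq_one.mp (isOfFinOrder_of_finite u))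
  have : ((φ u : ℂˣ) : ℂ) ^ n = 1 := by
    rw [← Units.val_pow_eq_pow_val, ← map_pow, h]; simp
  exact (Complex.norm_eq_one_of_pow_eq_one this (by omega))

lemma char_conj {G : Type} [CommGroup G] [Finite G] (φ : G →* ℂˣ) (u : G) :
    (starRingEnd ℂ) (φ u : ℂ) = (φ u⁻¹ : ℂ) := by
  rw [map_inv, Units.val_inv_eq_inv_val, Complex.inv_eq_conj (char_norm_one φ u)]

lemma sum_chars {G : Type} [CommGroup G] [Fintype G] [Fintype (G →* ℂˣ)] (a : G) :
    ∑ φ : G →* ℂˣ, (φ a : ℂ) = if a = 1 then (Fintype.card G : ℂ) else 0 := by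
  split_ifs with ha
  · subst ha
    have := Fintype.card_congr (CommGroup.monoidHom_mulEquiv_of_hasEnoughRootsOfUnity G ℂ).some.toEquiv
    simp [this]
  · obtain ⟨χ, hχ⟩ := CommGroup.exists_apply_ne_one_of_hasEnoughRootsOfUnity G ℂ ha
    have hχ' : (χ a : ℂ) ≠ 1 := fun h => hχ (Units.ext h)
    refine eq_zero_of_mul_eq_self_left hχ' ?_
    rw [Finset.mul_sum]
    exact Fintype.sum_bijective _ (Group.mulLeft_bijective χ) _ _ fun χ' ↦ by simp

lemma char_expand {G ι : Type} [CommGroup G] [Fintype G] (g : G → ℂ) (hg : ∀ u, ‖g u‖ ≤ 1) (s : Finset ι)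
    (c : ι → ℂ) (u : ι → G) (B : ℝ) (hB : ∀ φ : G →* ℂˣ, ‖∑ i ∈ s, c i * (φ (u i) : ℂ)‖ ≤ B) :
    ‖∑ i ∈ s, c i * g (u i)‖ ≤ Real.sqrt (Fintype.card G) * B := by
  have hfin : Finite (G →* ℂˣ) := Finite.of_equiv _ (CommGroup.monoidHom_mulEquiv_of_hasEnoughRootsOfUnity G ℂ).some.symm.toEquiv
  have : Fintype (G →* ℂˣ) := Fintype.ofFinite _
  have hcard : Fintype.card (G →* ℂˣ) = Fintype.card G :=
    Fintype.card_congr (CommGroup.monoidHom_mulEquiv_of_hasEnoughRootsOfUnity G ℂ).some.toEquiv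
  have hB0 : 0 ≤ B := (norm_nonneg _).trans (hB 1)
  set N : ℝ := (Fintype.card G : ℝ) with hN
  have hNpos : 0 < N := by rw [hN]; exact_mod_cast Fintype.card_pos
  set gh : (G →* ℂˣ) → ℂ := fun φ => ∑ v, g v * (φ v⁻¹ : ℂ) with hgh
  have inv : ∀ v, (N : ℂ) * g v = ∑ φ, gh φ * (φ v : ℂ) := by
    intro v
    simp only [hgh, Finset.sum_mul]
    rw [Finset.sum_comm]
    have : ∀ y, ∑ φ : G →* ℂˣ, g y * (φ y⁻¹ : ℂ) * (φ v : ℂ) = if v = y then (N : ℂ) * g v else 0 := by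
      intro y
      have h1 : ∑ φ : G →* ℂˣ, g y * (φ y⁻¹ : ℂ) * (φ v : ℂ) = g y * ∑ φ : G →* ℂˣ, (φ (y⁻¹ * v) : ℂ) := by
        rw [Finset.mul_sum]
        apply Finset.sum_congr rfl
        intro φ _
        rw [map_mul, Units.val_mul]; ring
      rw [h1, sum_chars]
      by_cases h : v = y
      · subst h; simp [hN]; ring
      · rw [if_neg h, if_neg, mul_zero]
        intro h2
        exact h (inv_mul_eq_one.mp h2).symm
    simp only [this]
    simp
  have pars : ∑ φ, ‖gh φ‖ ^ 2 ≤ N ^ 2 := by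
    have e : (∑ φ, ((‖gh φ‖ ^ 2 : ℝ) : ℂ)) = N * ∑ v, ((‖g v‖ ^ 2 : ℝ) : ℂ) := by
      have h1 : ∀ φ, ((‖gh φ‖ ^ 2 : ℝ) : ℂ) = ∑ v, (starRingEnd ℂ) (g v) * (gh φ * (φ v : ℂ)) := by
        intro φ
        push_cast
        rw [← Complex.mul_conj', mul_comm]
        conv_lhs => rw [hgh]
        simp only []
        rw [map_sum, Finset.sum_mul]
        apply Finset.sum_congr rfl
        intro v _
        rw [map_mul, char_conj, inv_inv]
        ring
      rw [Finset.sum_congr rfl (fun φ _ => h1 φ), Finset.sum_comm, Finset.mul_sum]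
      apply Finset.sum_congr rfl
      intro v _
      rw [← Finset.mul_sum, ← inv v]
      push_cast
      rw [← Complex.mul_conj']; ring
    have e' : ∑ φ, ‖gh φ‖ ^ 2 = N * ∑ v, ‖g v‖ ^ 2 := by exact_mod_cast e
    rw [e', pow_two]
    apply mul_le_mul_of_nonneg_left _ hNpos.le
    refine (Finset.sum_le_sum (g := fun _ => (1:ℝ)) (fun v _ => pow_le_one₀ (norm_nonneg _) (hg v))).trans ?_
    simp [hN]
  have l1 : ∑ φ, ‖gh φ‖ ≤ Real.sqrt N * N := by
    have h := sq_sum_le_card_mul_sum_sq (s := (Finset.univ : Finset (G →* ℂˣ))) (f := fun φ => ‖gh φ‖)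
    rw [Finset.card_univ, hcard, ← hN] at h
    refine le_of_pow_le_pow_left₀ (n := 2) (by norm_num) (by positivity) ?_
    rw [mul_pow, Real.sq_sqrt hNpos.le]
    exact h.trans (mul_le_mul_of_nonneg_left pars hNpos.le)
  have key : (N : ℂ) * ∑ i ∈ s, c i * g (u i) = ∑ φ, gh φ * ∑ i ∈ s, c i * (φ (u i) : ℂ) := by
    rw [Finset.mul_sum]
    simp only [Finset.mul_sum]
    rw [Finset.sum_comm]
    apply Finset.sum_congr rfl
    intro i _
    rw [mul_left_comm, inv, Finset.mul_sum]
    apply Finset.sum_congr rfl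
    intro φ _
    ring
  have hnn : N * ‖∑ i ∈ s, c i * g (u i)‖ ≤ N * (Real.sqrt N * B) := by
    have : ‖(N : ℂ) * ∑ i ∈ s, c i * g (u i)‖ = N * ‖∑ i ∈ s, c i * g (u i)‖ := by
      rw [norm_mul, Complex.norm_real, Real.norm_of_nonneg hNpos.le]
    rw [← this, key]
    refine (norm_sum_le _ _).trans ?_
    calc _ ≤ ∑ φ, ‖gh φ‖ * B := by
          apply Finset.sum_le_sum
          intro φ _
          rw [norm_mul]
          exact mul_le_mul_of_nonneg_left (hB φ) (norm_nonneg _)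
      _ = (∑ φ, ‖gh φ‖) * B := by rw [Finset.sum_mul]
      _ ≤ Real.sqrt N * N * B := mul_le_mul_of_nonneg_right l1 hB0
      _ = _ := by ring
  exact le_of_mul_le_mul_left hnn hNpos

end CharExp

section App
variable {F : Type} [Field F] [Fintype F]

/-- The weight attached to the modulus `M` and an additive character modulo `D`. -/
noncomputable def wt (M D : F[X]) (ψ : AddChar (F[X] ⧸ Ideal.span {D}) ℂ) (f : F[X]) : ℂ :=
  if IsCoprime f M then ψ (Ring.inverse (Ideal.Quotient.mk _ f)) else 0

lemma psi_norm {D : F[X]} (hD : D.Monic) (ψ : AddChar (F[X] ⧸ Ideal.span {D}) ℂ) (x) : ‖ψ x‖ = 1 := by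
  have := quot_finite hD
  exact AddChar.norm_apply ψ x

lemma wt_norm {M D : F[X]} (hD : D.Monic) (ψ : AddChar (F[X] ⧸ Ideal.span {D}) ℂ) (f : F[X]) : ‖wt M D ψ f‖ ≤ 1 := by
  rw [wt]
  split_ifs
  · rw [psi_norm hD]
  · simp

theorem large_n (F : Type) [Field F] [Fintype F] (ε : ℝ) (hε : 0 < ε) : ∃ C : ℝ, 0 < C ∧ ∀ M D : F[X], M.Monic → Squarefree M →
    D.Monic → D ∣ M → ∀ ψ : AddChar (F[X] ⧸ Ideal.span {D}) ℂ, ∀ n : ℕ,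
    ‖∑ f ∈ mon F n, (pmu f : ℂ) * wt M D ψ f‖ ≤
      (Fintype.card F : ℝ) ^ ((1 / 2 : ℝ) * D.natDegree) *
      (C * (Fintype.card F : ℝ) ^ (ε * M.natDegree) * (Fintype.card F : ℝ) ^ ((1 / 2 + ε) * n)) := by
  obtain ⟨C, hC, hb⟩ := grh F ε hε
  refine ⟨C, hC, ?_⟩
  intro M D hM hs hD hDM ψ n
  have := quot_finite hD
  have : Fintype (F[X] ⧸ Ideal.span {D}) := Fintype.ofFinite _
  set q : ℝ := (Fintype.card F : ℝ) with hqdef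
  have hq1 : 1 < q := by rw [hqdef]; exact_mod_cast one_lt_q
  have hle : Ideal.span {M} ≤ Ideal.span {D} := Ideal.span_singleton_le_span_singleton.mpr hDM
  have hcop : ∀ f, IsCoprime f M → IsUnit (Ideal.Quotient.mk (Ideal.span {D}) f) := by
    intro f hf
    exact isUnit_mk_iff.mpr (hf.of_isCoprime_of_dvd_right hDM)
  set u : F[X] → (F[X] ⧸ Ideal.span {D})ˣ := fun f => if h : IsUnit (Ideal.Quotient.mk (Ideal.span {D}) f) then h.unit else 1 with hu
  have e1 : ∑ f ∈ mon F n, (pmu f : ℂ) * wt M D ψ f = ∑ f ∈ (mon F n).filter (fun f => IsCoprime f M), (pmu f : ℂ) * (fun v : (F[X] ⧸ Ideal.span {D})ˣ => ψ ((v⁻¹ : (F[X] ⧸ Ideal.span {D})ˣ) : F[X] ⧸ Ideal.span {D})) (u f) := by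
    rw [Finset.sum_filter]
    apply Finset.sum_congr rfl
    intro f _
    rw [wt]
    split_ifs with h
    · simp only [hu]
      rw [dif_pos (hcop f h)]
      congr 2
      conv_lhs => rw [← (hcop f h).unit_spec]
      rw [Ring.inverse_unit]
    · simp
  rw [e1]
  refine (char_expand (fun v : (F[X] ⧸ Ideal.span {D})ˣ => ψ ((v⁻¹ : (F[X] ⧸ Ideal.span {D})ˣ) : F[X] ⧸ Ideal.span {D})) (fun v => by rw [psi_norm hD]) _ _ u (C * q ^ (ε * M.natDegree) * q ^ ((1 / 2 + ε) * n)) ?_).trans ?_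
  · intro φ
    have := hb M hM hs (MulChar.ofUnitHom (φ.comp (Units.map ((Ideal.Quotient.factor hle : _ →+* _) : (F[X] ⧸ Ideal.span {M}) →* (F[X] ⧸ Ideal.span {D}))))) n
    refine le_trans (le_of_eq ?_) this
    congr 1
    rw [Finset.sum_filter]
    apply Finset.sum_congr rfl
    intro f _
    split_ifs with h
    · congr 1
      have h1 := isUnit_mk_iff.mpr h
      conv_rhs => rw [← h1.unit_spec]
      rw [MulChar.ofUnitHom_coe]
      rw [MonoidHom.comp_apply]
      congr 2
      ext
      simp only [hu]
      rw [dif_pos (hcop f h)]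
      simp
    · rw [MulChar.map_nonunit _ (fun h1 => h (isUnit_mk_iff.mp h1)), mul_zero]
  · apply mul_le_mul_of_nonneg_right _ (by positivity)
    have h1 : Fintype.card (F[X] ⧸ Ideal.span {D})ˣ ≤ Fintype.card F ^ D.natDegree := by
      rw [← card_quot hD]
      exact Fintype.card_le_of_injective _ Units.val_injective
    have h2 : ((Fintype.card (F[X] ⧸ Ideal.span {D})ˣ : ℕ) : ℝ) ≤ q ^ D.natDegree := by rw [hqdef]; exact_mod_cast h1
    rw [Real.sqrt_le_left (by positivity)]
    refine h2.trans (le_of_eq ?_)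
    rw [← Real.rpow_natCast, ← Real.rpow_natCast, ← Real.rpow_mul (by positivity)]
    congr 1
    push_cast
    ring

end App
end FM

open scoped Classical
open Polynomial Filter
set_option linter.unusedSectionVars false
set_option linter.unusedVariables false
set_option linter.style.haveILetI false
namespace FM
section Bilin

lemma addchar_conj {R : Type} [CommRing R] [Fintype R] (ψ : AddChar R ℂ) (x : R) :
    (starRingEnd ℂ) (ψ x) = ψ (-x) := by
  rw [AddChar.map_neg_eq_inv, Complex.inv_eq_conj (AddChar.norm_apply ψ x)]

lemma parseval {R : Type} [CommRing R] [Fintype R] (ψ : AddChar R ℂ) (hψ : ψ.IsPrimitive) (v : R → ℂ) :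
    ∑ a, ‖∑ b, v b * ψ (a * b)‖ ^ 2 = (Fintype.card R : ℝ) * ∑ b, ‖v b‖ ^ 2 := by
  have e : (∑ a, ((‖∑ b, v b * ψ (a * b)‖ ^ 2 : ℝ) : ℂ)) = (Fintype.card R : ℂ) * ∑ b, ((‖v b‖ ^ 2 : ℝ) : ℂ) := by
    have h1 : ∀ a, ((‖∑ b, v b * ψ (a * b)‖ ^ 2 : ℝ) : ℂ)
        = ∑ b, ∑ c, v b * (starRingEnd ℂ) (v c) * ψ (a * (b - c)) := by
      intro a
      push_cast
      rw [← Complex.mul_conj', map_sum, Finset.sum_mul_sum]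
      apply Finset.sum_congr rfl
      intro b _
      apply Finset.sum_congr rfl
      intro c _
      rw [map_mul (starRingEnd ℂ), addchar_conj, show a * (b - c) = a * b + -(a * c) by ring, AddChar.map_add_eq_mul]
      ring
    rw [Finset.sum_congr rfl (fun a _ => h1 a), Finset.sum_comm, Finset.mul_sum]
    apply Finset.sum_congr rfl
    intro b _
    rw [Finset.sum_comm]
    have h2 : ∀ c, ∑ a, v b * (starRingEnd ℂ) (v c) * ψ (a * (b - c)) = if b = c then (Fintype.card R : ℂ) * ((‖v b‖ ^ 2 : ℝ) : ℂ) else 0 := by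
      intro c
      rw [← Finset.mul_sum, AddChar.sum_mulShift _ hψ]
      by_cases h : b = c
      · subst h
        simp only [sub_self, if_true]
        rw [Complex.mul_conj']
        push_cast; ring
      · rw [if_neg h, if_neg (sub_ne_zero.mpr h)]; simp
    rw [Finset.sum_congr rfl (fun c _ => h2 c)]
    simp
  exact_mod_cast e

lemma bilin {R : Type} [CommRing R] [Fintype R] (ψ : AddChar R ℂ) (hψ : ψ.IsPrimitive) (u v : R → ℂ) :
    ‖∑ a, u a * ∑ b, v b * ψ (a * b)‖ ^ 2 ≤ (Fintype.card R : ℝ) * (∑ a, ‖u a‖ ^ 2) * ∑ b, ‖v b‖ ^ 2 := by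
  have h1 : ‖∑ a, u a * ∑ b, v b * ψ (a * b)‖ ≤ ∑ a, ‖u a‖ * ‖∑ b, v b * ψ (a * b)‖ := by
    refine (norm_sum_le _ _).trans (le_of_eq ?_)
    simp
  calc _ ≤ (∑ a, ‖u a‖ * ‖∑ b, v b * ψ (a * b)‖) ^ 2 := pow_le_pow_left₀ (norm_nonneg _) h1 2
    _ ≤ (∑ a, ‖u a‖ ^ 2) * ∑ a, ‖∑ b, v b * ψ (a * b)‖ ^ 2 := Finset.sum_mul_sq_le_sq_mul_sq _ _ _
    _ = _ := by rw [parseval ψ hψ]; ring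

/-- additive energy (differences) -/
noncomputable def nu {R ι : Type} [CommRing R] [Fintype R] (S : Finset ι) (x : ι → R) (a : R) : ℕ :=
  ((S ×ˢ S).filter (fun p => x p.1 - x p.2 = a)).card

lemma sum_nu {R ι : Type} [CommRing R] [Fintype R] (S : Finset ι) (x : ι → R) (g : R → ℂ) :
    ∑ s ∈ S, ∑ t ∈ S, g (x s - x t) = ∑ a, (nu S x a : ℂ) * g a := by
  rw [← Finset.sum_product' S S (fun s t => g (x s - x t))]
  rw [← Finset.sum_fiberwise_of_maps_to (g := fun p => x p.1 - x p.2) (t := Finset.univ) (fun _ _ => Finset.mem_univ _)]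
  apply Finset.sum_congr rfl
  intro a _
  rw [Finset.sum_congr rfl (g := fun _ => g a)]
  · rw [Finset.sum_const, nsmul_eq_mul, nu]
  · intro p hp
    rw [(Finset.mem_filter.mp hp).2]

lemma sq_norm_sum {R ι : Type} [CommRing R] [Fintype R] (ψ : AddChar R ℂ) (T : Finset ι) (β : ι → ℂ) (y : ι → R) (x : R) :
    ((‖∑ t ∈ T, β t * ψ (x * y t)‖ ^ 2 : ℝ) : ℂ) = ∑ t ∈ T, ∑ t' ∈ T, β t * (starRingEnd ℂ) (β t') * ψ (x * (y t - y t')) := by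
  push_cast
  rw [← Complex.mul_conj', map_sum, Finset.sum_mul_sum]
  apply Finset.sum_congr rfl
  intro b _
  apply Finset.sum_congr rfl
  intro c _
  rw [map_mul (starRingEnd ℂ), addchar_conj, show x * (y b - y c) = x * y b + -(x * y c) by ring, AddChar.map_add_eq_mul]
  ring

lemma type_two {R ι κ : Type} [CommRing R] [Fintype R] (ψ : AddChar R ℂ) (hψ : ψ.IsPrimitive)
    (S : Finset ι) (T : Finset κ) (α : ι → ℂ) (β : κ → ℂ) (x : ι → R) (y : κ → R) (K L : ℝ) (hK : 0 ≤ K) (hL : 0 ≤ L)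
    (hα : ∀ s ∈ S, ‖α s‖ ≤ K) (hβ : ∀ t ∈ T, ‖β t‖ ≤ L) :
    ‖∑ s ∈ S, ∑ t ∈ T, α s * β t * ψ (x s * y t)‖ ^ 8 ≤
      (K * L) ^ 8 * (S.card : ℝ) ^ 4 * (T.card : ℝ) ^ 4 * (Fintype.card R : ℝ) *
        (∑ a, (nu S x a : ℝ) ^ 2) * (∑ a, (nu T y a : ℝ) ^ 2) := by
  set B := ∑ s ∈ S, ∑ t ∈ T, α s * β t * ψ (x s * y t) with hB
  set Q := ∑ t ∈ T, ∑ t' ∈ T, ‖∑ s ∈ S, ψ (x s * (y t - y t'))‖ with hQ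
  have hQ0 : 0 ≤ Q := by positivity
  -- first Cauchy
  have h1 : ‖B‖ ≤ K * ∑ s ∈ S, ‖∑ t ∈ T, β t * ψ (x s * y t)‖ := by
    rw [Finset.mul_sum, hB]
    refine (norm_sum_le _ _).trans (Finset.sum_le_sum ?_)
    intro s hs
    have : ∑ t ∈ T, α s * β t * ψ (x s * y t) = α s * ∑ t ∈ T, β t * ψ (x s * y t) := by
      rw [Finset.mul_sum]
      exact Finset.sum_congr rfl (fun t _ => by ring)
    rw [this, norm_mul]
    exact mul_le_mul_of_nonneg_right (hα s hs) (norm_nonneg _)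
  have h2 : ∑ s ∈ S, ‖∑ t ∈ T, β t * ψ (x s * y t)‖ ^ 2 ≤ L ^ 2 * Q := by
    have e : ((∑ s ∈ S, ‖∑ t ∈ T, β t * ψ (x s * y t)‖ ^ 2 : ℝ) : ℂ)
        = ∑ t ∈ T, ∑ t' ∈ T, β t * (starRingEnd ℂ) (β t') * ∑ s ∈ S, ψ (x s * (y t - y t')) := by
      rw [Complex.ofReal_sum, Finset.sum_congr rfl (fun s _ => sq_norm_sum ψ T β y (x s)), Finset.sum_comm]
      apply Finset.sum_congr rfl
      intro t _
      rw [Finset.sum_comm]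
      apply Finset.sum_congr rfl
      intro t' _
      rw [Finset.mul_sum]
    have e2 : (∑ s ∈ S, ‖∑ t ∈ T, β t * ψ (x s * y t)‖ ^ 2 : ℝ) = ‖((∑ s ∈ S, ‖∑ t ∈ T, β t * ψ (x s * y t)‖ ^ 2 : ℝ) : ℂ)‖ := by
      rw [Complex.norm_real, Real.norm_of_nonneg (by positivity)]
    rw [e2, e, hQ, Finset.mul_sum]
    refine (norm_sum_le _ _).trans (Finset.sum_le_sum ?_)
    intro t ht
    rw [Finset.mul_sum]
    refine (norm_sum_le _ _).trans (Finset.sum_le_sum ?_)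
    intro t' ht'
    rw [norm_mul, norm_mul, RCLike.norm_conj]
    apply mul_le_mul_of_nonneg_right _ (norm_nonneg _)
    rw [pow_two]
    exact mul_le_mul (hβ t ht) (hβ t' ht') (norm_nonneg _) hL
  have h3 : ‖B‖ ^ 2 ≤ (K * L) ^ 2 * S.card * Q := by
    calc ‖B‖ ^ 2 ≤ (K * ∑ s ∈ S, ‖∑ t ∈ T, β t * ψ (x s * y t)‖) ^ 2 := pow_le_pow_left₀ (norm_nonneg _) h1 2
      _ = K ^ 2 * (∑ s ∈ S, ‖∑ t ∈ T, β t * ψ (x s * y t)‖) ^ 2 := by ring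
      _ ≤ K ^ 2 * (S.card * ∑ s ∈ S, ‖∑ t ∈ T, β t * ψ (x s * y t)‖ ^ 2) :=
          mul_le_mul_of_nonneg_left sq_sum_le_card_mul_sum_sq (by positivity)
      _ ≤ K ^ 2 * (S.card * (L ^ 2 * Q)) := by gcongr
      _ = _ := by ring
  -- second Cauchy
  set P := ∑ t ∈ T, ∑ t' ∈ T, ‖∑ s ∈ S, ψ (x s * (y t - y t'))‖ ^ 2 with hP
  have h4 : Q ^ 2 ≤ (T.card : ℝ) ^ 2 * P := by
    have := sq_sum_le_card_mul_sum_sq (s := T ×ˢ T) (f := fun p => ‖∑ s ∈ S, ψ (x s * (y p.1 - y p.2))‖)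
    rw [Finset.sum_product, Finset.sum_product, Finset.card_product] at this
    rw [hQ, hP]
    refine this.trans (le_of_eq ?_)
    push_cast; ring
  have h5 : P ^ 2 ≤ (Fintype.card R : ℝ) * (∑ a, (nu S x a : ℝ) ^ 2) * (∑ a, (nu T y a : ℝ) ^ 2) := by
    have e : (P : ℂ) = ∑ a, (nu T y a : ℂ) * ∑ b, (nu S x b : ℂ) * ψ (a * b) := by
      rw [hP]
      push_cast
      have e1 : ∀ t t', ((‖∑ s ∈ S, ψ (x s * (y t - y t'))‖ : ℝ) : ℂ) ^ 2 = ∑ b, (nu S x b : ℂ) * ψ ((y t - y t') * b) := by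
        intro t t'
        rw [← sum_nu S x (fun b => ψ ((y t - y t') * b))]
        have := sq_norm_sum ψ S (fun _ => 1) x (y t - y t')
        push_cast at this
        simp only [one_mul, map_one] at this
        rw [← this]
        congr 3
        exact Finset.sum_congr rfl (fun s _ => by rw [mul_comm])
      simp only [e1]
      exact sum_nu T y (fun a => ∑ b, (nu S x b : ℂ) * ψ (a * b))
    have hb := bilin ψ hψ (fun a => (nu T y a : ℂ)) (fun b => (nu S x b : ℂ))
    rw [← e] at hb
    simp only [Complex.norm_real, Complex.norm_natCast] at hb
    rw [Real.norm_of_nonneg (by positivity)] at hb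
    refine hb.trans (le_of_eq ?_)
    ring
  have hB0 := norm_nonneg B
  calc ‖B‖ ^ 8 = (‖B‖ ^ 2) ^ 4 := by ring
    _ ≤ ((K * L) ^ 2 * S.card * Q) ^ 4 := pow_le_pow_left₀ (by positivity) h3 4
    _ = ((K * L) ^ 8 * S.card ^ 4) * (Q ^ 2) ^ 2 := by ring
    _ ≤ ((K * L) ^ 8 * S.card ^ 4) * ((T.card : ℝ) ^ 2 * P) ^ 2 := by gcongr
    _ = ((K * L) ^ 8 * S.card ^ 4) * (T.card : ℝ) ^ 4 * P ^ 2 := by ring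
    _ ≤ ((K * L) ^ 8 * S.card ^ 4) * (T.card : ℝ) ^ 4 * ((Fintype.card R : ℝ) * (∑ a, (nu S x a : ℝ) ^ 2) * (∑ a, (nu T y a : ℝ) ^ 2)) := by gcongr
    _ = _ := by ring

/-- number of representations as sums -/
noncomputable def rs {R ι : Type} [CommRing R] [Fintype R] (S : Finset ι) (x : ι → R) (c : R) : ℕ :=
  ((S ×ˢ S).filter (fun p => x p.1 + x p.2 = c)).card

lemma sum_sq_card {R ι : Type} [Fintype R] (P : Finset ι) (f : ι → R) :
    ∑ a, ((P.filter (fun p => f p = a)).card) ^ 2 = ((P ×ˢ P).filter (fun pp => f pp.1 = f pp.2)).card := by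
  rw [Finset.card_eq_sum_card_fiberwise (f := fun pp => f pp.1) (t := Finset.univ) (fun _ _ => Finset.mem_coe.mpr (Finset.mem_univ _))]
  apply Finset.sum_congr rfl
  intro a _
  rw [pow_two, ← Finset.card_product]
  congr 1
  ext ⟨p, p'⟩
  simp only [Finset.mem_product, Finset.mem_filter]
  constructor
  · rintro ⟨⟨h1, h2⟩, h3, h4⟩
    exact ⟨⟨⟨h1, h3⟩, by rw [h2, h4]⟩, h2⟩
  · rintro ⟨⟨⟨h1, h2⟩, h3⟩, h4⟩
    exact ⟨⟨h1, h4⟩, h2, by rw [← h3, h4]⟩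

lemma nu_eq_rs {R ι : Type} [CommRing R] [Fintype R] (S : Finset ι) (x : ι → R) :
    ∑ a, (nu S x a) ^ 2 = ∑ c, (rs S x c) ^ 2 := by
  unfold nu rs
  rw [sum_sq_card, sum_sq_card]
  refine Finset.card_bij' (fun pp _ => ((pp.1.1, pp.2.2), (pp.2.1, pp.1.2))) (fun pp _ => ((pp.1.1, pp.2.2), (pp.2.1, pp.1.2))) ?_ ?_ ?_ ?_
  · rintro ⟨⟨a, b⟩, ⟨c, d⟩⟩ h
    simp only [Finset.mem_product, Finset.mem_filter] at h ⊢
    obtain ⟨⟨⟨h1, h2⟩, h3, h4⟩, h5⟩ := h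
    exact ⟨⟨⟨h1, h4⟩, h3, h2⟩, by linear_combination h5⟩
  · rintro ⟨⟨a, b⟩, ⟨c, d⟩⟩ h
    simp only [Finset.mem_product, Finset.mem_filter] at h ⊢
    obtain ⟨⟨⟨h1, h2⟩, h3, h4⟩, h5⟩ := h
    exact ⟨⟨⟨h1, h4⟩, h3, h2⟩, by linear_combination h5⟩
  · intros; rfl
  · intros; rfl

lemma sum_rs {R ι : Type} [CommRing R] [Fintype R] (S : Finset ι) (x : ι → R) : ∑ c, rs S x c = S.card ^ 2 := by
  unfold rs
  rw [pow_two, ← Finset.card_product]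
  exact (Finset.card_eq_sum_card_fiberwise (f := fun pp : ι × ι => x pp.1 + x pp.2) (t := Finset.univ) (fun _ _ => Finset.mem_coe.mpr (Finset.mem_univ _))).symm

end Bilin
end FM

open scoped Classical
open Polynomial Filter
set_option linter.unusedSectionVars false
set_option linter.unusedVariables false
set_option linter.style.haveILetI false
namespace FM
section Energy
variable {F : Type} [Field F] [Fintype F]

lemma card_divisors_le {H : F[X]} (hH : H ≠ 0) (Z : Finset F[X]) (hZ : ∀ d ∈ Z, d ∣ H) :
    Z.card ≤ Fintype.card F * (dv H).card := by
  rw [← Finset.card_univ (α := F), ← Finset.card_product]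
  apply Finset.card_le_card_of_injOn (fun d => (d.leadingCoeff, C d.leadingCoeff⁻¹ * d))
  · intro d hd
    have h0 : d ≠ 0 := by rintro rfl; exact hH (zero_dvd_iff.mp (hZ 0 hd))
    have hl : d.leadingCoeff ≠ 0 := leadingCoeff_ne_zero.mpr h0
    simp only [Finset.coe_product, Set.mem_prod, Finset.mem_coe, Finset.mem_univ, true_and]
    rw [mem_dv hH]
    refine ⟨?_, ?_⟩
    · rw [mul_comm]; exact monic_mul_leadingCoeff_inv h0
    · have hu : IsUnit (C d.leadingCoeff⁻¹) := isUnit_C.mpr (inv_ne_zero hl).isUnit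
      exact (hu.mul_left_dvd).mpr (hZ d hd)
  · intro d hd e he h
    simp only [Prod.mk.injEq] at h
    have h0 : d ≠ 0 := by rintro rfl; exact hH (zero_dvd_iff.mp (hZ 0 hd))
    have hl : d.leadingCoeff ≠ 0 := leadingCoeff_ne_zero.mpr h0
    rw [← h.1] at h
    exact mul_left_cancel₀ (C_ne_zero.mpr (inv_ne_zero hl)) h.2

lemma pigeon {D : F[X]} (hD : D.Monic) (c : F[X] ⧸ Ideal.span {D}) {s : ℕ} (hs : s < D.natDegree) :
    ∃ v u : F[X], v ≠ 0 ∧ v.degree < (s + 1 : ℕ) ∧ u.degree < (D.natDegree - s : ℕ) ∧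
      Ideal.Quotient.mk (Ideal.span {D}) u = c * Ideal.Quotient.mk _ v := by
  obtain ⟨c0, rfl⟩ := Ideal.Quotient.mk_surjective c
  set m := D.natDegree with hm
  set φ : F[X] → (Fin s → F) := fun v i => ((c0 * v) %ₘ D).coeff (m - s + i) with hφ
  obtain ⟨v1, h1, v2, h2, hne, heq⟩ := Finset.exists_ne_map_eq_of_card_lt_of_maps_to
    (s := lt F (s + 1)) (t := (Finset.univ : Finset (Fin s → F))) (f := φ)
    (by rw [card_lt, Finset.card_univ, Fintype.card_fun, Fintype.card_fin]; exact Nat.pow_lt_pow_right one_lt_q (by omega))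
    (fun _ _ => by simp)
  rw [mem_lt] at h1 h2
  refine ⟨v1 - v2, (c0 * (v1 - v2)) %ₘ D, sub_ne_zero.mpr hne, ?_, ?_, ?_⟩
  · exact lt_of_le_of_lt (degree_sub_le _ _) (max_lt h1 h2)
  · rw [degree_lt_iff_coeff_zero]
    intro i hi
    by_cases him : i < m
    · have := congrFun heq ⟨i - (m - s), by omega⟩
      simp only [hφ] at this
      rw [show m - s + (i - (m - s)) = i by omega] at this
      rw [mul_sub, sub_modByMonic, coeff_sub, this, sub_self]
    · apply coeff_eq_zero_of_degree_lt
      refine lt_of_lt_of_le (degree_modByMonic_lt _ hD) ?_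
      rw [degree_eq_natDegree hD.ne_zero, ← hm]
      exact_mod_cast (by omega : m ≤ i)
  · rw [← map_mul, mk_eq_iff, ← dvd_neg, neg_sub]
    have := modByMonic_add_div (c0 * (v1 - v2)) D
    exact ⟨(c0 * (v1 - v2)) /ₘ D, by linear_combination -this⟩

lemma mk_inj_mon {D : F[X]} (hD : D.Monic) {k : ℕ} (hk : k < D.natDegree) {f g : F[X]} (hf : f ∈ mon F k) (hg : g ∈ mon F k)
    (h : Ideal.Quotient.mk (Ideal.span {D}) f = Ideal.Quotient.mk (Ideal.span {D}) g) : f = g := by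
  apply mk_inj_lt hD _ _ h <;> rw [mem_lt]
  · rw [degree_eq_natDegree (mem_mon.mp hf).1.ne_zero, (mem_mon.mp hf).2]; exact_mod_cast hk
  · rw [degree_eq_natDegree (mem_mon.mp hg).1.ne_zero, (mem_mon.mp hg).2]; exact_mod_cast hk

lemma inv_inj {R : Type} [CommRing R] {a b : R} (ha : IsUnit a) (hb : IsUnit b) (h : Ring.inverse a = Ring.inverse b) : a = b := by
  obtain ⟨u, rfl⟩ := ha
  obtain ⟨v, rfl⟩ := hb
  rw [Ring.inverse_unit, Ring.inverse_unit] at h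
  have := inv_injective (Units.ext h)
  rw [this]

/-- inverse residue -/
noncomputable def xi (D : F[X]) (f : F[X]) : F[X] ⧸ Ideal.span {D} := Ring.inverse (Ideal.Quotient.mk _ f)

lemma xi_inj {D : F[X]} (hD : D.Monic) {k : ℕ} (hk : k < D.natDegree) {f g : F[X]} (hf : f ∈ mon F k) (hg : g ∈ mon F k)
    (hfc : IsCoprime f D) (hgc : IsCoprime g D) (h : xi D f = xi D g) : f = g :=
  mk_inj_mon hD hk hf hg (inv_inj (isUnit_mk_iff.mpr hfc) (isUnit_mk_iff.mpr hgc) h)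

lemma mul_xi {D f : F[X]} (h : IsCoprime f D) : Ideal.Quotient.mk (Ideal.span {D}) f * xi D f = 1 :=
  Ring.mul_inverse_cancel _ (isUnit_mk_iff.mpr h)

lemma rs_good {D : F[X]} (hD : D.Monic) (hsq : Squarefree D) [Fintype (F[X] ⧸ Ideal.span {D})] {k : ℕ} (hk : k < D.natDegree)
    (S : Finset F[X]) (hS : S ⊆ mon F k) (hSc : ∀ f ∈ S, IsCoprime f D) (c : F[X] ⧸ Ideal.span {D})
    (v u : F[X]) (hv0 : v ≠ 0) (hv : v.degree < ((k + D.natDegree) / 2 + 1 : ℕ)) (hu : u.degree < (D.natDegree - (k + D.natDegree) / 2 : ℕ))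
    (hu0 : u ≠ 0) (huv : Ideal.Quotient.mk (Ideal.span {D}) u = c * Ideal.Quotient.mk _ v) (B : ℕ)
    (hB : ∀ H : F[X], H ≠ 0 → H.natDegree ≤ 4 * D.natDegree → (dv H).card ≤ B) :
    rs S (xi D) c ≤ Fintype.card F ^ ((3 * k + 2 - D.natDegree) / 2) * (Fintype.card F * B) := by
  set m := D.natDegree with hm
  set t := (3 * k + 2 - m) / 2 with ht
  set s := (k + m) / 2 with hs
  have hvn : v.natDegree ≤ s := by
    rw [degree_eq_natDegree hv0] at hv
    have : v.natDegree < s + 1 := by exact_mod_cast hv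
    omega
  have hun : u.natDegree < m - s := by
    rw [degree_eq_natDegree hu0] at hu
    exact_mod_cast hu
  unfold rs
  set P := (S ×ˢ S).filter (fun p => xi D p.1 + xi D p.2 = c) with hP
  -- main divisibility
  have hdiv : ∀ p ∈ P, ∃ w ∈ lt F t, u * p.1 * p.2 - v * (p.1 + p.2) = D * w := by
    rintro ⟨a, b⟩ hp
    simp only [hP, Finset.mem_filter, Finset.mem_product] at hp
    obtain ⟨⟨ha, hb⟩, hab⟩ := hp
    have ham := mem_mon.mp (hS ha)
    have hbm := mem_mon.mp (hS hb)
    have hd : D ∣ u * a * b - v * (a + b) := by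
      rw [← mk_eq_zero_iff]
      simp only [map_sub, map_mul, map_add]
      rw [huv, ← hab]
      have e1 := mul_xi (hSc a ha)
      have e2 := mul_xi (hSc b hb)
      linear_combination (Ideal.Quotient.mk (Ideal.span {D}) v) * (Ideal.Quotient.mk (Ideal.span {D}) b) * e1 + (Ideal.Quotient.mk (Ideal.span {D}) v) * (Ideal.Quotient.mk (Ideal.span {D}) a) * e2
    obtain ⟨w, hw⟩ := hd
    refine ⟨w, ?_, hw⟩
    rw [mem_lt]
    by_cases hw0 : w = 0
    · rw [hw0, degree_zero]; exact WithBot.bot_lt_coe _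
    · rw [degree_eq_natDegree hw0]
      have h1 : (D * w).natDegree = m + w.natDegree := natDegree_mul hD.ne_zero hw0
      have h2 : (u * a * b - v * (a + b)).natDegree ≤ max (u.natDegree + k + k) (v.natDegree + k) := by
        refine (natDegree_sub_le _ _).trans (max_le_max ?_ ?_)
        · refine natDegree_mul_le.trans ?_
          have := natDegree_mul_le (p := u) (q := a)
          omega
        · refine natDegree_mul_le.trans ?_
          have := natDegree_add_le a b
          rw [ham.2, hbm.2, max_self] at this
          omega
      rw [hw, h1] at h2
      have : w.natDegree < t := by
        rcases le_max_iff.mp h2 with h | h <;> omega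
      exact_mod_cast this
  choose! W hW1 hW2 using hdiv
  rw [Finset.card_eq_sum_card_fiberwise (f := W) (t := lt F t) (fun p hp => hW1 p hp)]
  rw [← card_lt, ← smul_eq_mul, ← Finset.sum_const]
  apply Finset.sum_le_sum
  intro w hw
  set H := v ^ 2 + u * (D * w) with hH
  have hH0 : H ≠ 0 := by
    intro h0
    have : D ∣ v ^ 2 := ⟨-(u * w), by linear_combination h0 - hH⟩
    have hd : D ∣ v := (hsq.dvd_pow_iff_dvd (by norm_num)).mp this
    have := natDegree_le_of_dvd hd hv0
    omega
  by_cases hne : (P.filter (fun p => W p = w)).Nonempty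
  swap
  · rw [Finset.not_nonempty_iff_eq_empty.mp hne]; simp
  have hfac : ∀ p ∈ P.filter (fun p => W p = w), (u * p.1 - v) * (u * p.2 - v) = H := by
    intro p hp
    rw [Finset.mem_filter] at hp
    have := hW2 p hp.1
    rw [hp.2] at this
    rw [hH]
    linear_combination u * this
  have hHd : H.natDegree ≤ 4 * m := by
    obtain ⟨p, hp⟩ := hne
    have e := hfac p hp
    rw [Finset.mem_filter, hP, Finset.mem_filter, Finset.mem_product] at hp
    have h1 := (mem_mon.mp (hS hp.1.1.1)).2
    have h2 := (mem_mon.mp (hS hp.1.1.2)).2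
    rw [← e]
    refine natDegree_mul_le.trans ?_
    have e1 := natDegree_sub_le (u * p.1) v
    have e2 := natDegree_sub_le (u * p.2) v
    have e3 := natDegree_mul_le (p := u) (q := p.1)
    have e4 := natDegree_mul_le (p := u) (q := p.2)
    rcases le_max_iff.mp e1 with h | h <;> rcases le_max_iff.mp e2 with h' | h' <;> omega
  have hcard : (P.filter (fun p => W p = w)).card = ((P.filter (fun p => W p = w)).image (fun p => u * p.1 - v)).card := by
    symm
    apply Finset.card_image_of_injOn
    rintro ⟨a, b⟩ hp ⟨a', b'⟩ hp' h
    simp only [hP, Finset.coe_filter, Set.mem_ofPred_eq, Finset.mem_filter, Finset.mem_product] at hp hp'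
    simp only at h
    have haa : a = a' := mul_left_cancel₀ hu0 (by linear_combination h)
    subst haa
    obtain ⟨⟨⟨h1, h2⟩, h3⟩, h4⟩ := hp
    obtain ⟨⟨⟨h1', h2'⟩, h3'⟩, h4'⟩ := hp'
    have : b = b' := xi_inj hD hk (hS h2) (hS h2') (hSc _ h2) (hSc _ h2') (by linear_combination h3 - h3')
    rw [this]
  rw [hcard]
  refine (card_divisors_le hH0 _ ?_).trans (Nat.mul_le_mul_left _ (hB H hH0 hHd))
  intro d hd
  obtain ⟨p, hp, rfl⟩ := Finset.mem_image.mp hd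
  exact ⟨_, (hfac p hp).symm⟩

lemma rs_triv {D : F[X]} (hD : D.Monic) [Fintype (F[X] ⧸ Ideal.span {D})] {k : ℕ} (hk : k < D.natDegree)
    (S : Finset F[X]) (hS : S ⊆ mon F k) (hSc : ∀ f ∈ S, IsCoprime f D) (c : F[X] ⧸ Ideal.span {D}) :
    rs S (xi D) c ≤ Fintype.card F ^ k := by
  rw [← card_mon]
  refine le_trans ?_ (Finset.card_le_card hS)
  apply Finset.card_le_card_of_injOn (fun p => p.1)
  · intro p hp
    simp only [Finset.coe_filter, Set.mem_ofPred_eq, Finset.mem_product] at hp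
    exact hp.1.1
  · rintro ⟨a, b⟩ hp ⟨a', b'⟩ hp' h
    simp only [Finset.coe_filter, Set.mem_ofPred_eq, Finset.mem_product] at hp hp'
    simp only at h
    subst h
    have : b = b' := xi_inj hD hk (hS hp.1.2) (hS hp'.1.2) (hSc _ hp.1.2) (hSc _ hp'.1.2) (by linear_combination hp.2 - hp'.2)
    rw [this]

lemma count_cong {k : ℕ} {g n : F[X]} (hg : g.Monic) (hgk : g.natDegree ≤ k) :
    ((mon F k).filter (fun b => g ∣ n + b)).card ≤ Fintype.card F ^ (k - g.natDegree) := by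
  rw [← card_mon]
  apply Finset.card_le_card_of_injOn (fun b => b /ₘ g)
  · intro b hb
    simp only [Finset.coe_filter, Set.mem_ofPred_eq] at hb
    have hbm := mem_mon.mp hb.1
    rw [Finset.mem_coe, mem_mon]
    refine ⟨?_, ?_⟩
    · rw [Monic, leadingCoeff_divByMonic_of_monic hg]
      · exact hbm.1
      · rw [degree_eq_natDegree hg.ne_zero, degree_eq_natDegree hbm.1.ne_zero, hbm.2]; exact_mod_cast hgk
    · rw [natDegree_divByMonic _ hg, hbm.2]
  · intro b hb b' hb' h
    simp only [Finset.coe_filter, Set.mem_ofPred_eq] at hb hb'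
    simp only at h
    have hd : g ∣ b - b' := by
      have := dvd_sub hb.2 hb'.2
      rwa [show n + b - (n + b') = b - b' by ring] at this
    have h1 := modByMonic_add_div b g
    have h2 := modByMonic_add_div b' g
    have h3 : b %ₘ g = b' %ₘ g := by
      rw [← sub_eq_zero, ← sub_modByMonic]
      exact (modByMonic_eq_zero_iff_dvd hg).mpr hd
    rw [← h1, ← h2, h, h3]

lemma sum_rs_bad {D : F[X]} (hD : D.Monic) [Fintype (F[X] ⧸ Ideal.span {D})] (h2F : (2 : F) ≠ 0) {k s : ℕ}
    (S : Finset F[X]) (hS : S ⊆ mon F k) (hSc : ∀ f ∈ S, IsCoprime f D)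
    (bad : Finset (F[X] ⧸ Ideal.span {D}))
    (hbad : ∀ c ∈ bad, ∃ v : F[X], v ≠ 0 ∧ v.natDegree ≤ s ∧ c * Ideal.Quotient.mk _ v = 0) :
    (∑ c ∈ bad, rs S (xi D) c) * Fintype.card F ^ (D.natDegree - s) ≤ (dv D).card * (Fintype.card F ^ k * Fintype.card F ^ k) := by
  set m := D.natDegree with hm
  set P := (S ×ˢ S).filter (fun p => xi D p.1 + xi D p.2 ∈ bad) with hP
  have e1 : ∑ c ∈ bad, rs S (xi D) c = P.card := by
    rw [Finset.card_eq_sum_card_fiberwise (s := P) (f := fun p : F[X] × F[X] => xi D p.1 + xi D p.2) (t := bad) (fun p hp => (Finset.mem_filter.mp hp).2)]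
    apply Finset.sum_congr rfl
    intro c hc
    unfold rs
    congr 1
    ext p
    simp only [hP, Finset.mem_filter]
    constructor
    · rintro ⟨h1, h2⟩; exact ⟨⟨h1, by rw [h2]; exact hc⟩, h2⟩
    · rintro ⟨⟨h1, h2⟩, h3⟩; exact ⟨h1, h3⟩
  have hsub : ∀ p ∈ P, ∃ g ∈ dv D, m - s ≤ g.natDegree ∧ g.natDegree ≤ k ∧ g ∣ p.1 + p.2 := by
    rintro ⟨a, b⟩ hp
    rw [hP, Finset.mem_filter, Finset.mem_product] at hp
    obtain ⟨⟨ha, hb⟩, hc⟩ := hp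
    simp only at ha hb hc ⊢
    have ham := mem_mon.mp (hS ha)
    have hbm := mem_mon.mp (hS hb)
    obtain ⟨v, hv0, hvs, hv⟩ := hbad _ hc
    have hd : D ∣ (a + b) * v := by
      rw [← mk_eq_zero_iff]
      simp only [map_mul, map_add]
      have e1 := mul_xi (hSc a ha)
      have e2 := mul_xi (hSc b hb)
      linear_combination (Ideal.Quotient.mk (Ideal.span {D}) a) * (Ideal.Quotient.mk (Ideal.span {D}) b) * hv - (Ideal.Quotient.mk (Ideal.span {D}) v) * (Ideal.Quotient.mk (Ideal.span {D}) b) * e1 - (Ideal.Quotient.mk (Ideal.span {D}) v) * (Ideal.Quotient.mk (Ideal.span {D}) a) * e2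
    have hcoef : (a + b).coeff k = 2 := by
      have h1 : a.coeff k = 1 := by rw [← ham.2]; exact ham.1
      have h2 : b.coeff k = 1 := by rw [← hbm.2]; exact hbm.1
      rw [coeff_add, h1, h2]; norm_num
    have hab0 : a + b ≠ 0 := by
      intro h; rw [h, coeff_zero] at hcoef; exact h2F hcoef.symm
    have habd : (a + b).natDegree ≤ k := by
      have := natDegree_add_le a b
      rwa [ham.2, hbm.2, max_self] at this
    set g' := EuclideanDomain.gcd (a + b) D with hg'
    have hg'1 : g' ∣ a + b := EuclideanDomain.gcd_dvd_left _ _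
    have hg'2 : g' ∣ D := EuclideanDomain.gcd_dvd_right _ _
    have hg'0 : g' ≠ 0 := by intro h; rw [h] at hg'2; exact hD.ne_zero (zero_dvd_iff.mp hg'2)
    have hDg : D ∣ g' * v := by
      have hbez := EuclideanDomain.gcd_eq_gcd_ab (a + b) D
      rw [← hg'] at hbez
      rw [hbez, add_mul]
      apply dvd_add
      · have := hd.mul_right (EuclideanDomain.gcdA (a + b) D)
        convert this using 1; ring
      · exact ⟨EuclideanDomain.gcdB (a + b) D * v, by ring⟩
    have hdeg := natDegree_le_of_dvd hDg (mul_ne_zero hg'0 hv0)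
    rw [natDegree_mul hg'0 hv0] at hdeg
    have hass : Associated g' (normalize g') := (normalize_associated g').symm
    refine ⟨normalize g', ?_, ?_, ?_, ?_⟩
    · rw [mem_dv hD.ne_zero]
      exact ⟨Polynomial.monic_normalize hg'0, hass.dvd_iff_dvd_left.mp hg'2⟩
    · rw [natDegree_eq_of_degree_eq degree_normalize]; omega
    · rw [natDegree_eq_of_degree_eq degree_normalize]
      exact (natDegree_le_of_dvd hg'1 hab0).trans habd
    · exact hass.dvd_iff_dvd_left.mp hg'1
  have hPsub : P ⊆ ((dv D).filter (fun g => m - s ≤ g.natDegree ∧ g.natDegree ≤ k)).biUnion (fun g => (mon F k ×ˢ mon F k).filter (fun p => g ∣ p.1 + p.2)) := by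
    intro p hp
    obtain ⟨g, h1, h2, h3, h4⟩ := hsub p hp
    rw [Finset.mem_biUnion]
    refine ⟨g, Finset.mem_filter.mpr ⟨h1, h2, h3⟩, ?_⟩
    rw [hP, Finset.mem_filter, Finset.mem_product] at hp
    exact Finset.mem_filter.mpr ⟨Finset.mem_product.mpr ⟨hS hp.1.1, hS hp.1.2⟩, h4⟩
  rw [e1]
  have h1 := (Finset.card_le_card hPsub).trans Finset.card_biUnion_le
  refine (Nat.mul_le_mul_right _ h1).trans ?_
  rw [Finset.sum_mul]
  refine le_trans (Finset.sum_le_card_nsmul _ _ (Fintype.card F ^ k * Fintype.card F ^ k) ?_) ?_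
  · intro g hg
    rw [Finset.mem_filter] at hg
    obtain ⟨hg1, hg2, hg3⟩ := hg
    have hgm := ((mem_dv hD.ne_zero).mp hg1).1
    have h3 : ((mon F k ×ˢ mon F k).filter (fun p => g ∣ p.1 + p.2)).card ≤ Fintype.card F ^ k * Fintype.card F ^ (k - g.natDegree) := by
      rw [Finset.card_filter, Finset.sum_product]
      have : ∀ a ∈ mon F k, (∑ b ∈ mon F k, if g ∣ a + b then 1 else 0) ≤ Fintype.card F ^ (k - g.natDegree) := by
        intro a _
        rw [← Finset.card_filter]
        exact count_cong hgm hg3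
      refine (Finset.sum_le_card_nsmul _ _ _ this).trans ?_
      rw [card_mon, smul_eq_mul]
    refine (Nat.mul_le_mul_right _ h3).trans ?_
    rw [mul_assoc, ← pow_add]
    apply Nat.mul_le_mul_left
    exact Nat.pow_le_pow_right (one_lt_q (F := F)).le (by omega)
  · rw [smul_eq_mul]
    exact Nat.mul_le_mul_right _ (Finset.card_le_card (Finset.filter_subset _ _))

theorem energy_bound (F : Type) [Field F] [Fintype F] (h2F : (2 : F) ≠ 0) (ε : ℝ) (hε : 0 < ε) : ∃ C : ℝ, 0 < C ∧ ∀ D : F[X], D.Monic → Squarefree D →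
    ∀ [Fintype (F[X] ⧸ Ideal.span {D})], ∀ k : ℕ, k < D.natDegree → ∀ S : Finset F[X], S ⊆ mon F k → (∀ f ∈ S, IsCoprime f D) →
    (∑ a, (nu S (xi D) a : ℝ) ^ 2) ≤ C * (Fintype.card F : ℝ) ^ (ε * D.natDegree) *
      ((Fintype.card F : ℝ) ^ ((2 : ℝ) * k) + (Fintype.card F : ℝ) ^ ((7 / 2 : ℝ) * k - D.natDegree / 2)) := by
  obtain ⟨C, hC1, hC⟩ := dv_bound F (ε / 4) (by linarith)
  set q : ℝ := (Fintype.card F : ℝ) with hqdef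
  have hq1 : 1 < q := by rw [hqdef]; exact_mod_cast one_lt_q
  have hq0 : 0 < q := by linarith
  refine ⟨C * (q ^ 2 + 1), by positivity, ?_⟩
  intro D hD hsq _ k hk S hS hSc
  set m := D.natDegree with hm
  set s := (k + m) / 2 with hs
  set t := (3 * k + 2 - m) / 2 with ht
  set Bd : ℝ := C * q ^ (ε * m) with hBd
  have hBd0 : 0 < Bd := by positivity
  have hdvD : ((dv D).card : ℝ) ≤ Bd := by
    refine (hC D hD.ne_zero).trans ?_
    apply mul_le_mul_of_nonneg_left _ (by linarith)
    apply Real.rpow_le_rpow_of_exponent_le hq1.le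
    have : (0:ℝ) ≤ ε * m := by positivity
    rw [← hm]; linarith
  have hBH : ∀ H : F[X], H ≠ 0 → H.natDegree ≤ 4 * m → (dv H).card ≤ ⌊Bd⌋₊ := by
    intro H hH0 hH
    apply Nat.le_floor
    refine (hC H hH0).trans ?_
    apply mul_le_mul_of_nonneg_left _ (by linarith)
    apply Real.rpow_le_rpow_of_exponent_le hq1.le
    have : (H.natDegree : ℝ) ≤ 4 * m := by exact_mod_cast hH
    nlinarith
  set bad : Finset (F[X] ⧸ Ideal.span {D}) := Finset.univ.filter (fun c => ∃ v : F[X], v ≠ 0 ∧ v.natDegree ≤ s ∧ c * Ideal.Quotient.mk _ v = 0) with hbad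
  have hbs := sum_rs_bad hD h2F S hS hSc bad (s := s) (fun c hc => (Finset.mem_filter.mp hc).2)
  have hgood : ∀ c, c ∉ bad → rs S (xi D) c ≤ Fintype.card F ^ t * (Fintype.card F * ⌊Bd⌋₊) := by
    intro c hc
    obtain ⟨v, u, hv0, hv, hu, huv⟩ := pigeon hD c (s := s) (by omega)
    refine rs_good hD hsq hk S hS hSc c v u hv0 hv hu ?_ huv _ hBH
    intro hu0
    apply hc
    rw [hbad, Finset.mem_filter]
    refine ⟨Finset.mem_univ _, v, hv0, ?_, ?_⟩
    · rw [degree_eq_natDegree hv0] at hv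
      have : v.natDegree < s + 1 := by exact_mod_cast hv
      omega
    · rw [← huv, hu0, map_zero]
  have hnat : (∑ a, (nu S (xi D) a : ℝ) ^ 2) = ∑ c, (rs S (xi D) c : ℝ) ^ 2 := by
    exact_mod_cast nu_eq_rs S (xi D)
  have hScard : (S.card : ℝ) ≤ q ^ k := by
    have := Finset.card_le_card hS
    rw [card_mon] at this
    rw [hqdef]; exact_mod_cast this
  have hsum : ∑ c, (rs S (xi D) c : ℝ) ≤ q ^ k * q ^ k := by
    have : ∑ c, (rs S (xi D) c : ℝ) = (S.card : ℝ) ^ 2 := by exact_mod_cast sum_rs S (xi D)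
    rw [this, pow_two]
    exact mul_le_mul hScard hScard (by positivity) (by positivity)
  have hterm : ∀ c, (rs S (xi D) c : ℝ) ^ 2 ≤ (q ^ t * (q * Bd)) * rs S (xi D) c + if c ∈ bad then q ^ k * (rs S (xi D) c : ℝ) else 0 := by
    intro c
    have h0 : (0:ℝ) ≤ rs S (xi D) c := by positivity
    split_ifs with h
    · have h1 : (rs S (xi D) c : ℝ) ≤ q ^ k := by
        have := rs_triv hD hk S hS hSc c
        rw [hqdef]; exact_mod_cast this
      have h2 := mul_le_mul_of_nonneg_right h1 h0
      have h3 : 0 ≤ (q ^ t * (q * Bd)) * (rs S (xi D) c : ℝ) := by positivity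
      rw [pow_two]; linarith
    · have h1 : (rs S (xi D) c : ℝ) ≤ q ^ t * (q * ⌊Bd⌋₊) := by
        have := hgood c h
        rw [hqdef]; exact_mod_cast this
      have h2 : (⌊Bd⌋₊ : ℝ) ≤ Bd := Nat.floor_le hBd0.le
      have h3 : q ^ t * (q * ⌊Bd⌋₊) ≤ q ^ t * (q * Bd) := by gcongr
      have h4 := mul_le_mul_of_nonneg_right (h1.trans h3) h0
      rw [pow_two]; linarith
  have hbs' : (∑ c ∈ bad, (rs S (xi D) c : ℝ)) * q ^ (m - s) ≤ Bd * (q ^ k * q ^ k) := by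
    have h1 : (∑ c ∈ bad, (rs S (xi D) c : ℝ)) * q ^ (m - s) ≤ (dv D).card * (q ^ k * q ^ k) := by
      rw [hqdef]; exact_mod_cast hbs
    exact h1.trans (mul_le_mul_of_nonneg_right hdvD (by positivity))
  rw [hnat]
  refine (Finset.sum_le_sum (fun c _ => hterm c)).trans ?_
  rw [Finset.sum_add_distrib, ← Finset.mul_sum, ← Finset.sum_filter]
  have hfb : Finset.univ.filter (fun c => c ∈ bad) = bad := by ext; simp
  rw [hfb, ← Finset.mul_sum]
  have hqk : (q ^ k * q ^ k : ℝ) = q ^ ((2:ℝ) * k) := by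
    rw [← Real.rpow_natCast, ← Real.rpow_add hq0]; congr 1; ring
  -- power t
  have hqt : q ^ t ≤ q * (1 + q ^ ((3 * k - m : ℝ) / 2)) := by
    by_cases h : 3 * k + 2 < m
    · have : t = 0 := by omega
      rw [this, pow_zero]
      have h2 : 0 < q ^ ((3 * k - m : ℝ) / 2) := by positivity
      nlinarith
    · have h1 : (t : ℝ) ≤ 1 + (3 * k - m : ℝ) / 2 := by
        have h2 : 2 * t + m ≤ 3 * k + 2 := by omega
        have h3 : (2 * t + m : ℝ) ≤ 3 * k + 2 := by exact_mod_cast h2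
        linarith
      calc q ^ t = q ^ (t : ℝ) := (Real.rpow_natCast _ _).symm
        _ ≤ q ^ (1 + (3 * k - m : ℝ) / 2) := Real.rpow_le_rpow_of_exponent_le hq1.le h1
        _ = q * q ^ ((3 * k - m : ℝ) / 2) := by rw [Real.rpow_add hq0, Real.rpow_one]
        _ ≤ _ := by nlinarith
  have hbad2 : q ^ k * ∑ c ∈ bad, (rs S (xi D) c : ℝ) ≤ Bd * q ^ ((7 / 2 : ℝ) * k - m / 2) := by
    have hms : (m - s : ℕ) = ((m : ℝ) - s) := by rw [Nat.cast_sub (by omega)]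
    have h1 : ∑ c ∈ bad, (rs S (xi D) c : ℝ) ≤ Bd * (q ^ k * q ^ k) * q ^ (-((m - s : ℕ) : ℝ)) := by
      rw [Real.rpow_neg hq0.le, ← div_eq_mul_inv, le_div_iff₀ (by positivity), Real.rpow_natCast]
      exact hbs'
    have h2 : -((m - s : ℕ) : ℝ) ≤ (k - m : ℝ) / 2 := by
      have h3 : 2 * s ≤ k + m := by omega
      have h4 : (2 * s : ℝ) ≤ k + m := by exact_mod_cast h3
      rw [hms]; linarith
    calc q ^ k * ∑ c ∈ bad, (rs S (xi D) c : ℝ) ≤ q ^ k * (Bd * (q ^ k * q ^ k) * q ^ ((k - m : ℝ) / 2)) := by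
          apply mul_le_mul_of_nonneg_left _ (by positivity)
          refine h1.trans ?_
          apply mul_le_mul_of_nonneg_left _ (by positivity)
          exact Real.rpow_le_rpow_of_exponent_le hq1.le h2
      _ = Bd * (q ^ k * q ^ ((2:ℝ) * k) * q ^ ((k - m : ℝ) / 2)) := by rw [hqk]; ring
      _ = _ := by
          rw [← Real.rpow_natCast, ← Real.rpow_add hq0, ← Real.rpow_add hq0]
          congr 2; ring
  have hmain : q ^ t * (q * Bd) * ∑ c, (rs S (xi D) c : ℝ) ≤ q ^ 2 * Bd * (q ^ ((2:ℝ) * k) + q ^ ((7 / 2 : ℝ) * k - m / 2)) := by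
    calc _ ≤ (q * (1 + q ^ ((3 * k - m : ℝ) / 2))) * (q * Bd) * (q ^ k * q ^ k) := by gcongr
      _ = q ^ 2 * Bd * (q ^ ((2:ℝ) * k) + q ^ ((3 * k - m : ℝ) / 2) * q ^ ((2:ℝ) * k)) := by rw [hqk]; ring
      _ = _ := by
          rw [← Real.rpow_add hq0]
          congr 3; ring_nf
  have hz : 0 < Bd * q ^ ((2:ℝ) * k) := by positivity
  calc _ ≤ q ^ 2 * Bd * (q ^ ((2:ℝ) * k) + q ^ ((7 / 2 : ℝ) * k - m / 2)) + Bd * q ^ ((7 / 2 : ℝ) * k - m / 2) := add_le_add hmain hbad2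
    _ ≤ q ^ 2 * Bd * (q ^ ((2:ℝ) * k) + q ^ ((7 / 2 : ℝ) * k - m / 2)) + Bd * (q ^ ((2:ℝ) * k) + q ^ ((7 / 2 : ℝ) * k - m / 2)) := by linarith
    _ = _ := by rw [hBd]; ring

end Energy
end FM

open scoped Classical
open Polynomial Filter
set_option linter.unusedSectionVars false
set_option linter.unusedVariables false
set_option linter.style.haveILetI false
namespace FM
section Kl

noncomputable def klo {R : Type} [CommRing R] [Fintype R] (ψ : AddChar R ℂ) (a b : R) : ℂ :=
  ∑ u : Rˣ, ψ (a * u + b * (u⁻¹ : Rˣ))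

lemma klo_shift {R : Type} [CommRing R] [Fintype R] (ψ : AddChar R ℂ) (a b : R) (t : Rˣ) :
    klo ψ (a * t) (b * (t⁻¹ : Rˣ)) = klo ψ a b := by
  unfold klo
  refine Fintype.sum_equiv (Equiv.mulLeft t) _ _ ?_
  intro u
  simp only [Equiv.coe_mulLeft, mul_inv, Units.val_mul]
  congr 1; ring

/-- pairs sums -/
noncomputable def ff {R : Type} [CommRing R] (p : Rˣ × Rˣ) : R × R :=
  ((p.1 : R) + p.2, ((p.1⁻¹ : Rˣ) : R) + (p.2⁻¹ : Rˣ))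

noncomputable def n2 {R : Type} [CommRing R] [Fintype R] (c : R × R) : ℕ :=
  ((Finset.univ : Finset (Rˣ × Rˣ)).filter (fun p => ff p = c)).card

lemma klo_sq {R : Type} [CommRing R] [Fintype R] (ψ : AddChar R ℂ) (a b : R) :
    klo ψ a b ^ 2 = ∑ c, (∑ d, (n2 (c, d) : ℂ) * ψ (b * d)) * ψ (a * c) := by
  have h1 : klo ψ a b ^ 2 = ∑ p : Rˣ × Rˣ, ψ (a * (ff p).1 + b * (ff p).2) := by
    rw [pow_two]
    unfold klo
    rw [Finset.sum_mul_sum, Fintype.sum_prod_type]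
    apply Finset.sum_congr rfl
    intro u _
    apply Finset.sum_congr rfl
    intro v _
    rw [← AddChar.map_add_eq_mul]
    simp only [ff]
    congr 1; ring
  rw [h1, ← Finset.sum_fiberwise_of_maps_to (g := ff) (t := Finset.univ) (fun _ _ => Finset.mem_univ _), Fintype.sum_prod_type]
  apply Finset.sum_congr rfl
  intro c _
  rw [Finset.sum_mul]
  apply Finset.sum_congr rfl
  intro d _
  rw [Finset.sum_congr rfl (g := fun _ => ψ (b * d) * ψ (a * c))]
  · rw [Finset.sum_const, nsmul_eq_mul, n2]; ring
  · intro p hp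
    rw [(Finset.mem_filter.mp hp).2, AddChar.map_add_eq_mul, mul_comm]

lemma klo_moment {R : Type} [CommRing R] [Fintype R] (ψ : AddChar R ℂ) (hψ : ψ.IsPrimitive) :
    ∑ b, ∑ a, ‖klo ψ a b‖ ^ 4 = (Fintype.card R : ℝ) ^ 2 * ∑ c : R × R, (n2 c : ℝ) ^ 2 := by
  have h1 : ∀ b, ∑ a, ‖klo ψ a b‖ ^ 4 = (Fintype.card R : ℝ) * ∑ c, ‖∑ d, (n2 (c, d) : ℂ) * ψ (b * d)‖ ^ 2 := by
    intro b
    rw [← parseval ψ hψ]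
    apply Finset.sum_congr rfl
    intro a _
    rw [← klo_sq, norm_pow]; ring
  simp only [h1]
  rw [← Finset.mul_sum, Finset.sum_comm, pow_two, mul_assoc]
  congr 1
  rw [Fintype.sum_prod_type, Finset.mul_sum]
  apply Finset.sum_congr rfl
  intro c _
  rw [parseval ψ hψ (fun d => (n2 (c, d) : ℂ))]
  simp

lemma klo_bound1 {R : Type} [CommRing R] [Fintype R] (ψ : AddChar R ℂ) (hψ : ψ.IsPrimitive) (a b : R) (hb : IsUnit b) :
    (Fintype.card Rˣ : ℝ) * ‖klo ψ a b‖ ^ 4 ≤ (Fintype.card R : ℝ) ^ 2 * ∑ c : R × R, (n2 c : ℝ) ^ 2 := by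
  rw [← klo_moment ψ hψ]
  have h1 : (Fintype.card Rˣ : ℝ) * ‖klo ψ a b‖ ^ 4 = ∑ t : Rˣ, ‖klo ψ (a * t) (b * (t⁻¹ : Rˣ))‖ ^ 4 := by
    simp [klo_shift]
  rw [h1]
  have h2 : ∑ b, ∑ a, ‖klo ψ a b‖ ^ 4 = ∑ p : R × R, ‖klo ψ p.2 p.1‖ ^ 4 := by
    rw [Fintype.sum_prod_type]
  rw [h2]
  have hinj : Function.Injective (fun t : Rˣ => (b * ((t⁻¹ : Rˣ) : R), a * (t : R))) := by
    intro t t' h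
    simp only [Prod.mk.injEq] at h
    have := hb.mul_left_cancel h.1
    exact inv_injective (Units.ext this)
  rw [← Finset.sum_image (f := fun p : R × R => ‖klo ψ p.2 p.1‖ ^ 4) (s := Finset.univ) (g := fun t : Rˣ => (b * ((t⁻¹ : Rˣ) : R), a * (t : R))) (hinj.injOn)]
  apply Finset.sum_le_sum_of_subset_of_nonneg (Finset.subset_univ _)
  intros; positivity

lemma n2_count {R : Type} [CommRing R] [Fintype R] (h2 : IsUnit (2 : R)) :
    ∑ c : R × R, (n2 c) ^ 2 ≤ ((Finset.univ : Finset (R × R × R)).filter (fun p => p.1 * p.2.1 * p.2.2 = 0)).card := by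
  have hs := sum_sq_card (R := R × R) (Finset.univ : Finset (Rˣ × Rˣ)) ff
  have hs' : ∑ c : R × R, (n2 c) ^ 2 = (((Finset.univ : Finset (Rˣ × Rˣ)) ×ˢ (Finset.univ : Finset (Rˣ × Rˣ))).filter (fun pp => ff pp.1 = ff pp.2)).card := by
    unfold n2
    convert hs
  rw [hs']
  apply Finset.card_le_card_of_injOn (fun pp => ((pp.1.1 : R) + pp.1.2, (pp.2.1 : R) - pp.1.1, (pp.2.1 : R) - pp.1.2))
  · rintro ⟨⟨u1, u2⟩, ⟨u3, u4⟩⟩ h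
    simp only [Finset.coe_filter, Set.mem_ofPred_eq, Finset.mem_product, ff, Prod.mk.injEq] at h
    simp only [Finset.coe_filter, Set.mem_ofPred_eq, Finset.mem_univ, true_and]
    obtain ⟨_, h3, h4⟩ := h
    have i1 : (u1 : R) * (u1⁻¹ : Rˣ) = 1 := Units.mul_inv u1
    have i2 : (u2 : R) * (u2⁻¹ : Rˣ) = 1 := Units.mul_inv u2
    have i3 : (u3 : R) * (u3⁻¹ : Rˣ) = 1 := Units.mul_inv u3
    have i4 : (u4 : R) * (u4⁻¹ : Rˣ) = 1 := Units.mul_inv u4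
    set a := (u1 : R); set b := (u2 : R); set c := (u3 : R); set d := (u4 : R)
    set a' := ((u1⁻¹ : Rˣ) : R); set b' := ((u2⁻¹ : Rˣ) : R); set c' := ((u3⁻¹ : Rˣ) : R); set d' := ((u4⁻¹ : Rˣ) : R)
    have e1 : a * b * c * d * (a' + b') = c * d * (a + b) := by
      linear_combination b * c * d * i1 + a * c * d * i2
    have e2 : a * b * c * d * (c' + d') = a * b * (c + d) := by
      linear_combination a * b * d * i3 + a * b * c * i4
    have e3 : c * d * (a + b) = a * b * (c + d) := by rw [← e1, ← e2, h4]
    have hd : d = a + b - c := by linear_combination -h3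
    rw [hd] at e3
    linear_combination -e3
  · rintro ⟨⟨u1, u2⟩, ⟨u3, u4⟩⟩ h ⟨⟨v1, v2⟩, ⟨v3, v4⟩⟩ h' he
    simp only [Finset.coe_filter, Set.mem_ofPred_eq, Finset.mem_product, ff, Prod.mk.injEq] at h h' he
    obtain ⟨e1, e2, e3⟩ := he
    have k3 : (u3 : R) = v3 := h2.mul_left_cancel (by linear_combination e1 + e2 + e3)
    have k1 : (u1 : R) = v1 := by linear_combination k3 - e2
    have k2 : (u2 : R) = v2 := by linear_combination k3 - e3
    have k4 : (u4 : R) = v4 := by linear_combination -h.2.1 + h'.2.1 + k1 + k2 - k3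
    rw [Units.ext k1, Units.ext k2, Units.ext k3, Units.ext k4]

end Kl

section KlF
variable {F : Type} [Field F] [Fintype F]

lemma count_mult {n : ℕ} {g : F[X]} (hg : g.Monic) :
    ((lt F n).filter (fun f => g ∣ f)).card ≤ Fintype.card F ^ (n - g.natDegree) := by
  rw [← card_lt]
  apply Finset.card_le_card_of_injOn (fun b => b /ₘ g)
  · intro b hb
    simp only [Finset.coe_filter, Set.mem_ofPred_eq] at hb
    rw [Finset.mem_coe, mem_lt]
    obtain ⟨h1, h2⟩ := hb
    change (b /ₘ g).degree < _
    by_cases hq : b /ₘ g = 0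
    · rw [hq, degree_zero]; exact WithBot.bot_lt_coe _
    · have hb0 : b ≠ 0 := by rintro rfl; simp at hq
      rw [degree_eq_natDegree hq, natDegree_divByMonic _ hg]
      rw [mem_lt, degree_eq_natDegree hb0] at h1
      have h3 : b.natDegree < n := by exact_mod_cast h1
      have h4 := natDegree_le_of_dvd h2 hb0
      exact_mod_cast (by omega : b.natDegree - g.natDegree < n - g.natDegree)
  · intro b hb b' hb' h
    simp only [Finset.coe_filter, Set.mem_ofPred_eq] at hb hb'
    simp only at h
    have h1 := modByMonic_add_div b g
    have h2 := modByMonic_add_div b' g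
    rw [← h1, ← h2, h, (modByMonic_eq_zero_iff_dvd hg).mpr hb.2, (modByMonic_eq_zero_iff_dvd hg).mpr hb'.2]

/-- monic gcd -/
noncomputable def mg (a b : F[X]) : F[X] := normalize (EuclideanDomain.gcd a b)

lemma mg_dvd_left (a b : F[X]) : mg a b ∣ a :=
  (normalize_associated _).dvd_iff_dvd_left.mpr (EuclideanDomain.gcd_dvd_left _ _)
lemma mg_dvd_right (a b : F[X]) : mg a b ∣ b :=
  (normalize_associated _).dvd_iff_dvd_left.mpr (EuclideanDomain.gcd_dvd_right _ _)
lemma mg_monic (a : F[X]) {b : F[X]} (hb : b ≠ 0) : (mg a b).Monic := by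
  apply Polynomial.monic_normalize
  intro h
  exact hb (EuclideanDomain.gcd_eq_zero_iff.mp h).2
lemma mg_bezout (a b : F[X]) : ∃ x y, mg a b = x * a + y * b := by
  have h := EuclideanDomain.gcd_eq_gcd_ab a b
  obtain ⟨u, hu⟩ := (normalize_associated (EuclideanDomain.gcd a b)).symm
  refine ⟨EuclideanDomain.gcdA a b * u, EuclideanDomain.gcdB a b * u, ?_⟩
  rw [mg, ← hu]
  linear_combination (u : F[X]) * h
lemma dvd_mg {c a b : F[X]} (h1 : c ∣ a) (h2 : c ∣ b) : c ∣ mg a b := by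
  obtain ⟨x, y, h⟩ := mg_bezout a b
  rw [h]
  exact dvd_add (h1.mul_left _) (h2.mul_left _)
lemma dvd_mg_mul {D a b : F[X]} (h : D ∣ a * b) : D ∣ mg a D * b := by
  obtain ⟨x, y, e⟩ := mg_bezout a D
  rw [e, add_mul]
  apply dvd_add
  · rw [mul_assoc]; exact h.mul_left _
  · exact ⟨y * b, by ring⟩

lemma count_triples {D : F[X]} (hD : D.Monic) [Fintype (F[X] ⧸ Ideal.span {D})] :
    ((Finset.univ : Finset ((F[X] ⧸ Ideal.span {D}) × (F[X] ⧸ Ideal.span {D}) × (F[X] ⧸ Ideal.span {D}))).filter (fun p => p.1 * p.2.1 * p.2.2 = 0)).card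
      ≤ (dv D).card ^ 3 * Fintype.card F ^ (2 * D.natDegree) := by
  set m := D.natDegree with hm
  set A := fun g : F[X] => (lt F m).filter (fun f => g ∣ f) with hA
  set G := (dv D ×ˢ dv D ×ˢ dv D).filter (fun g => D ∣ g.1 * g.2.1 * g.2.2) with hG
  have hsub : ((Finset.univ : Finset ((F[X] ⧸ Ideal.span {D}) × (F[X] ⧸ Ideal.span {D}) × (F[X] ⧸ Ideal.span {D}))).filter (fun p => p.1 * p.2.1 * p.2.2 = 0))
      ⊆ G.biUnion (fun g => (A g.1 ×ˢ A g.2.1 ×ˢ A g.2.2).image (fun f => (Ideal.Quotient.mk _ f.1, Ideal.Quotient.mk _ f.2.1, Ideal.Quotient.mk _ f.2.2))) := by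
    rintro ⟨x, y, z⟩ hp
    simp only [Finset.mem_filter, Finset.mem_univ, true_and] at hp
    obtain ⟨a, ha, rfl⟩ := mk_surj_lt hD x
    obtain ⟨b, hb, rfl⟩ := mk_surj_lt hD y
    obtain ⟨c, hc, rfl⟩ := mk_surj_lt hD z
    rw [← map_mul, ← map_mul, mk_eq_zero_iff] at hp
    have e1 : D ∣ mg a D * (b * c) := dvd_mg_mul (by rwa [← mul_assoc])
    have e2 : D ∣ mg b D * (mg a D * c) := dvd_mg_mul (by convert e1 using 1; ring)
    have e3 : D ∣ mg c D * (mg b D * mg a D) := dvd_mg_mul (by convert e2 using 1; ring)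
    have hmem : ∀ f, mg f D ∈ dv D := fun f => (mem_dv hD.ne_zero).mpr ⟨mg_monic f hD.ne_zero, mg_dvd_right _ _⟩
    rw [Finset.mem_biUnion]
    refine ⟨(mg a D, mg b D, mg c D), ?_, ?_⟩
    · rw [hG, Finset.mem_filter, Finset.mem_product, Finset.mem_product]
      exact ⟨⟨hmem a, hmem b, hmem c⟩, by convert e3 using 1; ring⟩
    · rw [Finset.mem_image]
      refine ⟨(a, b, c), ?_, rfl⟩
      simp only [hA, Finset.mem_product, Finset.mem_filter]
      exact ⟨⟨ha, mg_dvd_left _ _⟩, ⟨hb, mg_dvd_left _ _⟩, hc, mg_dvd_left _ _⟩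
  refine (Finset.card_le_card hsub).trans (Finset.card_biUnion_le.trans ?_)
  have hG3 : G.card ≤ (dv D).card ^ 3 := by
    refine (Finset.card_le_card (Finset.filter_subset _ _)).trans (le_of_eq ?_)
    rw [Finset.card_product, Finset.card_product]; ring
  refine (Finset.sum_le_card_nsmul _ _ (Fintype.card F ^ (2 * m)) ?_).trans (by rw [smul_eq_mul]; exact Nat.mul_le_mul_right _ hG3)
  rintro ⟨g1, g2, g3⟩ hg
  rw [hG, Finset.mem_filter, Finset.mem_product, Finset.mem_product] at hg
  obtain ⟨⟨h1, h2, h3⟩, h4⟩ := hg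
  simp only at h1 h2 h3 h4
  rw [mem_dv hD.ne_zero] at h1 h2 h3
  refine Finset.card_image_le.trans ?_
  rw [Finset.card_product, Finset.card_product]
  refine (Nat.mul_le_mul (count_mult h1.1) (Nat.mul_le_mul (count_mult h2.1) (count_mult h3.1))).trans ?_
  rw [← pow_add, ← pow_add]
  apply Nat.pow_le_pow_right (one_lt_q (F := F)).le
  have d1 := natDegree_le_of_dvd h1.2 hD.ne_zero
  have d2 := natDegree_le_of_dvd h2.2 hD.ne_zero
  have d3 := natDegree_le_of_dvd h3.2 hD.ne_zero
  have d4 := natDegree_le_of_dvd h4 ((h1.1.mul h2.1).mul h3.1).ne_zero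
  rw [(h1.1.mul h2.1).natDegree_mul h3.1, h1.1.natDegree_mul h2.1] at d4
  omega

lemma card_units_ge {D : F[X]} (hD : D.Monic) (hsq : Squarefree D) [Fintype (F[X] ⧸ Ideal.span {D})] :
    Fintype.card (F[X] ⧸ Ideal.span {D}) ≤ (dv D).card * Fintype.card (F[X] ⧸ Ideal.span {D})ˣ := by
  rw [← Finset.card_univ (α := (F[X] ⧸ Ideal.span {D})ˣ), ← Finset.card_product, ← Finset.card_univ]
  refine Finset.card_le_card_of_surjOn (fun p => Ideal.Quotient.mk _ p.1 * (p.2 : F[X] ⧸ Ideal.span {D})) ?_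
  intro x _
  obtain ⟨f, rfl⟩ := Ideal.Quotient.mk_surjective x
  have hgm := mg_monic f hD.ne_zero
  obtain ⟨h, hh⟩ := mg_dvd_right f D
  obtain ⟨y, hy⟩ := mg_dvd_left f D
  obtain ⟨a, b, hab⟩ := mg_bezout f D
  set g := mg f D with hg
  have hcop : IsCoprime g h := by
    rw [hh] at hsq
    exact (squarefree_mul_iff.mp hsq).1.isCoprime
  obtain ⟨α, β, hαβ⟩ := hcop
  have h1 : a * y + b * h = 1 := by
    apply mul_left_cancel₀ hgm.ne_zero
    linear_combination -hab - a * hy - b * hh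
  have hu : IsCoprime (y * α * g + β * h) D := by
    rw [hh]
    apply IsCoprime.mul_right
    · exact ⟨1, -((y - 1) * α), by linear_combination hαβ⟩
    · refine ⟨a, b - a * (1 - y) * β, ?_⟩
      linear_combination h1 + a * y * hαβ
  obtain ⟨u, hu'⟩ := isUnit_mk_iff.mpr hu
  refine ⟨(g, u), ?_, ?_⟩
  · simp only [Finset.coe_product, Set.mem_prod, Finset.mem_coe, Finset.mem_univ, and_true]
    exact (mem_dv hD.ne_zero).mpr ⟨hgm, ⟨h, hh⟩⟩
  · simp only
    rw [hu', ← map_mul, mk_eq_iff]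
    refine ⟨(1 - y) * β, ?_⟩
    linear_combination (-1 : F[X]) * hy + (1 - y) * β * (-1) * hh + g * y * hαβ

end KlF
end FM

open scoped Classical
open Polynomial Filter
set_option linter.unusedSectionVars false
set_option linter.unusedVariables false
set_option linter.style.haveILetI false
namespace FM
section TypeOne

noncomputable def Fr {R : Type} [CommRing R] (ψ : AddChar R ℂ) (b x : R) : ℂ :=
  if IsUnit x then ψ (b * Ring.inverse x) else 0

lemma Fr_expand {R : Type} [CommRing R] [Fintype R] (ψ : AddChar R ℂ) (hψ : ψ.IsPrimitive) (b x : R) :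
    (Fintype.card R : ℂ) * Fr ψ b x = ∑ h, klo ψ (-h) b * ψ (h * x) := by
  have h1 : ∀ h, klo ψ (-h) b * ψ (h * x) = ∑ u : Rˣ, ψ (b * (u⁻¹ : Rˣ)) * ψ (h * (x - u)) := by
    intro h
    rw [klo, Finset.sum_mul]
    apply Finset.sum_congr rfl
    intro u _
    rw [← AddChar.map_add_eq_mul, ← AddChar.map_add_eq_mul]
    congr 1; ring
  simp only [h1]
  rw [Finset.sum_comm]
  simp only [← Finset.mul_sum]
  have h2 : ∀ u : Rˣ, ∑ h, ψ (h * (x - u)) = if x = u then (Fintype.card R : ℂ) else 0 := by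
    intro u
    rw [AddChar.sum_mulShift (x - (u : R)) hψ]
    simp only [sub_eq_zero]
    split_ifs <;> simp
  simp only [h2]
  by_cases hx : IsUnit x
  · obtain ⟨v, rfl⟩ := hx
    rw [Fr, if_pos v.isUnit, Finset.sum_eq_single v]
    · simp [mul_comm]
    · intro w _ hw
      rw [if_neg, mul_zero]
      intro h; exact hw (Units.ext h).symm
    · simp
  · rw [Fr, if_neg hx, Finset.sum_eq_zero]
    · simp
    · intro u _
      rw [if_neg, mul_zero]
      rintro rfl; exact hx u.isUnit

variable {F : Type} [Field F] [Fintype F]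

lemma two_unit (h2F : (2 : F) ≠ 0) (D : F[X]) : IsUnit (2 : F[X] ⧸ Ideal.span {D}) := by
  have h := (IsUnit.mk0 (2 : F) h2F).map ((Ideal.Quotient.mk (Ideal.span {D})).comp (C : F →+* F[X]))
  rwa [map_ofNat] at h

lemma klo_bound {D : F[X]} (h2F : (2 : F) ≠ 0) (hD : D.Monic) (hsq : Squarefree D) [Fintype (F[X] ⧸ Ideal.span {D})]
    (ψ : AddChar (F[X] ⧸ Ideal.span {D}) ℂ) (hψ : ψ.IsPrimitive) (a b : F[X] ⧸ Ideal.span {D}) (hb : IsUnit b) :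
    ‖klo ψ a b‖ ≤ ((dv D).card : ℝ) * (Fintype.card F : ℝ) ^ ((3 / 4 : ℝ) * D.natDegree) := by
  have h1 := klo_bound1 ψ hψ a b hb
  have h2 := (n2_count (two_unit h2F D)).trans (count_triples hD)
  have h3 := card_units_ge hD hsq
  have h4 := card_quot hD
  have hq : (0 : ℝ) < Fintype.card F := by exact_mod_cast Fintype.card_pos
  set q : ℝ := (Fintype.card F : ℝ) with hqdef
  have h2' : (∑ c : (F[X] ⧸ Ideal.span {D}) × (F[X] ⧸ Ideal.span {D}), (n2 c : ℝ) ^ 2) ≤ ((dv D).card : ℝ) ^ 3 * q ^ (2 * D.natDegree) := by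
    rw [hqdef]; exact_mod_cast h2
  have h3' : q ^ D.natDegree ≤ ((dv D).card : ℝ) * (Fintype.card (F[X] ⧸ Ideal.span {D})ˣ : ℝ) := by
    rw [h4] at h3
    rw [hqdef]; exact_mod_cast h3
  have h4' : (Fintype.card (F[X] ⧸ Ideal.span {D}) : ℝ) = q ^ D.natDegree := by
    rw [hqdef, h4]; push_cast; rfl
  rw [h4'] at h1
  set Q := q ^ D.natDegree with hQ
  have hQ0 : 0 < Q := by positivity
  have hQ2 : q ^ (2 * D.natDegree) = Q ^ 2 := by rw [hQ, ← pow_mul, mul_comm]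
  rw [hQ2] at h2'
  set t : ℝ := ((dv D).card : ℝ)
  have ht : 0 ≤ t := by positivity
  set K := ‖klo ψ a b‖
  have hK : 0 ≤ K := norm_nonneg _
  have h5 : Q * K ^ 4 ≤ Q * (t ^ 4 * Q ^ 3) := by
    calc Q * K ^ 4 ≤ (t * (Fintype.card (F[X] ⧸ Ideal.span {D})ˣ : ℝ)) * K ^ 4 := by gcongr
      _ = t * ((Fintype.card (F[X] ⧸ Ideal.span {D})ˣ : ℝ) * K ^ 4) := by ring
      _ ≤ t * (Q ^ 2 * (t ^ 3 * Q ^ 2)) := by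
        refine mul_le_mul_of_nonneg_left (h1.trans ?_) ht
        gcongr
      _ = _ := by ring
  have h6 := le_of_mul_le_mul_left h5 hQ0
  have h7 : t ^ 4 * Q ^ 3 = (t * q ^ ((3 / 4 : ℝ) * D.natDegree)) ^ 4 := by
    rw [mul_pow]; congr 1
    rw [← Real.rpow_natCast (q ^ ((3 / 4 : ℝ) * D.natDegree)), ← Real.rpow_mul hq.le, hQ, ← pow_mul, ← Real.rpow_natCast]
    congr 1; push_cast; ring
  rw [h7] at h6
  exact le_of_pow_le_pow_left₀ (by norm_num) (by positivity) h6

lemma lt_add {k : ℕ} {f g : F[X]} (hf : f ∈ lt F k) (hg : g ∈ lt F k) : f + g ∈ lt F k := by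
  rw [mem_lt] at *
  exact (degree_add_le _ _).trans_lt (max_lt hf hg)

lemma lt_sub {k : ℕ} {f g : F[X]} (hf : f ∈ lt F k) (hg : g ∈ lt F k) : f - g ∈ lt F k := by
  rw [mem_lt] at *
  exact (degree_sub_le _ _).trans_lt (max_lt hf hg)

lemma lin_sum {D : F[X]} (ψ : AddChar (F[X] ⧸ Ideal.span {D}) ℂ) (k : ℕ) (h : F[X] ⧸ Ideal.span {D}) :
    ((‖∑ g ∈ lt F k, ψ (h * Ideal.Quotient.mk _ g)‖ : ℝ) : ℂ) = ∑ g ∈ lt F k, ψ (h * Ideal.Quotient.mk _ g) := by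
  by_cases H : ∀ g ∈ lt F k, ψ (h * Ideal.Quotient.mk _ g) = 1
  · rw [Finset.sum_congr rfl H]; simp
  · push Not at H
    obtain ⟨g0, hg0, h1⟩ := H
    have h2 : ψ (h * Ideal.Quotient.mk _ g0) * ∑ g ∈ lt F k, ψ (h * Ideal.Quotient.mk _ g) = ∑ g ∈ lt F k, ψ (h * Ideal.Quotient.mk _ g) := by
      rw [Finset.mul_sum]
      refine Finset.sum_bij' (fun g _ => g0 + g) (fun g _ => g - g0) ?_ ?_ ?_ ?_ ?_
      · intro g hg; exact lt_add hg0 hg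
      · intro g hg; exact lt_sub hg hg0
      · intro g hg; ring
      · intro g hg; ring
      · intro g hg
        rw [← AddChar.map_add_eq_mul, map_add (Ideal.Quotient.mk (Ideal.span {D})), mul_add]
    have h3 : ∑ g ∈ lt F k, ψ (h * Ideal.Quotient.mk _ g) = 0 := by
      have : (ψ (h * Ideal.Quotient.mk _ g0) - 1) * ∑ g ∈ lt F k, ψ (h * Ideal.Quotient.mk _ g) = 0 := by
        rw [sub_mul, h2, one_mul, sub_self]
      exact (mul_eq_zero.mp this).resolve_left (sub_ne_zero.mpr h1)
    rw [h3]; simp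

lemma lin_total {D : F[X]} (hD : D.Monic) [Fintype (F[X] ⧸ Ideal.span {D})]
    (ψ : AddChar (F[X] ⧸ Ideal.span {D}) ℂ) (hψ : ψ.IsPrimitive) (k : ℕ) :
    ∑ h, ‖∑ g ∈ lt F k, ψ (h * Ideal.Quotient.mk _ g)‖ ≤
      (Fintype.card (F[X] ⧸ Ideal.span {D}) : ℝ) * (Fintype.card F : ℝ) ^ (k - D.natDegree) := by
  have h1 : ((∑ h, ‖∑ g ∈ lt F k, ψ (h * Ideal.Quotient.mk _ g)‖ : ℝ) : ℂ) =
      (((Fintype.card (F[X] ⧸ Ideal.span {D}) : ℝ) * (((lt F k).filter (fun f => D ∣ f)).card : ℝ) : ℝ) : ℂ) := by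
    push_cast
    simp only [lin_sum]
    rw [Finset.sum_comm]
    have h2 : ∀ g, ∑ h, ψ (h * Ideal.Quotient.mk _ g) = if D ∣ g then (Fintype.card (F[X] ⧸ Ideal.span {D}) : ℂ) else 0 := by
      intro g
      rw [AddChar.sum_mulShift _ hψ]
      simp only [mk_eq_zero_iff]
      split_ifs <;> simp
    simp only [h2]
    rw [← Finset.sum_filter, Finset.sum_const, nsmul_eq_mul, mul_comm]
  have h3 := Complex.ofReal_injective h1
  rw [h3]
  gcongr
  exact_mod_cast count_mult hD

lemma incomplete {D : F[X]} (h2F : (2 : F) ≠ 0) (hD : D.Monic) (hsq : Squarefree D) [Fintype (F[X] ⧸ Ideal.span {D})]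
    (ψ : AddChar (F[X] ⧸ Ideal.span {D}) ℂ) (hψ : ψ.IsPrimitive) (b : F[X] ⧸ Ideal.span {D}) (hb : IsUnit b) (k : ℕ) :
    ‖∑ c ∈ mon F k, Fr ψ b (Ideal.Quotient.mk _ c)‖ ≤
      ((dv D).card : ℝ) * (Fintype.card F : ℝ) ^ ((3 / 4 : ℝ) * D.natDegree) * (Fintype.card F : ℝ) ^ (k - D.natDegree) := by
  set B := ((dv D).card : ℝ) * (Fintype.card F : ℝ) ^ ((3 / 4 : ℝ) * D.natDegree) with hB
  have hcard : (0 : ℝ) < Fintype.card (F[X] ⧸ Ideal.span {D}) := by exact_mod_cast Fintype.card_pos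
  have h1 : (Fintype.card (F[X] ⧸ Ideal.span {D}) : ℂ) * ∑ c ∈ mon F k, Fr ψ b (Ideal.Quotient.mk _ c)
      = ∑ h, klo ψ (-h) b * ψ (h * Ideal.Quotient.mk _ (X ^ k)) * ∑ g ∈ lt F k, ψ (h * Ideal.Quotient.mk _ g) := by
    rw [Finset.mul_sum]
    simp only [Fr_expand ψ hψ]
    rw [Finset.sum_comm]
    apply Finset.sum_congr rfl
    intro h _
    rw [mon, Finset.sum_image (fun x _ y _ hxy => add_right_injective _ hxy), Finset.mul_sum]
    apply Finset.sum_congr rfl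
    intro g _
    rw [map_add (Ideal.Quotient.mk (Ideal.span {D})), mul_add, AddChar.map_add_eq_mul, mul_assoc]
  have h2 : (Fintype.card (F[X] ⧸ Ideal.span {D}) : ℝ) * ‖∑ c ∈ mon F k, Fr ψ b (Ideal.Quotient.mk _ c)‖ ≤
      (Fintype.card (F[X] ⧸ Ideal.span {D}) : ℝ) * (B * (Fintype.card F : ℝ) ^ (k - D.natDegree)) := by
    have := congrArg norm h1
    rw [norm_mul, Complex.norm_natCast] at this
    rw [this]
    refine (norm_sum_le _ _).trans ?_
    calc _ ≤ ∑ h, B * ‖∑ g ∈ lt F k, ψ (h * Ideal.Quotient.mk _ g)‖ := by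
          apply Finset.sum_le_sum
          intro h _
          rw [norm_mul, norm_mul, psi_norm hD, mul_one]
          gcongr
          exact klo_bound h2F hD hsq ψ hψ _ _ hb
      _ = B * ∑ h, ‖∑ g ∈ lt F k, ψ (h * Ideal.Quotient.mk _ g)‖ := by rw [Finset.mul_sum]
      _ ≤ B * ((Fintype.card (F[X] ⧸ Ideal.span {D}) : ℝ) * (Fintype.card F : ℝ) ^ (k - D.natDegree)) := by
          gcongr
          exact lin_total hD ψ hψ k
      _ = _ := by ring
  exact le_of_mul_le_mul_left h2 hcard

lemma cop_ind {E : F[X]} (hE : E.Monic) (c : F[X]) :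
    (if IsCoprime c E then (1 : ℂ) else 0) = ∑ e ∈ dv E, if e ∣ c then (pmu e : ℂ) else 0 := by
  have h1 : (dv E).filter (fun e => e ∣ c) = dv (mg c E) := by
    ext e
    rw [Finset.mem_filter, mem_dv hE.ne_zero, mem_dv (mg_monic c hE.ne_zero).ne_zero]
    constructor
    · rintro ⟨⟨a, b⟩, d⟩; exact ⟨a, dvd_mg d b⟩
    · rintro ⟨a, b⟩; exact ⟨⟨a, b.trans (mg_dvd_right _ _)⟩, b.trans (mg_dvd_left _ _)⟩
  rw [← Finset.sum_filter, h1]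
  have h2 := sum_pmu_dv (mg c E) (mg_monic c hE.ne_zero)
  have h3 : (∑ e ∈ dv (mg c E), (pmu e : ℂ)) = if mg c E = 1 then (1 : ℂ) else 0 := by
    have := congrArg (fun z : ℤ => (z : ℂ)) h2
    simp only [Int.cast_sum] at this
    rw [this]; split_ifs <;> simp
  rw [h3]
  congr 1
  apply propext
  constructor
  · intro h
    exact (mg_monic c hE.ne_zero).eq_one_of_isUnit (h.isUnit_of_dvd' (mg_dvd_left _ _) (mg_dvd_right _ _))
  · intro h
    obtain ⟨x, y, hxy⟩ := mg_bezout c E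
    exact ⟨x, y, by rw [← hxy, h]⟩

lemma type_one {M D : F[X]} (h2F : (2 : F) ≠ 0) (hM : M.Monic) (hsqM : Squarefree M) (hD : D.Monic) (hDM : D ∣ M) [Fintype (F[X] ⧸ Ideal.span {D})]
    (ψ : AddChar (F[X] ⧸ Ideal.span {D}) ℂ) (hψ : ψ.IsPrimitive) (b : F[X] ⧸ Ideal.span {D}) (hb : IsUnit b) (k : ℕ) :
    ‖∑ c ∈ mon F k, (if IsCoprime c M then ψ (b * xi D c) else 0)‖ ≤
      ((dv M).card : ℝ) * (((dv M).card : ℝ) * (Fintype.card F : ℝ) ^ ((3 / 4 : ℝ) * D.natDegree) * (Fintype.card F : ℝ) ^ (k - D.natDegree)) := by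
  obtain ⟨E, rfl⟩ := hDM
  have hE : E.Monic := hD.of_mul_monic_left hM
  have hsqD : Squarefree D := hsqM.of_mul_left
  have hq1 : (1 : ℝ) ≤ Fintype.card F := by exact_mod_cast Fintype.card_pos
  have hcop : IsCoprime D E := by
    exact (isRelPrime_iff_isCoprime).mp ((squarefree_mul_iff).mp hsqM).1
  have hdvE : dv E ⊆ dv (D * E) := by
    intro e he
    rw [mem_dv hE.ne_zero] at he
    rw [mem_dv hM.ne_zero]
    exact ⟨he.1, he.2.mul_left D⟩
  have hdvD : dv D ⊆ dv (D * E) := by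
    intro e he
    rw [mem_dv hD.ne_zero] at he
    rw [mem_dv hM.ne_zero]
    exact ⟨he.1, he.2.mul_right E⟩
  have h1 : ∀ c, (if IsCoprime c (D * E) then ψ (b * xi D c) else 0) = ∑ e ∈ dv E, (pmu e : ℂ) * (if e ∣ c then Fr ψ b (Ideal.Quotient.mk _ c) else 0) := by
    intro c
    have h2 : (if IsCoprime c (D * E) then ψ (b * xi D c) else 0) = (if IsCoprime c E then (1 : ℂ) else 0) * Fr ψ b (Ideal.Quotient.mk _ c) := by
      simp only [Fr, isUnit_mk_iff, IsCoprime.mul_right_iff, xi]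
      by_cases h3 : IsCoprime c D <;> by_cases h4 : IsCoprime c E <;> simp [h3, h4]
    rw [h2, cop_ind hE, Finset.sum_mul]
    apply Finset.sum_congr rfl
    intro e _
    split_ifs <;> simp
  simp only [h1]
  rw [Finset.sum_comm]
  simp only [← Finset.mul_sum]
  set B := ((dv (D * E)).card : ℝ) * (Fintype.card F : ℝ) ^ ((3 / 4 : ℝ) * D.natDegree) * (Fintype.card F : ℝ) ^ (k - D.natDegree) with hB
  have hB0 : 0 ≤ B := by positivity
  have h5 : ∀ e ∈ dv E, ‖(pmu e : ℂ) * ∑ c ∈ mon F k, (if e ∣ c then Fr ψ b (Ideal.Quotient.mk _ c) else 0)‖ ≤ B := by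
    intro e he
    rw [mem_dv hE.ne_zero] at he
    rw [norm_mul]
    refine (mul_le_of_le_one_left (norm_nonneg _) (pmu_norm_le e)).trans ?_
    by_cases hk : e.natDegree ≤ k
    · rw [sum_dvd_mon (i := e.natDegree) (mem_mon.mpr ⟨he.1, rfl⟩) hk (fun c => Fr ψ b (Ideal.Quotient.mk _ c))]
      have hu : IsUnit (Ideal.Quotient.mk (Ideal.span {D}) e) :=
        isUnit_mk_iff.mpr (hcop.symm.of_isCoprime_of_dvd_left he.2)
      obtain ⟨u, hu⟩ := hu
      have h6 : ∀ g, Fr ψ b (Ideal.Quotient.mk (Ideal.span {D}) (e * g)) = Fr ψ (b * (u⁻¹ : (F[X] ⧸ Ideal.span {D})ˣ)) (Ideal.Quotient.mk (Ideal.span {D}) g) := by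
        intro g
        rw [map_mul, ← hu, Fr, Fr]
        simp only [Units.isUnit_units_mul]
        split_ifs with h7
        · obtain ⟨v, hv⟩ := h7
          rw [← hv, ← Units.val_mul, Ring.inverse_unit, Ring.inverse_unit, mul_inv_rev, Units.val_mul]
          congr 1; ring
        · rfl
      simp only [h6]
      refine (incomplete h2F hD hsqD ψ hψ _ (hb.mul (Units.isUnit _)) _).trans ?_
      rw [hB]
      have : ((dv D).card : ℝ) ≤ (dv (D * E)).card := by exact_mod_cast Finset.card_le_card hdvD
      gcongr
      omega
    · rw [Finset.sum_eq_zero]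
      · simpa using hB0
      · intro c hc
        rw [mem_mon] at hc
        rw [if_neg]
        intro h
        exact hk (hc.2 ▸ natDegree_le_of_dvd h hc.1.ne_zero)
  refine (norm_sum_le _ _).trans ((Finset.sum_le_sum h5).trans ?_)
  rw [Finset.sum_const, nsmul_eq_mul]
  gcongr

end TypeOne
end FM

open scoped Classical
open Polynomial Filter
set_option linter.unusedSectionVars false
set_option linter.unusedVariables false
set_option linter.style.haveILetI false
namespace FM
section Vau
variable {F : Type} [Field F] [Fintype F]

lemma xi_mul {D f g : F[X]} (hf : IsCoprime f D) (hg : IsCoprime g D) : xi D (f * g) = xi D f * xi D g := by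
  obtain ⟨u, hu⟩ := isUnit_mk_iff.mpr hf
  obtain ⟨v, hv⟩ := isUnit_mk_iff.mpr hg
  rw [xi, xi, xi, map_mul, ← hu, ← hv, ← Units.val_mul, Ring.inverse_unit, Ring.inverse_unit, Ring.inverse_unit, mul_inv_rev, Units.val_mul, mul_comm]

lemma xi_unit {D f : F[X]} (hf : IsCoprime f D) : IsUnit (xi D f) := by
  obtain ⟨u, hu⟩ := isUnit_mk_iff.mpr hf
  rw [xi, ← hu, Ring.inverse_unit]
  exact Units.isUnit _

lemma wt_mul {M D : F[X]} (hDM : D ∣ M) (ψ : AddChar (F[X] ⧸ Ideal.span {D}) ℂ) (f g : F[X]) :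
    wt M D ψ (f * g) = if IsCoprime f M then (if IsCoprime g M then ψ (xi D f * xi D g) else 0) else 0 := by
  rw [wt]
  by_cases hf : IsCoprime f M
  · by_cases hg : IsCoprime g M
    · rw [if_pos (hf.mul_left hg), if_pos hf, if_pos hg, ← xi_mul (hf.of_isCoprime_of_dvd_right hDM) (hg.of_isCoprime_of_dvd_right hDM)]
      rfl
    · rw [if_neg (fun h => hg h.of_mul_left_right), if_neg hg, if_pos hf]
  · rw [if_neg (fun h => hf h.of_mul_left_left), if_neg hf]

lemma regroup {β : Type*} [AddCommMonoid β] (j k : ℕ) (G : F[X] → F[X] → β) :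
    ∑ b ∈ mon F j, ∑ c ∈ mon F k, G b c = ∑ g ∈ mon F (j + k), ∑ b ∈ (dv g).filter (fun b => b.natDegree = j), G b (g / b) := by
  have h := sum_pairs (F := F) (j + k) (fun b c => if b.natDegree = j then G b c else 0)
  simp only [Finset.sum_filter]
  rw [← h, Finset.sum_eq_single (j, k)]
  · apply Finset.sum_congr rfl
    intro b hb
    apply Finset.sum_congr rfl
    intro c hc
    rw [if_pos (mem_mon.mp hb).2]
  · rintro ⟨i, l⟩ hil hne
    rw [Finset.HasAntidiagonal.mem_antidiagonal] at hil
    simp only at hil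
    apply Finset.sum_eq_zero
    intro b hb
    apply Finset.sum_eq_zero
    intro c hc
    rw [if_neg]
    rw [(mem_mon.mp hb).2]
    rintro rfl
    exact hne (by rw [Nat.add_left_cancel hil])
  · intro h
    exact absurd ((Finset.HasAntidiagonal.mem_antidiagonal (n := j + k) (a := (j, k))).mpr rfl) h

noncomputable def Tv (w : F[X] → ℂ) (i j k : ℕ) : ℂ :=
  ∑ a ∈ mon F i, ∑ b ∈ mon F j, ∑ c ∈ mon F k, (pmu a : ℂ) * (pmu b : ℂ) * w (a * b * c)

noncomputable def Sv (w : F[X] → ℂ) (n : ℕ) : ℂ := ∑ f ∈ mon F n, (pmu f : ℂ) * w f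

lemma Tv_symm (w : F[X] → ℂ) (i j k : ℕ) : Tv w i j k = Tv w j i k := by
  unfold Tv
  rw [Finset.sum_comm]
  apply Finset.sum_congr rfl; intro a _
  apply Finset.sum_congr rfl; intro b _
  apply Finset.sum_congr rfl; intro c _
  rw [mul_comm b a, mul_comm (pmu b : ℂ)]

lemma Tv_sum (w : F[X] → ℂ) (j l : ℕ) :
    ∑ i ∈ Finset.range (l + 1), Tv w i j (l - i) = if l = 0 then Sv w j else 0 := by
  have h := sum_pmu_pairs l (fun f => ∑ b ∈ mon F j, (pmu b : ℂ) * w (b * f))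
  rw [Finset.Nat.sum_antidiagonal_eq_sum_range_succ_mk] at h
  have h2 : (if l = 0 then Sv w j else 0) = if l = 0 then ∑ b ∈ mon F j, (pmu b : ℂ) * w (b * 1) else 0 := by
    simp [Sv]
  rw [h2, ← h]
  apply Finset.sum_congr rfl; intro i _
  unfold Tv
  apply Finset.sum_congr rfl; intro a _
  rw [Finset.sum_comm]
  apply Finset.sum_congr rfl; intro c _
  rw [Finset.mul_sum]
  apply Finset.sum_congr rfl; intro b _
  rw [mul_assoc]
  congr 3
  ring

noncomputable def Tn (w : F[X] → ℂ) (n i j : ℕ) : ℂ := if i + j ≤ n then Tv w i j (n - i - j) else 0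

lemma Tn_symm (w : F[X] → ℂ) (n i j : ℕ) : Tn w n i j = Tn w n j i := by
  unfold Tn
  rw [Tv_symm, add_comm, Nat.sub_right_comm]

lemma Tn_sum (w : F[X] → ℂ) (n j : ℕ) (hj : j ≤ n) :
    ∑ i ∈ Finset.range (n + 1), Tn w n i j = if j = n then Sv w n else 0 := by
  have h := Tv_sum w j (n - j)
  have h1 : ∑ i ∈ Finset.range (n + 1), Tn w n i j = ∑ i ∈ Finset.range (n - j + 1), Tv w i j (n - j - i) := by
    rw [← Finset.sum_subset (s₁ := Finset.range (n - j + 1))]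
    · apply Finset.sum_congr rfl
      intro i hi
      rw [Finset.mem_range] at hi
      rw [Tn, if_pos (by omega), Nat.sub_right_comm]
    · intro i; simp only [Finset.mem_range]; omega
    · intro i _ hi
      rw [Finset.mem_range] at hi
      rw [Tn, if_neg (by omega)]
  rw [h1, h]
  by_cases hjn : j = n
  · subst hjn; simp
  · rw [if_neg (by omega), if_neg hjn]

lemma vaughan (w : F[X] → ℂ) (n U : ℕ) (hU : U < n) :
    Sv w n = (∑ i ∈ Finset.range (n + 1), ∑ j ∈ Finset.range (n + 1), if U < i ∧ U < j then Tn w n i j else 0)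
      - ∑ i ∈ Finset.range (n + 1), ∑ j ∈ Finset.range (n + 1), if i ≤ U ∧ j ≤ U then Tn w n i j else 0 := by
  have h1 : ∑ i ∈ Finset.range (n + 1), ∑ j ∈ Finset.range (n + 1), Tn w n i j = Sv w n := by
    rw [Finset.sum_comm]
    rw [Finset.sum_congr rfl (fun j hj => Tn_sum w n j (by rw [Finset.mem_range] at hj; omega))]
    simp
  have h2 : ∑ i ∈ Finset.range (n + 1), ∑ j ∈ Finset.range (n + 1), (if j ≤ U then Tn w n i j else 0) = 0 := by
    rw [Finset.sum_comm]
    apply Finset.sum_eq_zero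
    intro j hj
    rw [Finset.mem_range] at hj
    by_cases h : j ≤ U
    · simp only [if_pos h]
      rw [Tn_sum w n j (by omega), if_neg (by omega)]
    · simp [if_neg h]
  have h3 : ∑ i ∈ Finset.range (n + 1), ∑ j ∈ Finset.range (n + 1), (if i ≤ U then Tn w n i j else 0) = 0 := by
    refine Eq.trans ?_ h2
    rw [Finset.sum_comm]
    apply Finset.sum_congr rfl; intro i _
    apply Finset.sum_congr rfl; intro j _
    rw [Tn_symm]
  have h4 : ∀ i j, (if U < i ∧ U < j then Tn w n i j else 0) - (if i ≤ U ∧ j ≤ U then Tn w n i j else 0)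
      = Tn w n i j - (if j ≤ U then Tn w n i j else 0) - (if i ≤ U then Tn w n i j else 0) := by
    intro i j
    by_cases hi : i ≤ U <;> by_cases hj : j ≤ U
    · simp [hi, hj, not_lt.mpr hi]
    · simp [hi, hj, not_lt.mpr hi]
    · simp [hi, hj, not_lt.mpr hj]
    · simp [hi, hj, not_le.mp hi, not_le.mp hj]
  simp only [← Finset.sum_sub_distrib]
  simp only [h4]
  simp only [Finset.sum_sub_distrib]
  rw [h1, h2, h3]; ring

lemma vaughan_bound (w : F[X] → ℂ) (n U : ℕ) (hU : U < n) (B : ℝ)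
    (hB : ∀ i j, i + j ≤ n → ((U < i ∧ U < j) ∨ (i ≤ U ∧ j ≤ U)) → ‖Tv w i j (n - i - j)‖ ≤ B) :
    ‖Sv w n‖ ≤ ((n : ℝ) + 1) ^ 2 * B := by
  have hB0 : 0 ≤ B := (norm_nonneg _).trans (hB 0 0 (by omega) (by omega))
  rw [vaughan w n U hU]
  simp only [← Finset.sum_sub_distrib]
  have h : ∀ i j, ‖(if U < i ∧ U < j then Tn w n i j else 0) - (if i ≤ U ∧ j ≤ U then Tn w n i j else 0)‖ ≤ B := by
    intro i j
    have hT : ((U < i ∧ U < j) ∨ (i ≤ U ∧ j ≤ U)) → ‖Tn w n i j‖ ≤ B := by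
      intro h
      rw [Tn]; split_ifs with h1
      · exact hB i j h1 h
      · simpa using hB0
    by_cases h1 : U < i ∧ U < j
    · rw [if_pos h1, if_neg (by omega), sub_zero]; exact hT (Or.inl h1)
    · by_cases h2 : i ≤ U ∧ j ≤ U
      · rw [if_neg h1, if_pos h2, zero_sub, norm_neg]; exact hT (Or.inr h2)
      · rw [if_neg h1, if_neg h2]; simpa using hB0
  calc _ ≤ ∑ i ∈ Finset.range (n + 1), ∑ j ∈ Finset.range (n + 1), B := by
        refine (norm_sum_le _ _).trans (Finset.sum_le_sum fun i _ => (norm_sum_le _ _).trans (Finset.sum_le_sum fun j _ => h i j))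
    _ = _ := by simp; ring

lemma mono_aux (k cs ct Cs Ct Q e1 e2 E1 E2 : ℝ) (hk : 0 ≤ k) (hcs : 0 ≤ cs) (hct : 0 ≤ ct) (hQ : 0 ≤ Q) (he1 : 0 ≤ e1) (he2 : 0 ≤ e2)
    (h1 : cs ≤ Cs) (h2 : ct ≤ Ct) (h3 : e1 ≤ E1) (h4 : e2 ≤ E2) :
    k * cs ^ 4 * ct ^ 4 * Q * e1 * e2 ≤ k * Cs ^ 4 * Ct ^ 4 * Q * E1 * E2 := by
  have : 0 ≤ Cs := hcs.trans h1
  have : 0 ≤ Ct := hct.trans h2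
  have : 0 ≤ E1 := he1.trans h3
  gcongr

lemma mono_aux2 (k Y x1 x2 x3 x4 : ℝ) (hk : 0 ≤ k) (h1 : x1 ≤ Y) (h2 : x2 ≤ Y) (h3 : x3 ≤ Y) (h4 : x4 ≤ Y) :
    k * (x1 + x2 + x3 + x4) ≤ k * (4 * Y) := by
  apply mul_le_mul_of_nonneg_left _ hk
  linarith

lemma type_two_app {M D : F[X]} (hD : D.Monic) (hDM : D ∣ M) [Fintype (F[X] ⧸ Ideal.span {D})]
    (ψ : AddChar (F[X] ⧸ Ideal.span {D}) ℂ) (hψ : ψ.IsPrimitive) (A : ℝ) (hA : 0 ≤ A)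
    (hE : ∀ k : ℕ, k < D.natDegree → ∀ S : Finset F[X], S ⊆ mon F k → (∀ f ∈ S, IsCoprime f D) →
      (∑ a, (nu S (xi D) a : ℝ) ^ 2) ≤ A *
      ((Fintype.card F : ℝ) ^ ((2 : ℝ) * k) + (Fintype.card F : ℝ) ^ ((7 / 2 : ℝ) * k - D.natDegree / 2)))
    (s t n : ℕ) (hst : s + t = n) (hs : 5 * s ≤ n + 3 * D.natDegree) (ht : 5 * t ≤ n + 3 * D.natDegree)
    (hn : 5 * n < 6 * D.natDegree) (K L : ℝ) (hK : 0 ≤ K) (hL : 0 ≤ L) (α β : F[X] → ℂ)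
    (hα : ∀ f ∈ mon F s, ‖α f‖ ≤ K) (hβ : ∀ f ∈ mon F t, ‖β f‖ ≤ L) :
    ‖∑ f ∈ mon F s, ∑ g ∈ mon F t, α f * β g * wt M D ψ (f * g)‖ ^ 8 ≤
      (K * L) ^ 8 * (4 * A ^ 2) * ((Fintype.card F : ℝ) ^ ((6 * D.natDegree + 25 * n : ℝ) / 32)) ^ 8 := by
  have hq1 : (1 : ℝ) < Fintype.card F := by exact_mod_cast one_lt_q
  have hcq := card_quot hD
  set q : ℝ := (Fintype.card F : ℝ) with hqdef
  have hq0 : 0 < q := by linarith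
  set m := D.natDegree with hm
  set S := (mon F s).filter (fun f => IsCoprime f M)
  set T := (mon F t).filter (fun f => IsCoprime f M)
  have h1 : ∑ f ∈ mon F s, ∑ g ∈ mon F t, α f * β g * wt M D ψ (f * g) = ∑ f ∈ S, ∑ g ∈ T, α f * β g * ψ (xi D f * xi D g) := by
    rw [Finset.sum_filter]
    apply Finset.sum_congr rfl; intro f _
    split_ifs with hf
    · rw [Finset.sum_filter]
      apply Finset.sum_congr rfl; intro g _
      rw [wt_mul hDM, if_pos hf]
      split_ifs <;> simp
    · apply Finset.sum_eq_zero; intro g _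
      rw [wt_mul hDM, if_neg hf, mul_zero]
  rw [h1]
  have h2 := type_two ψ hψ S T α β (xi D) (xi D) K L hK hL (fun f hf => hα f (Finset.mem_filter.mp hf).1) (fun f hf => hβ f (Finset.mem_filter.mp hf).1)
  refine h2.trans ?_
  have e1 := hE s (by omega) S (Finset.filter_subset _ _) (fun f hf => (Finset.mem_filter.mp hf).2.of_isCoprime_of_dvd_right hDM)
  have e2 := hE t (by omega) T (Finset.filter_subset _ _) (fun f hf => (Finset.mem_filter.mp hf).2.of_isCoprime_of_dvd_right hDM)
  have c1 : (S.card : ℝ) ≤ q ^ (s : ℝ) := by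
    rw [Real.rpow_natCast, hqdef]; exact_mod_cast (Finset.card_filter_le _ _).trans (card_mon s).le
  have c2 : (T.card : ℝ) ≤ q ^ (t : ℝ) := by
    rw [Real.rpow_natCast, hqdef]; exact_mod_cast (Finset.card_filter_le _ _).trans (card_mon t).le
  have c3 : (Fintype.card (F[X] ⧸ Ideal.span {D}) : ℝ) = q ^ (m : ℝ) := by
    rw [Real.rpow_natCast, hqdef, hcq]; push_cast; rfl
  rw [c3]
  have p1 : ∀ x : ℝ, (q ^ x) ^ 4 = q ^ (4 * x) := by
    intro x; rw [← Real.rpow_natCast, ← Real.rpow_mul hq0.le]; congr 1; push_cast; ring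
  have p2 : ∀ x : ℝ, (q ^ x) ^ 8 = q ^ (8 * x) := by
    intro x; rw [← Real.rpow_natCast, ← Real.rpow_mul hq0.le]; congr 1; push_cast; ring
  have r1 : (n : ℝ) = s + t := by rw [← hst]; push_cast; rfl
  have r2 : 5 * (s : ℝ) ≤ n + 3 * m := by exact_mod_cast hs
  have r3 : 5 * (t : ℝ) ≤ n + 3 * m := by exact_mod_cast ht
  have r4 : 5 * (n : ℝ) ≤ 6 * m := by exact_mod_cast hn.le
  have r5 : (0 : ℝ) ≤ m := by positivity
  set Y := (q ^ ((6 * m + 25 * n : ℝ) / 32)) ^ 8 with hY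
  have hx : ∀ x y : ℝ, 4 * (s : ℝ) + 4 * t + m + x + y ≤ (6 * m + 25 * n : ℝ) / 4 →
      q ^ (4 * (s : ℝ)) * q ^ (4 * (t : ℝ)) * q ^ (m : ℝ) * (q ^ x * q ^ y) ≤ Y := by
    intro x y h
    rw [hY, p2, ← Real.rpow_add hq0, ← Real.rpow_add hq0, ← Real.rpow_add hq0, ← Real.rpow_add hq0]
    apply Real.rpow_le_rpow_of_exponent_le hq1.le
    linarith
  have k1 := hx (2 * s) (2 * t) (by linarith)
  have k2 := hx (2 * s) (7 / 2 * t - m / 2) (by linarith)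
  have k3 := hx (7 / 2 * s - m / 2) (2 * t) (by linarith)
  have k4 := hx (7 / 2 * s - m / 2) (7 / 2 * t - m / 2) (by linarith)
  set a1 := q ^ ((2 : ℝ) * s)
  set a2 := q ^ ((7 / 2 : ℝ) * s - m / 2)
  set b1 := q ^ ((2 : ℝ) * t)
  set b2 := q ^ ((7 / 2 : ℝ) * t - m / 2)
  have ha1 : 0 < a1 := by positivity
  have ha2 : 0 < a2 := by positivity
  calc _ ≤ (K * L) ^ 8 * (q ^ (s : ℝ)) ^ 4 * (q ^ (t : ℝ)) ^ 4 * q ^ (m : ℝ) * (A * (a1 + a2)) * (A * (b1 + b2)) :=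
        mono_aux _ _ _ _ _ _ _ _ _ _ (by positivity) (by positivity) (by positivity) (by positivity)
          (Finset.sum_nonneg fun _ _ => by positivity) (Finset.sum_nonneg fun _ _ => by positivity) c1 c2 e1 e2
    _ = (K * L) ^ 8 * A ^ 2 * (q ^ (4 * (s : ℝ)) * q ^ (4 * (t : ℝ)) * q ^ (m : ℝ) * (a1 * b1) + q ^ (4 * (s : ℝ)) * q ^ (4 * (t : ℝ)) * q ^ (m : ℝ) * (a1 * b2)
          + q ^ (4 * (s : ℝ)) * q ^ (4 * (t : ℝ)) * q ^ (m : ℝ) * (a2 * b1) + q ^ (4 * (s : ℝ)) * q ^ (4 * (t : ℝ)) * q ^ (m : ℝ) * (a2 * b2)) := by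
        rw [p1, p1]; ring
    _ ≤ (K * L) ^ 8 * A ^ 2 * (4 * Y) := mono_aux2 _ _ _ _ _ _ (by positivity) k1 k2 k3 k4
    _ = _ := by ring

end Vau
end FM

open scoped Classical
open Polynomial Filter
set_option linter.unusedSectionVars false
set_option linter.unusedVariables false
set_option linter.style.haveILetI false
namespace FM
section Mid
variable {F : Type} [Field F] [Fintype F]

lemma Tv_case1 (w : F[X] → ℂ) (i j k : ℕ) :
    Tv w i j k = ∑ a ∈ mon F i, ∑ g ∈ mon F (j + k), (pmu a : ℂ) * (∑ b ∈ (dv g).filter (fun b => b.natDegree = j), (pmu b : ℂ)) * w (a * g) := by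
  unfold Tv
  apply Finset.sum_congr rfl; intro a _
  rw [regroup]
  apply Finset.sum_congr rfl; intro g hg
  rw [Finset.mul_sum, Finset.sum_mul]
  apply Finset.sum_congr rfl; intro b hb
  have hg0 := (mem_mon.mp hg).1.ne_zero
  have hb' := (mem_dv hg0).mp (Finset.mem_filter.mp hb).1
  rw [mul_assoc a b, EuclideanDomain.mul_div_cancel' hb'.1.ne_zero hb'.2]

lemma Tv_case2 (w : F[X] → ℂ) (i j k : ℕ) :
    Tv w i j k = ∑ g ∈ mon F (i + j), ∑ c ∈ mon F k, (∑ a ∈ (dv g).filter (fun b => b.natDegree = i), (pmu a : ℂ) * (pmu (g / a) : ℂ)) * 1 * w (g * c) := by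
  unfold Tv
  rw [regroup i j (fun a b => ∑ c ∈ mon F k, (pmu a : ℂ) * (pmu b : ℂ) * w (a * b * c))]
  apply Finset.sum_congr rfl; intro g hg
  rw [Finset.sum_comm]
  apply Finset.sum_congr rfl; intro c hc
  rw [mul_one, Finset.sum_mul]
  apply Finset.sum_congr rfl; intro b hb
  have hg0 := (mem_mon.mp hg).1.ne_zero
  have hb' := (mem_dv hg0).mp (Finset.mem_filter.mp hb).1
  rw [EuclideanDomain.mul_div_cancel' hb'.1.ne_zero hb'.2]

lemma wt_type_one {M D : F[X]} (h2F : (2 : F) ≠ 0) (hM : M.Monic) (hsqM : Squarefree M) (hD : D.Monic) (hDM : D ∣ M) [Fintype (F[X] ⧸ Ideal.span {D})]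
    (ψ : AddChar (F[X] ⧸ Ideal.span {D}) ℂ) (hψ : ψ.IsPrimitive) (f : F[X]) (k : ℕ) :
    ‖∑ c ∈ mon F k, wt M D ψ (f * c)‖ ≤
      ((dv M).card : ℝ) * (((dv M).card : ℝ) * (Fintype.card F : ℝ) ^ ((3 / 4 : ℝ) * D.natDegree) * (Fintype.card F : ℝ) ^ (k - D.natDegree)) := by
  by_cases hf : IsCoprime f M
  · simp only [wt_mul hDM, if_pos hf]
    exact type_one h2F hM hsqM hD hDM ψ hψ _ (xi_unit (hf.of_isCoprime_of_dvd_right hDM)) k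
  · simp only [wt_mul hDM, if_neg hf, Finset.sum_const_zero, norm_zero]
    positivity

set_option maxHeartbeats 800000 in
lemma Tv_bound {M D : F[X]} (h2F : (2 : F) ≠ 0) (hM : M.Monic) (hsqM : Squarefree M) (hD : D.Monic) (hDM : D ∣ M) [Fintype (F[X] ⧸ Ideal.span {D})]
    (ψ : AddChar (F[X] ⧸ Ideal.span {D}) ℂ) (hψ : ψ.IsPrimitive) (A : ℝ) (hA : 0 ≤ A)
    (hE : ∀ k : ℕ, k < D.natDegree → ∀ S : Finset F[X], S ⊆ mon F k → (∀ f ∈ S, IsCoprime f D) →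
      (∑ a, (nu S (xi D) a : ℝ) ^ 2) ≤ A *
      ((Fintype.card F : ℝ) ^ ((2 : ℝ) * k) + (Fintype.card F : ℝ) ^ ((7 / 2 : ℝ) * k - D.natDegree / 2)))
    (B : ℝ) (hB1 : 1 ≤ B) (hB : ∀ f : F[X], f.Monic → f.natDegree ≤ 2 * M.natDegree → ((dv f).card : ℝ) ≤ B)
    (n U i j : ℕ) (hn1 : 6 * D.natDegree < 7 * n) (hn2 : 5 * n < 6 * D.natDegree) (hU : U = (4 * n - 3 * D.natDegree) / 5)
    (hij : i + j ≤ n) (hc : (U < i ∧ U < j) ∨ (i ≤ U ∧ j ≤ U)) :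
    ‖Tv (wt M D ψ) i j (n - i - j)‖ ≤ B ^ 2 * (4 * A ^ 2 + 1) * (Fintype.card F : ℝ) ^ ((6 * D.natDegree + 25 * n : ℝ) / 32) := by
  have hq1 : (1 : ℝ) < Fintype.card F := by exact_mod_cast one_lt_q
  have hmN : D.natDegree ≤ M.natDegree := natDegree_le_of_dvd hDM hM.ne_zero
  have hB0 : 0 ≤ B := by linarith
  obtain ⟨k, hk⟩ : ∃ k, k = n - i - j := ⟨_, rfl⟩
  rw [← hk]
  have key : ∀ (s t : ℕ) (α β : F[X] → ℂ), s + t = n → U < s → U < t → (∀ f ∈ mon F s, ‖α f‖ ≤ B) → (∀ f ∈ mon F t, ‖β f‖ ≤ B) →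
      ‖∑ f ∈ mon F s, ∑ g ∈ mon F t, α f * β g * wt M D ψ (f * g)‖ ≤ B ^ 2 * (4 * A ^ 2 + 1) * (Fintype.card F : ℝ) ^ ((6 * D.natDegree + 25 * n : ℝ) / 32) := by
    intro s t α β hst hs ht hα hβ
    have h := type_two_app hD hDM ψ hψ A hA hE s t n hst (by omega) (by omega) hn2 B B hB0 hB0 α β hα hβ
    refine le_of_pow_le_pow_left₀ (n := 8) (by norm_num) (by positivity) (h.trans ?_)
    rw [← pow_two B, mul_pow (B ^ 2 * (4 * A ^ 2 + 1)), mul_pow (B ^ 2)]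
    gcongr
    have h1 : (1 : ℝ) ≤ 4 * A ^ 2 + 1 := by nlinarith [sq_nonneg A]
    calc 4 * A ^ 2 ≤ 4 * A ^ 2 + 1 := by linarith
      _ ≤ (4 * A ^ 2 + 1) ^ 8 := le_self_pow₀ h1 (by norm_num)
  have hfil : ∀ (s : ℕ) (g : F[X]) (P : F[X] → Prop) [DecidablePred P] (v : F[X] → ℂ), s ≤ n → g ∈ mon F s → (∀ b, ‖v b‖ ≤ 1) → ‖∑ b ∈ (dv g).filter P, v b‖ ≤ B := by
    intro s g P _ v hs hg hv
    rw [mem_mon] at hg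
    calc _ ≤ ∑ b ∈ (dv g).filter P, (1 : ℝ) := (norm_sum_le _ _).trans (Finset.sum_le_sum fun b _ => hv b)
      _ = (((dv g).filter P).card : ℝ) := by simp
      _ ≤ ((dv g).card : ℝ) := by exact_mod_cast Finset.card_filter_le _ _
      _ ≤ B := hB g hg.1 (by omega)
  rcases hc with ⟨h1, h2⟩ | ⟨h1, h2⟩
  · rw [Tv_case1]
    have hh := key i (j + k) (fun a => (pmu a : ℂ)) (fun g => ∑ b ∈ (dv g).filter (fun b => b.natDegree = j), (pmu b : ℂ)) (by omega) h1 (by omega) (fun f _ => (pmu_norm_le f).trans hB1)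
      (fun g hg => hfil (j + k) g (fun b => b.natDegree = j) (fun b => (pmu b : ℂ)) (by omega) hg (fun b => pmu_norm_le b))
    exact hh
  · by_cases h3 : U < i + j
    · rw [Tv_case2]
      refine key (i + j) k (fun g => ∑ a ∈ (dv g).filter (fun b => b.natDegree = i), (pmu a : ℂ) * (pmu (g / a) : ℂ)) (fun _ => 1) (by omega) h3 (by omega) ?_ ?_
      · intro g hg
        refine hfil (i + j) g (fun b => b.natDegree = i) (fun a => (pmu a : ℂ) * (pmu (g / a) : ℂ)) (by omega) hg (fun b => ?_)
        rw [norm_mul]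
        exact mul_le_one₀ (pmu_norm_le b) (norm_nonneg _) (pmu_norm_le _)
      · intro f _; simpa using hB1
    · set q : ℝ := (Fintype.card F : ℝ) with hqdef
      set m := D.natDegree with hm
      have hq0 : 0 < q := by linarith
      have h4 : ‖Tv (wt M D ψ) i j k‖ ≤ ∑ a ∈ mon F i, ∑ b ∈ mon F j, (B * (B * q ^ ((3 / 4 : ℝ) * m) * q ^ (k - m))) := by
        unfold Tv
        refine (norm_sum_le _ _).trans (Finset.sum_le_sum fun a _ => (norm_sum_le _ _).trans (Finset.sum_le_sum fun b _ => ?_))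
        rw [← Finset.mul_sum, norm_mul, norm_mul]
        have h5 := wt_type_one h2F hM hsqM hD hDM ψ hψ (a * b) k
        have h6 := hB M hM (by omega)
        calc _ ≤ 1 * ‖∑ c ∈ mon F k, wt M D ψ (a * b * c)‖ := by
              gcongr
              exact mul_le_one₀ (pmu_norm_le a) (norm_nonneg _) (pmu_norm_le b)
          _ ≤ ((dv M).card : ℝ) * (((dv M).card : ℝ) * q ^ ((3 / 4 : ℝ) * m) * q ^ (k - m)) := by rw [one_mul]; exact h5
          _ ≤ _ := by gcongr
      refine h4.trans ?_
      rw [Finset.sum_const, Finset.sum_const, nsmul_eq_mul, nsmul_eq_mul, card_mon, card_mon]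
      push_cast
      rw [← hqdef]
      have h7 : q ^ i * (q ^ j * (B * (B * q ^ ((3 / 4 : ℝ) * m) * q ^ (k - m)))) = B ^ 2 * (q ^ ((i : ℝ) + j + 3 / 4 * m + ((k - m : ℕ) : ℝ))) := by
        rw [Real.rpow_add hq0, Real.rpow_add hq0, Real.rpow_add hq0, Real.rpow_natCast, Real.rpow_natCast, Real.rpow_natCast]
        ring
      rw [h7, mul_assoc]
      gcongr
      have h8 : q ^ ((i : ℝ) + j + 3 / 4 * m + ((k - m : ℕ) : ℝ)) ≤ q ^ ((6 * m + 25 * n : ℝ) / 32) := by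
        apply Real.rpow_le_rpow_of_exponent_le hq1.le
        have r4 : 5 * (n : ℝ) ≤ 6 * m := by exact_mod_cast hn2.le
        have r5 : 6 * (m : ℝ) ≤ 7 * n := by exact_mod_cast hn1.le
        have r6 : 5 * ((i : ℝ) + j) + 3 * m ≤ 4 * n := by exact_mod_cast (by omega : 5 * (i + j) + 3 * m ≤ 4 * n)
        have r7 : (n : ℝ) = i + j + k := by exact_mod_cast (by omega : n = i + j + k)
        by_cases hkm : m ≤ k
        · rw [Nat.cast_sub hkm]; linarith
        · rw [Nat.sub_eq_zero_of_le (by omega)]; push_cast; linarith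
      have h9 : 0 ≤ q ^ ((6 * m + 25 * n : ℝ) / 32) := by positivity
      refine h8.trans ?_
      nlinarith [mul_nonneg (sq_nonneg A) h9]

lemma poly_le (F : Type) [Field F] [Fintype F] (ε : ℝ) (hε : 0 < ε) : ∃ C : ℝ, 0 < C ∧ ∀ n : ℕ, ((n : ℝ) + 1) ^ 2 ≤ C * (Fintype.card F : ℝ) ^ (ε * n) := by
  have hq1 : (1 : ℝ) < Fintype.card F := by exact_mod_cast one_lt_q
  set q : ℝ := (Fintype.card F : ℝ)
  have hq0 : 0 < q := by linarith
  set c := ε / 2 * Real.log q with hc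
  have hc0 : 0 < c := by have := Real.log_pos hq1; positivity
  refine ⟨(1 / c + 1) ^ 2, by positivity, fun n => ?_⟩
  have h1 : q ^ (ε * n) = (Real.exp (c * n)) ^ 2 := by
    rw [Real.rpow_def_of_pos hq0, ← Real.exp_nat_mul]; congr 1; rw [hc]; push_cast; ring
  rw [h1, ← mul_pow]
  have h2 := Real.add_one_le_exp (c * n)
  have h3 : (n : ℝ) = 1 / c * (c * n) := by field_simp
  have h4 : (0 : ℝ) ≤ c * n := by positivity
  gcongr
  have h5 : 0 < 1 / c := by positivity
  calc (n : ℝ) + 1 = 1 / c * (c * n) + 1 := by rw [← h3]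
    _ ≤ (1 / c + 1) * (c * n + 1) := by nlinarith
    _ ≤ _ := by gcongr

theorem middle (F : Type) [Field F] [Fintype F] (h2F : (2 : F) ≠ 0) (ε : ℝ) (hε : 0 < ε) : ∃ C : ℝ, 0 < C ∧ ∀ M D : F[X], M.Monic → Squarefree M →
    D.Monic → D ∣ M → ∀ ψ : AddChar (F[X] ⧸ Ideal.span {D}) ℂ, ψ.IsPrimitive → ∀ n : ℕ, 6 * D.natDegree < 7 * n → 5 * n < 6 * D.natDegree →
    ‖∑ f ∈ mon F n, (pmu f : ℂ) * wt M D ψ f‖ ≤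
      C * (Fintype.card F : ℝ) ^ (ε * M.natDegree) * (Fintype.card F : ℝ) ^ ((6 * D.natDegree + 25 * n : ℝ) / 32) := by
  have hq1 : (1 : ℝ) < Fintype.card F := by exact_mod_cast one_lt_q
  have he : 0 < ε / 8 := by positivity
  obtain ⟨C1, hC1, h1⟩ := dv_bound F (ε / 8) he
  obtain ⟨C2, hC2, h2⟩ := poly_le F (ε / 8) he
  obtain ⟨C3, hC3, h3⟩ := energy_bound F h2F (ε / 8) he
  refine ⟨C2 * (C1 ^ 2 * (4 * C3 ^ 2 + 1)), by positivity, ?_⟩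
  intro M D hM hsqM hD hDM ψ hψ n hn1 hn2
  have hmN : D.natDegree ≤ M.natDegree := natDegree_le_of_dvd hDM hM.ne_zero
  have := quot_finite hD
  have := Fintype.ofFinite (F[X] ⧸ Ideal.span {D})
  have hsqD : Squarefree D := hsqM.squarefree_of_dvd hDM
  set q : ℝ := (Fintype.card F : ℝ) with hqdef
  have hq0 : 0 < q := by linarith
  set P := q ^ (ε / 8 * M.natDegree) with hP
  have hP1 : 1 ≤ P := Real.one_le_rpow hq1.le (by positivity)
  have hP2 : ∀ d : ℕ, d ≤ 2 * M.natDegree → q ^ (ε / 8 * d) ≤ P ^ 2 := by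
    intro d hd
    rw [hP, ← Real.rpow_natCast (q ^ _), ← Real.rpow_mul hq0.le]
    apply Real.rpow_le_rpow_of_exponent_le hq1.le
    have : (d : ℝ) ≤ 2 * M.natDegree := by exact_mod_cast hd
    push_cast
    nlinarith
  have hB : ∀ f : F[X], f.Monic → f.natDegree ≤ 2 * M.natDegree → ((dv f).card : ℝ) ≤ C1 * P ^ 2 := by
    intro f hf hd
    refine (h1 f hf.ne_zero).trans ?_
    gcongr
    exact hP2 _ hd
  have hE : ∀ k : ℕ, k < D.natDegree → ∀ S : Finset F[X], S ⊆ mon F k → (∀ f ∈ S, IsCoprime f D) →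
      (∑ a, (nu S (xi D) a : ℝ) ^ 2) ≤ (C3 * P) *
      (q ^ ((2 : ℝ) * k) + q ^ ((7 / 2 : ℝ) * k - D.natDegree / 2)) := by
    intro k hk S hS hSc
    refine (h3 D hD hsqD k hk S hS hSc).trans ?_
    gcongr
    exact Real.rpow_le_rpow_of_exponent_le hq1.le (by gcongr)
  have hT := vaughan_bound (wt M D ψ) n ((4 * n - 3 * D.natDegree) / 5) (by omega) _
    (fun i j hij hc => Tv_bound h2F hM hsqM hD hDM ψ hψ (C3 * P) (by positivity) hE (C1 * P ^ 2) (by nlinarith [one_le_pow₀ hP1 (n := 2)]) hB n _ i j hn1 hn2 rfl hij hc)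
  rw [Sv] at hT
  refine hT.trans ?_
  have h5 : ((n : ℝ) + 1) ^ 2 ≤ C2 * P ^ 2 := (h2 n).trans (by gcongr; exact hP2 n (by omega))
  have h6 : 4 * (C3 * P) ^ 2 + 1 ≤ (4 * C3 ^ 2 + 1) * P ^ 2 := by nlinarith [one_le_pow₀ hP1 (n := 2)]
  have h7 : q ^ (ε * M.natDegree) = P ^ 8 := by
    rw [hP, ← Real.rpow_natCast (q ^ _), ← Real.rpow_mul hq0.le]; congr 1; push_cast; ring
  rw [h7, ← hqdef]
  set Y := q ^ ((6 * D.natDegree + 25 * n : ℝ) / 32)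
  have hY : 0 < Y := by positivity
  calc _ ≤ (C2 * P ^ 2) * ((C1 * P ^ 2) ^ 2 * ((4 * C3 ^ 2 + 1) * P ^ 2) * Y) := by gcongr
    _ = _ := by ring

end Mid
end FM

open scoped Classical
open Polynomial Filter
set_option linter.unusedSectionVars false
set_option linter.unusedVariables false
set_option linter.style.haveILetI false
namespace FM
section Fin
variable {F : Type} [Field F] [Fintype F]

theorem per_n (F : Type) [Field F] [Fintype F] (h2F : (2 : F) ≠ 0) (ε : ℝ) (hε : 0 < ε) : ∃ C : ℝ, 0 < C ∧ ∀ M D : F[X], M.Monic → Squarefree M →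
    D.Monic → D ∣ M → ∀ ψ : AddChar (F[X] ⧸ Ideal.span {D}) ℂ, ψ.IsPrimitive → ∀ n : ℕ,
    ‖∑ f ∈ mon F n, (pmu f : ℂ) * wt M D ψ f‖ ≤
      C * (Fintype.card F : ℝ) ^ (ε * M.natDegree) * (Fintype.card F : ℝ) ^ ((6 * D.natDegree + 25 * n : ℝ) / 32) := by
  have hq1 : (1 : ℝ) < Fintype.card F := by exact_mod_cast one_lt_q
  obtain ⟨C1, hC1, h1⟩ := middle F h2F ε hε
  set e0 := min ε (1 / 48) with he0
  have he0p : 0 < e0 := lt_min hε (by norm_num)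
  have he1 : e0 ≤ ε := min_le_left _ _
  have he2 : e0 ≤ 1 / 48 := min_le_right _ _
  obtain ⟨C2, hC2, h2⟩ := large_n F e0 he0p
  refine ⟨C1 + C2 + 1, by positivity, ?_⟩
  intro M D hM hsqM hD hDM ψ hψ n
  set q : ℝ := (Fintype.card F : ℝ) with hqdef
  have hq0 : 0 < q := by linarith
  set N := M.natDegree
  set m := D.natDegree
  have hP1 : 1 ≤ q ^ (ε * N) := Real.one_le_rpow hq1.le (by positivity)
  by_cases c1 : 7 * n ≤ 6 * m
  · calc ‖∑ f ∈ mon F n, (pmu f : ℂ) * wt M D ψ f‖ ≤ ∑ f ∈ mon F n, (1 : ℝ) := by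
          refine (norm_sum_le _ _).trans (Finset.sum_le_sum fun f _ => ?_)
          rw [norm_mul]
          exact mul_le_one₀ (pmu_norm_le f) (norm_nonneg _) (wt_norm hD ψ f)
      _ = q ^ (n : ℝ) := by
          rw [Finset.sum_const, card_mon, Real.rpow_natCast, hqdef]; simp
      _ ≤ q ^ ((6 * m + 25 * n : ℝ) / 32) := by
          apply Real.rpow_le_rpow_of_exponent_le hq1.le
          have : 7 * (n : ℝ) ≤ 6 * m := by exact_mod_cast c1
          linarith
      _ = 1 * 1 * q ^ ((6 * m + 25 * n : ℝ) / 32) := by ring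
      _ ≤ _ := by gcongr; linarith
  · by_cases c2 : 5 * n < 6 * m
    · refine (h1 M D hM hsqM hD hDM ψ hψ n (by omega) c2).trans ?_
      gcongr
      linarith
    · refine (h2 M D hM hsqM hD hDM ψ n).trans ?_
      have r1 : 6 * (m : ℝ) ≤ 5 * n := by exact_mod_cast not_lt.mp c2
      have r2 : (0 : ℝ) ≤ n := by positivity
      have r3 : (0 : ℝ) ≤ N := by positivity
      calc q ^ ((1 / 2 : ℝ) * m) * (C2 * q ^ (e0 * N) * q ^ ((1 / 2 + e0) * n))
          = C2 * q ^ (e0 * N) * q ^ ((1 / 2 : ℝ) * m + (1 / 2 + e0) * n) := by rw [Real.rpow_add hq0]; ring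
        _ ≤ (C1 + C2 + 1) * q ^ (ε * N) * q ^ ((6 * m + 25 * n : ℝ) / 32) := by
          have s1 : q ^ (e0 * N) ≤ q ^ (ε * N) := Real.rpow_le_rpow_of_exponent_le hq1.le (by gcongr)
          have s2 : q ^ ((1 / 2 : ℝ) * m + (1 / 2 + e0) * n) ≤ q ^ ((6 * m + 25 * n : ℝ) / 32) :=
            Real.rpow_le_rpow_of_exponent_le hq1.le (by nlinarith)
          gcongr
          linarith

lemma ring_inv_of_mul {R : Type} [CommRing R] {x y : R} (h : x * y = 1) : Ring.inverse x = y := by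
  exact Ring.inverse_unit (⟨x, y, h, by rw [mul_comm]; exact h⟩ : Rˣ)

/-- reduction to a primitive character -/
lemma conductor {M : F[X]} (hM : M.Monic) (ψ : AddChar (F[X] ⧸ Ideal.span {M}) ℂ) :
    ∃ D : F[X], D.Monic ∧ D ∣ M ∧ ∃ ψ' : AddChar (F[X] ⧸ Ideal.span {D}) ℂ, ψ'.IsPrimitive ∧
      ∀ f, IsCoprime f M → ψ (Ring.inverse (Ideal.Quotient.mk (Ideal.span {M}) f)) = wt M D ψ' f := by
  let I : Ideal F[X] :=
    { carrier := {c | ∀ y, ψ (Ideal.Quotient.mk _ (c * y)) = 1}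
      add_mem' := by
        intro a b ha hb y
        rw [add_mul, map_add (Ideal.Quotient.mk (Ideal.span {M})), AddChar.map_add_eq_mul, ha y, hb y, one_mul]
      zero_mem' := by
        intro y
        rw [zero_mul, map_zero (Ideal.Quotient.mk (Ideal.span {M})), AddChar.map_zero_eq_one]
      smul_mem' := by
        intro c x hx y
        have := hx (c * y)
        rwa [← mul_assoc, mul_comm x c] at this }
  have hI : ∀ c, c ∈ I ↔ ∀ y, ψ (Ideal.Quotient.mk _ (c * y)) = 1 := fun c => Iff.rfl
  have hMI : M ∈ I := by
    rw [hI]; intro y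
    rw [mk_eq_zero_iff.mpr (dvd_mul_right M y), AddChar.map_zero_eq_one]
  obtain ⟨D0, hD0⟩ := (IsPrincipalIdealRing.principal I).principal
  have hdvd : ∀ c, c ∈ I ↔ D0 ∣ c := by
    intro c
    rw [hD0]; exact Ideal.mem_span_singleton
  have hD00 : D0 ≠ 0 := by
    rintro rfl
    exact hM.ne_zero (zero_dvd_iff.mp ((hdvd M).mp hMI))
  obtain ⟨D, hDdef⟩ : ∃ D, D = normalize D0 := ⟨_, rfl⟩
  have hDm : D.Monic := by rw [hDdef]; exact monic_normalize hD00
  have hdv : ∀ c, c ∈ I ↔ D ∣ c := by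
    intro c; rw [hdvd, hDdef, normalize_dvd_iff]
  have hDM : D ∣ M := (hdv M).mp hMI
  have hwell : ∀ f g : F[X], Ideal.Quotient.mk (Ideal.span {D}) f = Ideal.Quotient.mk (Ideal.span {D}) g →
      ψ (Ideal.Quotient.mk _ f) = ψ (Ideal.Quotient.mk _ g) := by
    intro f g h
    have h1 := (hI _).mp ((hdv _).mpr (mk_eq_iff.mp h)) 1
    have h2 : f = (f - g) * 1 + g := by ring
    rw [h2, map_add (Ideal.Quotient.mk (Ideal.span {M})), AddChar.map_add_eq_mul, h1, one_mul]
  choose rep hrep using (Ideal.Quotient.mk_surjective (I := Ideal.span {D}))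
  let ψ' : AddChar (F[X] ⧸ Ideal.span {D}) ℂ :=
    { toFun := fun x => ψ (Ideal.Quotient.mk _ (rep x))
      map_zero_eq_one' := by
        rw [hwell (rep 0) 0 (by rw [hrep, map_zero]), map_zero (Ideal.Quotient.mk (Ideal.span {M})), AddChar.map_zero_eq_one]
      map_add_eq_mul' := by
        intro x y
        rw [hwell (rep (x + y)) (rep x + rep y) (by rw [map_add, hrep, hrep, hrep]), map_add (Ideal.Quotient.mk (Ideal.span {M})), AddChar.map_add_eq_mul] }
  have hψ' : ∀ f, ψ' (Ideal.Quotient.mk _ f) = ψ (Ideal.Quotient.mk _ f) := by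
    intro f
    exact hwell _ _ (hrep _)
  refine ⟨D, hDm, hDM, ψ', ?_, ?_⟩
  · intro a ha hcontra
    apply ha
    obtain ⟨c, rfl⟩ := Ideal.Quotient.mk_surjective a
    rw [mk_eq_zero_iff, ← hdv, hI]
    intro y
    rw [← hψ', map_mul (Ideal.Quotient.mk (Ideal.span {D}))]
    have := DFunLike.congr_fun hcontra (Ideal.Quotient.mk _ y)
    rwa [AddChar.mulShift_apply, AddChar.one_apply] at this
  · intro f hf
    obtain ⟨a, b, hab⟩ := id hf
    rw [wt, if_pos hf]
    have h1 : Ring.inverse (Ideal.Quotient.mk (Ideal.span {M}) f) = Ideal.Quotient.mk (Ideal.span {M}) a := by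
      apply ring_inv_of_mul
      rw [← map_mul, ← map_one (Ideal.Quotient.mk (Ideal.span {M})), mk_eq_iff]
      exact ⟨-b, by linear_combination hab⟩
    have h2 : Ring.inverse (Ideal.Quotient.mk (Ideal.span {D}) f) = Ideal.Quotient.mk (Ideal.span {D}) a := by
      apply ring_inv_of_mul
      rw [← map_mul, ← map_one (Ideal.Quotient.mk (Ideal.span {D})), mk_eq_iff]
      exact hDM.trans ⟨-b, by linear_combination hab⟩
    rw [h1, h2, hψ']

lemma finsum_eq {M : F[X]} (d : ℕ) (v w : F[X] → ℂ) (hw : ∀ f, IsCoprime f M → v f = w f) (hw0 : ∀ f, ¬ IsCoprime f M → w f = 0) :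
    (∑ᶠ f ∈ {f : Polynomial F | f.Monic ∧ pnorm f ≤ (Fintype.card F : ℝ) ^ d ∧ IsCoprime f M}, (pmu f : ℂ) * v f)
      = ∑ n ∈ Finset.range (d + 1), ∑ f ∈ mon F n, (pmu f : ℂ) * w f := by
  have hq1 : (1 : ℝ) < Fintype.card F := by exact_mod_cast one_lt_q
  have hset : {f : Polynomial F | f.Monic ∧ pnorm f ≤ (Fintype.card F : ℝ) ^ d ∧ IsCoprime f M}
      = ↑((Finset.range (d + 1)).biUnion (fun n => (mon F n).filter (fun f => IsCoprime f M))) := by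
    ext f
    simp only [Set.mem_ofPred_eq, Finset.coe_biUnion, Set.mem_iUnion, Finset.mem_coe, Finset.mem_filter, mem_mon, Finset.mem_range]
    constructor
    · rintro ⟨h1, h2, h3⟩
      refine ⟨f.natDegree, ?_, ⟨h1, rfl⟩, h3⟩
      rw [pnorm, if_neg h1.ne_zero] at h2
      have := (pow_le_pow_iff_right₀ hq1).mp h2
      omega
    · rintro ⟨n, hn, ⟨h1, h2⟩, h3⟩
      refine ⟨h1, ?_, h3⟩
      rw [pnorm, if_neg h1.ne_zero]
      exact (pow_le_pow_iff_right₀ hq1).mpr (by omega)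
  rw [hset, finsum_mem_coe_finset, Finset.sum_biUnion]
  · apply Finset.sum_congr rfl; intro n _
    rw [Finset.sum_filter]
    apply Finset.sum_congr rfl; intro f _
    split_ifs with h
    · rw [hw f h]
    · rw [hw0 f h, mul_zero]
  · intro a _ b _ hab
    rw [Function.onFun, Finset.disjoint_left]
    intro f h1 h2
    exact hab ((mem_mon.mp (Finset.mem_filter.mp h1).1).2.symm.trans (mem_mon.mp (Finset.mem_filter.mp h2).1).2)

lemma geom_le (r : ℝ) (hr : 1 < r) (d : ℕ) : ∑ n ∈ Finset.range (d + 1), r ^ n ≤ r / (r - 1) * r ^ d := by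
  have h0 : 0 < r - 1 := by linarith
  rw [geom_sum_eq hr.ne', div_mul_eq_mul_div, pow_succ]
  gcongr
  linarith [mul_comm r (r ^ d)]

theorem final (F : Type) [Field F] [Fintype F] (hodd : Odd (Fintype.card F)) (ε : ℝ) (hε : 0 < ε) :
    ∃ C : ℝ, ∀ M : Polynomial F, M.Monic → Squarefree M →
      ∀ ψ : AddChar (Polynomial F ⧸ Ideal.span {M}) ℂ, ∀ d : ℕ,
      ‖(∑ᶠ f ∈ {f : Polynomial F |
            f.Monic ∧ pnorm f ≤ (Fintype.card F : ℝ) ^ d ∧ IsCoprime f M},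
          (pmu f : ℂ) * ψ (Ring.inverse (Ideal.Quotient.mk (Ideal.span {M}) f)))‖
        ≤ C * (pnorm M) ^ ((3 : ℝ) / 16 + ε) * ((Fintype.card F : ℝ) ^ d) ^ ((25 : ℝ) / 32) := by
  have h2F : (2 : F) ≠ 0 := by
    apply Ring.two_ne_zero
    intro h
    have := FiniteField.even_card_iff_char_two.mp h
    have := Nat.odd_iff.mp hodd
    omega
  have hq1 : (1 : ℝ) < Fintype.card F := by exact_mod_cast one_lt_q
  obtain ⟨C, hC, h⟩ := per_n F h2F ε hε
  set q : ℝ := (Fintype.card F : ℝ) with hqdef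
  have hq0 : 0 < q := by linarith
  set r := q ^ ((25 : ℝ) / 32) with hr
  have hr1 : 1 < r := Real.one_lt_rpow hq1 (by norm_num)
  have hr0 : 0 < r - 1 := by linarith
  refine ⟨C * (r / (r - 1)), ?_⟩
  intro M hM hsqM ψ d
  obtain ⟨D, hD, hDM, ψ', hψ', hf⟩ := conductor hM ψ
  rw [hqdef, finsum_eq d (fun f => ψ (Ring.inverse (Ideal.Quotient.mk (Ideal.span {M}) f))) (wt M D ψ') hf (fun f hf => by rw [wt, if_neg hf]), ← hqdef]
  have hmN : (D.natDegree : ℝ) ≤ M.natDegree := by exact_mod_cast natDegree_le_of_dvd hDM hM.ne_zero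
  rw [pnorm, if_neg hM.ne_zero, ← hqdef]
  have e1 : (q ^ M.natDegree) ^ ((3 : ℝ) / 16 + ε) = q ^ (ε * M.natDegree) * q ^ (3 / 16 * M.natDegree : ℝ) := by
    rw [← Real.rpow_natCast, ← Real.rpow_mul hq0.le, ← Real.rpow_add hq0]; congr 1; ring
  have e2 : (q ^ d) ^ ((25 : ℝ) / 32) = r ^ d := by
    rw [hr, ← Real.rpow_natCast, ← Real.rpow_natCast, ← Real.rpow_mul hq0.le, ← Real.rpow_mul hq0.le, mul_comm]
  have e3 : ∀ n : ℕ, q ^ ((6 * D.natDegree + 25 * n : ℝ) / 32) = q ^ (3 / 16 * D.natDegree : ℝ) * r ^ n := by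
    intro n
    rw [hr, ← Real.rpow_natCast (q ^ ((25 : ℝ) / 32)), ← Real.rpow_mul hq0.le, ← Real.rpow_add hq0]; congr 1; ring
  rw [e1, e2]
  have e4 : q ^ (3 / 16 * D.natDegree : ℝ) ≤ q ^ (3 / 16 * M.natDegree : ℝ) :=
    Real.rpow_le_rpow_of_exponent_le hq1.le (by linarith)
  calc _ ≤ ∑ n ∈ Finset.range (d + 1), C * q ^ (ε * M.natDegree) * (q ^ (3 / 16 * D.natDegree : ℝ) * r ^ n) := by
        refine (norm_sum_le _ _).trans (Finset.sum_le_sum fun n _ => ?_)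
        rw [← e3]
        exact h M D hM hsqM hD hDM ψ' hψ' n
    _ = C * q ^ (ε * M.natDegree) * (q ^ (3 / 16 * D.natDegree : ℝ) * ∑ n ∈ Finset.range (d + 1), r ^ n) := by
        rw [Finset.mul_sum, Finset.mul_sum]
    _ ≤ C * q ^ (ε * M.natDegree) * (q ^ (3 / 16 * M.natDegree : ℝ) * (r / (r - 1) * r ^ d)) := by
        have := geom_le r hr1 d
        gcongr
    _ = _ := by ring

end Fin
end FM

theorem statement5 (q : ℕ) (hq : IsPrimePow q) (hodd : Odd q) (ε : ℝ) (hε : 0 < ε)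
    (Fq : Type) [Field Fq] [Fintype Fq] (hcard : Fintype.card Fq = q) :
    ∃ C : ℝ, ∀ M : Polynomial Fq, M.Monic → Squarefree M →
      ∀ ψ : AddChar (Polynomial Fq ⧸ Ideal.span {M}) ℂ, ∀ d : ℕ,
      ‖(∑ᶠ f ∈ {f : Polynomial Fq |
            f.Monic ∧ pnorm f ≤ (q : ℝ) ^ d ∧ IsCoprime f M},
          (pmu f : ℂ) * ψ (Ring.inverse (Ideal.Quotient.mk (Ideal.span {M}) f)))‖
        ≤ C * (pnorm M) ^ ((3 : ℝ) / 16 + ε) * ((q : ℝ) ^ d) ^ ((25 : ℝ) / 32) := by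
  subst hcard
  exact FM.final Fq hodd ε hε
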